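/- Let k be an algebraically closed field. (1) For every generating pattern X on [6] there exists a permutation π of [6] such that the coordinate-permuted set {(a_{π(1)},…,a_{π(6)}) : a ∈ V_X} is one of the following subsets of k^6: a coordinate subspace V(χ_i : i ∈ S) for some S ⊆ [6] with |S| ≠ 5 (i.e. of dimension ≠ 1); V(χ_1, χ_4χ_6); V(χ_4χ_6); V(χ_4χ_6, χ_5χ_6); V(χ_2χ_4χ_6); or V(χ_1χ_3χ_5 + χ_2χ_4χ_6). (2) Conversely, every variety in this list equals V_X for some generating pattern X on [6]. -/

import Mathlib

open scoped Classical

noncomputable section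

/-- A *generating pattern* on `[n]`: a finite set `X` of nonempty subsets of `Fin n`
such that for all `i ≠ j` there is `σ ∈ X` with `i ∈ σ` and `j ∉ σ`. -/
def IsGenPattern (n : ℕ) (X : Finset (Finset (Fin n))) : Prop :=
  (∀ σ ∈ X, σ.Nonempty) ∧ ∀ i j : Fin n, i ≠ j → ∃ σ ∈ X, i ∈ σ ∧ j ∉ σ

/-- Adjacency in the GCD graph of a generating pattern. -/
def GcdAdj {n : ℕ} (X : Finset (Finset (Fin n))) (i j : Fin n) : Prop :=
  i ≠ j ∧ ∃ σ ∈ X, i ∈ σ ∧ j ∈ σ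

/-- The neighborhood of a set of vertices in the GCD graph. -/
def Nbhd {n : ℕ} (X : Finset (Finset (Fin n))) (S : Finset (Fin n)) : Finset (Fin n) :=
  Finset.univ.filter fun j => ∃ i ∈ S, GcdAdj X i j

/-- The differential edge `d_{σ,i}` (from `σ ∪ {i}` to `σ`) exists. -/
def DiffEdge {n : ℕ} (X : Finset (Finset (Fin n))) (σ : Finset (Fin n)) (i : Fin n) : Prop :=
  i ∉ σ ∧ ∀ τ ∈ X, i ∈ τ → (τ ∩ σ).Nonempty

/-- The homotopy edge `h_{σ,i}` (from `σ` to `σ ∪ {i}`) exists. -/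
def HomEdge {n : ℕ} (X : Finset (Finset (Fin n))) (σ : Finset (Fin n)) (i : Fin n) : Prop :=
  i ∉ σ ∧ i ∉ Nbhd X σ

/-- `sign(σ, i) = (-1)^{|{j ∈ σ : j < i}|}`. -/
def edgeSign {n : ℕ} (σ : Finset (Fin n)) (i : Fin n) : ℤ :=
  (-1) ^ (σ.filter fun j => j < i).card

/-- The Taylor matrix of the generating pattern `X`, evaluated at the point `a : Fin n → k`. -/
def taylorMatrixAt {n : ℕ} {k : Type*} [Field k] (X : Finset (Finset (Fin n)))
    (a : Fin n → k) : Matrix (Finset (Fin n)) (Finset (Fin n)) k :=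
  fun r c =>
    (∑ i : Fin n, if c = insert i r ∧ DiffEdge X r i then (edgeSign r i : k) else 0) +
      ∑ i : Fin n, if r = insert i c ∧ HomEdge X c i then (edgeSign c i : k) * a i else 0

/-- The cohomological support variety `V_X ⊆ k^n`: the locus where all
`2^(n-1) × 2^(n-1)` minors of the Taylor matrix vanish. -/
def supportVariety {n : ℕ} (k : Type*) [Field k] (X : Finset (Finset (Fin n))) :
    Set (Fin n → k) :=
  { a | ∀ f g : Fin (2 ^ (n - 1)) → Finset (Fin n),
      Function.Injective f → Function.Injective g →
      ((taylorMatrixAt X a).submatrix f g).det = 0 }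

/-- The list of candidate support varieties appearing in Theorem A (coordinates `0..5`
correspond to `χ_1,…,χ_6`). -/
def VarietyListSix (k : Type*) [Field k] (V : Set (Fin 6 → k)) : Prop :=
  (∃ S : Finset (Fin 6), S.card ≠ 5 ∧ V = {a | ∀ i ∈ S, a i = 0}) ∨
  V = {a | a 0 = 0 ∧ a 3 * a 5 = 0} ∨
  V = {a | a 3 * a 5 = 0} ∨
  V = {a | a 3 * a 5 = 0 ∧ a 4 * a 5 = 0} ∨
  V = {a | a 1 * a 3 * a 5 = 0} ∨
  V = {a | a 0 * a 2 * a 4 + a 1 * a 3 * a 5 = 0}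



/-! ### Core linear algebra -/

/-- flip membership of `i` in `r` -/
def flp (r : Finset (Fin 6)) (i : Fin 6) : Finset (Fin 6) :=
  if i ∈ r then r.erase i else insert i r

theorem mem_flp {r : Finset (Fin 6)} {i j : Fin 6} :
    j ∈ flp r i ↔ (j ≠ i ∧ j ∈ r) ∨ (j = i ∧ i ∉ r) := by
  unfold flp
  split_ifs with h
  · simp only [Finset.mem_erase]; tauto
  · simp only [Finset.mem_insert]
    constructor
    · rintro (rfl | h2)
      · exact Or.inr ⟨rfl, h⟩
      · refine Or.inl ⟨?_, h2⟩
        rintro rfl; exact h h2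
    · tauto

theorem flp_flp (r : Finset (Fin 6)) (i : Fin 6) : flp (flp r i) i = r := by
  ext j; simp only [mem_flp]; by_cases h : j = i
  · subst h; simp
  · simp [h]

theorem flp_comm (r : Finset (Fin 6)) (i j : Fin 6) : flp (flp r i) j = flp (flp r j) i := by
  ext l; simp only [mem_flp]
  by_cases h1 : l = i <;> by_cases h2 : l = j
  · subst h1; subst h2; rfl
  · subst h1; simp [h2]
  · subst h2; simp [h1]
  · simp [h1, h2]

theorem flp_inj {r : Finset (Fin 6)} {i j : Fin 6} (h : flp r i = flp r j) : i = j := by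
  by_contra hne
  have : i ∈ flp r i ↔ i ∈ flp r j := by rw [h]
  simp [mem_flp, hne] at this

/-- edge existence in uniform form -/
def EE (X : Finset (Finset (Fin 6))) (r : Finset (Fin 6)) (i : Fin 6) : Prop :=
  ∀ τ ∈ X, i ∈ τ → (i ∈ r ↔ Disjoint τ (r.erase i))

def sgn (R : Type*) [CommRing R] (r : Finset (Fin 6)) (i : Fin 6) : R :=
  ∏ j ∈ r, if j < i then (-1 : R) else 1

def ent {k : Type*} [Field k] (X : Finset (Finset (Fin 6))) (a : Fin 6 → k)
    (r : Finset (Fin 6)) (i : Fin 6) : k :=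
  if EE X r i then sgn k r i * (if i ∈ r then a i else 1) else 0

theorem edgeSign_cast {k : Type*} [Field k] (r : Finset (Fin 6)) (i : Fin 6) :
    ((edgeSign r i : ℤ) : k) = sgn k r i := by
  unfold edgeSign sgn
  rw [Finset.prod_ite]
  simp

theorem sgn_erase {R : Type*} [CommRing R] (r : Finset (Fin 6)) (i : Fin 6) :
    sgn R (r.erase i) i = sgn R r i := by
  unfold sgn
  by_cases h : i ∈ r
  · rw [← Finset.mul_prod_erase r _ h]; simp
  · rw [Finset.erase_eq_of_notMem h]

theorem diffEdge_iff (X : Finset (Finset (Fin 6))) (r : Finset (Fin 6)) (i : Fin 6)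
    (h : i ∉ r) : DiffEdge X r i ↔ EE X r i := by
  unfold DiffEdge EE
  simp only [h, not_false_eq_true, true_and, Finset.erase_eq_of_notMem h, false_iff,
    Finset.not_disjoint_iff_nonempty_inter]

theorem homEdge_iff (X : Finset (Finset (Fin 6))) (r : Finset (Fin 6)) (i : Fin 6)
    (h : i ∈ r) : HomEdge X (r.erase i) i ↔ EE X r i := by
  unfold HomEdge EE Nbhd GcdAdj
  simp only [Finset.mem_erase, ne_eq, not_true_eq_false, false_and, not_false_eq_true, true_and,
    Finset.mem_filter, Finset.mem_univ, h, true_iff, not_exists, not_and,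
    Finset.disjoint_right, and_imp]
  constructor
  · intro H τ hτ hi j hji hj hjt
    exact H j hji hj hji τ hτ hjt hi
  · intro H j hji hj _ τ hτ hjt hi
    exact H τ hτ hi hji hj hjt

theorem taylor_eq {k : Type*} [Field k] (X : Finset (Finset (Fin 6))) (a : Fin 6 → k)
    (r c : Finset (Fin 6)) :
    taylorMatrixAt X a r c = ∑ i : Fin 6, if c = flp r i then ent X a r i else 0 := by
  unfold taylorMatrixAt
  rw [← Finset.sum_add_distrib]
  refine Finset.sum_congr rfl fun i _ => ?_
  by_cases h : i ∈ r
  · have h1 : ¬ (c = insert i r ∧ DiffEdge X r i) := fun hh => hh.2.1 h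
    rw [if_neg h1, zero_add]
    by_cases hc : c = flp r i
    · have hc' : c = r.erase i := by rw [hc, flp, if_pos h]
      subst hc'
      rw [if_pos hc]
      have hr : r = insert i (r.erase i) := (Finset.insert_erase h).symm
      unfold ent
      by_cases he : EE X r i
      · rw [if_pos ⟨hr, (homEdge_iff X r i h).2 he⟩, if_pos he, if_pos h, edgeSign_cast, sgn_erase]
      · rw [if_neg (fun hh => he ((homEdge_iff X r i h).1 hh.2)), if_neg he]
    · rw [if_neg hc, if_neg]
      rintro ⟨h2, h3⟩
      apply hc
      rw [flp, if_pos h, h2, Finset.erase_insert h3.1]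
  · have h1 : ¬ (r = insert i c ∧ HomEdge X c i) := fun hh => h (hh.1 ▸ Finset.mem_insert_self i c)
    rw [if_neg h1, add_zero]
    unfold ent flp
    rw [if_neg h, if_neg h]
    by_cases hc : c = insert i r
    · by_cases he : EE X r i
      · rw [if_pos ⟨hc, (diffEdge_iff X r i h).2 he⟩, if_pos hc, if_pos he, edgeSign_cast, mul_one]
      · rw [if_neg (fun hh => he ((diffEdge_iff X r i h).1 hh.2)), if_pos hc, if_neg he]
    · rw [if_neg (fun hh => hc hh.1), if_neg hc]

theorem taylor_flp {k : Type*} [Field k] (X : Finset (Finset (Fin 6))) (a : Fin 6 → k)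
    (r : Finset (Fin 6)) (i : Fin 6) :
    taylorMatrixAt X a r (flp r i) = ent X a r i := by
  rw [taylor_eq, Finset.sum_eq_single i]
  · simp
  · intro j _ hj
    rw [if_neg]
    intro h; exact hj (flp_inj h).symm
  · simp

theorem taylor_zero {k : Type*} [Field k] (X : Finset (Finset (Fin 6))) (a : Fin 6 → k)
    (r c : Finset (Fin 6)) (h : ∀ i, c = flp r i → ent X a r i = 0) :
    taylorMatrixAt X a r c = 0 := by
  rw [taylor_eq]
  refine Finset.sum_eq_zero fun i _ => ?_
  split_ifs with hc
  · exact h i hc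
  · rfl

theorem sgn_flp {R : Type*} [CommRing R] (r : Finset (Fin 6)) (i j : Fin 6) :
    sgn R (flp r i) j = sgn R r j * (if i < j then -1 else 1) := by
  unfold flp
  split_ifs with h h2 h2
  · unfold sgn; rw [← Finset.mul_prod_erase r _ h, if_pos h2]; ring
  · unfold sgn; rw [← Finset.mul_prod_erase r _ h, if_neg h2]; ring
  · unfold sgn; rw [Finset.prod_insert h, if_pos h2]; ring
  · unfold sgn; rw [Finset.prod_insert h, if_neg h2]; ring

theorem EE_swap {X : Finset (Finset (Fin 6))} {r : Finset (Fin 6)} {i j : Fin 6} (hij : i ≠ j)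
    (h1 : EE X r i) (h2 : EE X (flp r i) j) : EE X r j ∧ EE X (flp r j) i := by
  unfold EE at *
  simp only [Finset.disjoint_left, Finset.mem_erase, mem_flp] at *
  have hji := hij.symm
  constructor <;> intro τ hτ hm
  · have := h2 τ hτ hm
    by_cases hi : i ∈ τ
    · have h1' := h1 τ hτ hi
      grind
    · grind
  · have h1' := h1 τ hτ hm
    by_cases hj : j ∈ τ
    · have := h2 τ hτ hj
      grind
    · grind

theorem taylor_sq {k : Type*} [Field k] (X : Finset (Finset (Fin 6))) (hX : IsGenPattern 6 X)
    (a : Fin 6 → k) : taylorMatrixAt X a * taylorMatrixAt X a = 0 := by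
  ext r c
  rw [Matrix.mul_apply, Matrix.zero_apply]
  have h1 : ∀ m, taylorMatrixAt X a r m * taylorMatrixAt X a m c =
      ∑ i : Fin 6, ∑ j : Fin 6, if m = flp r i then
        (if c = flp (flp r i) j then ent X a r i * ent X a (flp r i) j else 0) else 0 := by
    intro m
    rw [taylor_eq, taylor_eq, Finset.sum_mul_sum]
    refine Finset.sum_congr rfl fun i _ => Finset.sum_congr rfl fun j _ => ?_
    split_ifs with h1 h2 h2 h2 <;> simp_all
  simp only [h1]
  rw [Finset.sum_comm]
  simp_rw [Finset.sum_comm (s := (Finset.univ : Finset (Finset (Fin 6))))]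
  simp only [Finset.sum_ite_eq', Finset.mem_univ, if_true]
  rw [← Finset.sum_product' (f := fun i j => if c = flp (flp r i) j then
    ent X a r i * ent X a (flp r i) j else 0)]
  have key : ∀ i j, i ≠ j → ent X a r i * ent X a (flp r i) j +
      ent X a r j * ent X a (flp r j) i = 0 := by
    intro i j hij
    unfold ent
    by_cases hA : EE X r i ∧ EE X (flp r i) j
    · have hB := EE_swap hij hA.1 hA.2
      rw [if_pos hA.1, if_pos hA.2, if_pos hB.1, if_pos hB.2, sgn_flp, sgn_flp]
      have e1 : (j ∈ flp r i) ↔ j ∈ r := by simp [mem_flp, hij.symm]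
      have e2 : (i ∈ flp r j) ↔ i ∈ r := by simp [mem_flp, hij]
      simp only [e1, e2]
      rcases lt_or_gt_of_ne hij with h | h
      · rw [if_pos h, if_neg (not_lt.2 h.le)]; ring
      · rw [if_pos h, if_neg (not_lt.2 h.le)]; ring
    · have hB : ¬ (EE X r j ∧ EE X (flp r j) i) := fun hB => hA (EE_swap hij.symm hB.1 hB.2)
      have e1 : ∀ (p q : Prop) (x y : k), ¬ (p ∧ q) →
          (if p then x else 0) * (if q then y else 0) = 0 := by
        intro p q x y hpq
        by_cases hp : p
        · rw [if_neg (fun hq => hpq ⟨hp, hq⟩), mul_zero]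
        · rw [if_neg hp, zero_mul]
      rw [e1 _ _ _ _ hA, e1 _ _ _ _ hB, add_zero]
  have key2 : ∀ i, ent X a r i * ent X a (flp r i) i = 0 := by
    intro i
    unfold ent
    by_cases hA : EE X r i
    · by_cases hB : EE X (flp r i) i
      · exfalso
        obtain ⟨j, hj⟩ : ∃ j : Fin 6, i ≠ j := (exists_ne i).imp fun _ h => h.symm
        obtain ⟨τ, hτ, hi, -⟩ := hX.2 i j hj
        have h1 := hA τ hτ hi
        have h2 := hB τ hτ hi
        have e : (flp r i).erase i = r.erase i := by
          ext l; simp only [Finset.mem_erase, mem_flp]; tauto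
        have e2 : i ∈ flp r i ↔ i ∉ r := by simp [mem_flp]
        rw [e, e2] at h2
        tauto
      · rw [if_neg hB, mul_zero]
    · rw [if_neg hA, zero_mul]
  refine Finset.sum_involution (fun p _ => (p.2, p.1)) ?_ ?_ ?_ ?_
  · rintro ⟨i, j⟩ _
    by_cases hij : i = j
    · subst hij; simp [key2]
    · dsimp only
      rw [flp_comm r j i]
      split_ifs
      · exact key i j hij
      · simp
  · rintro ⟨i, j⟩ _ hne heq
    simp only [Prod.mk.injEq] at heq
    obtain rfl := heq.1
    simp [key2] at hne
  · intro _ _; simp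
  · intro _ _; rfl

/-- exactness off the support variety -/
theorem exact_of_notMem {k : Type*} [Field k] (X : Finset (Finset (Fin 6)))
    (hX : IsGenPattern 6 X) (a : Fin 6 → k) (ha : a ∉ supportVariety k X)
    (x : Finset (Fin 6) → k) (hx : (taylorMatrixAt X a).mulVec x = 0) :
    ∃ y, (taylorMatrixAt X a).mulVec y = x := by
  set T := taylorMatrixAt X a with hT
  simp only [supportVariety, Set.mem_ofPred_eq, not_forall] at ha
  obtain ⟨f, g, hf, hg, hdet⟩ := ha
  have hind : LinearIndependent k (fun j => T.mulVecLin (Pi.single (g j) 1)) := by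
    rw [Fintype.linearIndependent_iff]
    intro v hv
    have h0 : (T.submatrix f g).mulVec v = 0 := by
      ext p
      have := congrFun hv (f p)
      simp only [Finset.sum_apply, Pi.smul_apply, Matrix.mulVecLin_apply, Matrix.mulVec_single_one,
        Matrix.col_apply, smul_eq_mul, Pi.zero_apply] at this
      simp only [Matrix.mulVec, dotProduct, Matrix.submatrix_apply, Pi.zero_apply]
      rw [← this]
      exact Finset.sum_congr rfl fun i _ => mul_comm _ _
    have h1 := Matrix.eq_zero_of_mulVec_eq_zero hdet h0
    exact fun i => congrFun h1 i
  have hle : LinearMap.range T.mulVecLin ≤ LinearMap.ker T.mulVecLin := by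
    rintro _ ⟨y, rfl⟩
    rw [LinearMap.mem_ker, Matrix.mulVecLin_apply, Matrix.mulVecLin_apply, Matrix.mulVec_mulVec,
      hT, taylor_sq X hX a, Matrix.zero_mulVec]
  have h32 : 32 ≤ Module.finrank k (LinearMap.range T.mulVecLin) := by
    have hs : LinearIndependent k (fun j => (⟨T.mulVecLin (Pi.single (g j) 1), ⟨_, rfl⟩⟩ :
        LinearMap.range T.mulVecLin)) := by
      apply LinearIndependent.of_comp (LinearMap.range T.mulVecLin).subtype
      exact hind
    have := hs.fintype_card_le_finrank
    simpa using this
  have hrn := LinearMap.finrank_range_add_finrank_ker T.mulVecLin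
  have h64 : Module.finrank k (Finset (Fin 6) → k) = 64 := by
    rw [Module.finrank_fintype_fun_eq_card]; simp
  have heq := Submodule.eq_of_le_of_finrank_le hle (by omega)
  have hxk : x ∈ LinearMap.ker T.mulVecLin := by
    rw [LinearMap.mem_ker, Matrix.mulVecLin_apply, hx]
  rw [← heq] at hxk
  obtain ⟨y, hy⟩ := hxk
  exact ⟨y, hy⟩


/-! ### Membership by an Euler characteristic argument -/

theorem ker_eq_range_of_block {ι k : Type*} [Fintype ι] [Field k] (T : Matrix ι ι k)
    (hsq : T * T = 0) (hex : ∀ x, T.mulVec x = 0 → ∃ y, T.mulVec y = x) (P Q : Finset ι)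
    (h1 : ∀ r c, T r c ≠ 0 → (c ∈ P ↔ r ∈ Q)) (h2 : ∀ r c, T r c ≠ 0 → (c ∈ Q ↔ r ∈ P)) :
    LinearMap.ker (T.submatrix (fun r : Q => r.1) (fun c : P => c.1)).mulVecLin =
      LinearMap.range (T.submatrix (fun r : P => r.1) (fun c : Q => c.1)).mulVecLin := by
  have sub : ∀ (R : Finset ι) (F : ι → k), (∀ c, c ∉ R → F c = 0) → ∑ c : R, F c = ∑ c, F c := by
    intro R F hF
    rw [Finset.sum_coe_sort R F]
    exact Finset.sum_subset (Finset.subset_univ R) fun c _ hc => hF c hc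
  apply le_antisymm
  · intro x hx
    rw [LinearMap.mem_ker, Matrix.mulVecLin_apply] at hx
    let xh : ι → k := fun c => if h : c ∈ P then x ⟨c, h⟩ else 0
    have hxh : ∀ c : P, xh c = x c := fun c => by simp [xh]
    have hxn : ∀ c, c ∉ P → xh c = 0 := fun c hc => by simp [xh, hc]
    obtain ⟨y, hy⟩ := hex xh (by
      ext r
      simp only [Matrix.mulVec, dotProduct, Pi.zero_apply]
      by_cases hr : r ∈ Q
      · have := congrFun hx ⟨r, hr⟩
        simp only [Matrix.mulVec, dotProduct, Pi.zero_apply, Matrix.submatrix_apply] at this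
        rw [← sub P (fun c => T r c * xh c) (fun c hc => by simp [hxn c hc]), ← this]
        exact Finset.sum_congr rfl fun c _ => by rw [hxh]
      · refine Finset.sum_eq_zero fun c _ => ?_
        by_cases hc : T r c = 0
        · simp [hc]
        · rw [hxn c (fun hh => hr ((h1 r c hc).1 hh)), mul_zero])
    refine ⟨fun c => y c, ?_⟩
    ext r
    rw [Matrix.mulVecLin_apply, ← hxh, ← hy]
    simp only [Matrix.mulVec, dotProduct, Matrix.submatrix_apply]
    refine sub Q (fun c => T r c * y c) fun c hc => ?_
    by_cases h0 : T r c = 0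
    · simp [h0]
    · exact absurd ((h2 r c h0).2 r.2) hc
  · rintro _ ⟨y, rfl⟩
    rw [LinearMap.mem_ker, Matrix.mulVecLin_apply, Matrix.mulVecLin_apply, Matrix.mulVec_mulVec]
    have : T.submatrix (fun r : Q => r.1) (fun c : P => c.1) *
        T.submatrix (fun r : P => r.1) (fun c : Q => c.1) = 0 := by
      ext r d
      rw [Matrix.mul_apply, Matrix.zero_apply]
      have h0 := congrFun (congrFun hsq r.1) d.1
      rw [Matrix.mul_apply, Matrix.zero_apply] at h0
      rw [← h0]
      refine sub P (fun c => T r c * T c d) fun c hc => ?_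
      by_cases h0 : T r c = 0
      · simp [h0]
      · exact absurd ((h1 r c h0).2 r.2) hc
    rw [this, Matrix.zero_mulVec]

theorem card_eq_of_block {ι k : Type*} [Fintype ι] [Field k] (T : Matrix ι ι k)
    (hsq : T * T = 0) (hex : ∀ x, T.mulVec x = 0 → ∃ y, T.mulVec y = x) (P Q : Finset ι)
    (h1 : ∀ r c, T r c ≠ 0 → (c ∈ P ↔ r ∈ Q)) (h2 : ∀ r c, T r c ≠ 0 → (c ∈ Q ↔ r ∈ P)) :
    P.card = Q.card := by
  have e1 := ker_eq_range_of_block T hsq hex P Q h1 h2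
  have e2 := ker_eq_range_of_block T hsq hex Q P h2 h1
  have r1 := LinearMap.finrank_range_add_finrank_ker
    (T.submatrix (fun r : Q => r.1) (fun c : P => c.1)).mulVecLin
  have r2 := LinearMap.finrank_range_add_finrank_ker
    (T.submatrix (fun r : P => r.1) (fun c : Q => c.1)).mulVecLin
  rw [e1, Module.finrank_fintype_fun_eq_card, Fintype.card_coe] at r1
  rw [e2, Module.finrank_fintype_fun_eq_card, Fintype.card_coe] at r2
  omega

theorem taylor_ne {k : Type*} [Field k] (X : Finset (Finset (Fin 6))) (a : Fin 6 → k)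
    (r c : Finset (Fin 6)) (h : taylorMatrixAt X a r c ≠ 0) :
    ∃ i, c = flp r i ∧ ent X a r i ≠ 0 := by
  by_contra hh
  push Not at hh
  exact h (taylor_zero X a r c hh)

theorem even_flp (r : Finset (Fin 6)) (i : Fin 6) : Even (flp r i).card ↔ ¬ Even r.card := by
  unfold flp
  split_ifs with h
  · have := Finset.card_erase_add_one h
    rw [← this, Nat.even_add_one, not_not]
  · rw [Finset.card_insert_of_notMem h, Nat.even_add_one]

theorem memV_of_closed {k : Type*} [Field k] (X : Finset (Finset (Fin 6)))
    (hX : IsGenPattern 6 X) (a : Fin 6 → k) (C : Finset (Finset (Fin 6)))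
    (hC : ∀ r ∈ C, ∀ i, flp r i ∉ C → ent X a r i = 0 ∧ ent X a (flp r i) i = 0)
    (hne : (C.filter fun r => Even r.card).card ≠ (C.filter fun r => ¬ Even r.card).card) :
    a ∈ supportVariety k X := by
  by_contra ha
  apply hne
  have key : ∀ r c, taylorMatrixAt X a r c ≠ 0 →
      (c ∈ C ↔ r ∈ C) ∧ (Even c.card ↔ ¬ Even r.card) := by
    intro r c h
    obtain ⟨i, rfl, hi⟩ := taylor_ne X a r c h
    refine ⟨⟨fun h1 => ?_, fun h1 => ?_⟩, even_flp r i⟩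
    · by_contra h2
      have := hC _ h1 i (by rwa [flp_flp])
      rw [flp_flp] at this
      exact hi this.2
    · by_contra h2
      exact hi (hC _ h1 i h2).1
  refine card_eq_of_block (taylorMatrixAt X a) (taylor_sq X hX a)
    (exact_of_notMem X hX a ha) _ _ ?_ ?_
  · intro r c h
    have := key r c h
    simp only [Finset.mem_filter]
    tauto
  · intro r c h
    have := key r c h
    simp only [Finset.mem_filter]
    tauto

/-! ### Non-membership -/

theorem taylor_mulVec {k : Type*} [Field k] (X : Finset (Finset (Fin 6))) (a : Fin 6 → k)
    (x : Finset (Fin 6) → k) (r : Finset (Fin 6)) :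
    (taylorMatrixAt X a).mulVec x r = ∑ i, ent X a r i * x (flp r i) := by
  simp only [Matrix.mulVec, dotProduct, taylor_eq, Finset.sum_mul]
  rw [Finset.sum_comm]
  refine Finset.sum_congr rfl fun i _ => ?_
  rw [Finset.sum_eq_single (flp r i)]
  · simp
  · intro c _ hc; simp [hc]
  · simp

theorem notMem_of_null {k : Type*} [Field k] (X : Finset (Finset (Fin 6))) (a : Fin 6 → k)
    (S R : Finset (Finset (Fin 6))) (hS : S.card = 32) (hR : R.card = 32)
    (h : ∀ x : Finset (Fin 6) → k, (∀ s, s ∉ S → x s = 0) →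
      (∀ r ∈ R, ∑ i, ent X a r i * x (flp r i) = 0) → ∀ s ∈ S, x s = 0) :
    a ∉ supportVariety k X := by
  intro ha
  let g := S.equivFinOfCardEq hS
  let f := R.equivFinOfCardEq hR
  have hg : Function.Injective (fun p : Fin (2 ^ (6 - 1)) => (g.symm p).1) :=
    Subtype.val_injective.comp g.symm.injective
  have hf : Function.Injective (fun p : Fin (2 ^ (6 - 1)) => (f.symm p).1) :=
    Subtype.val_injective.comp f.symm.injective
  have hdet := ha _ _ hf hg
  rw [← Matrix.exists_mulVec_eq_zero_iff] at hdet
  obtain ⟨v, hv, hv0⟩ := hdet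
  apply hv
  let x : Finset (Fin 6) → k := fun s => if hs : s ∈ S then v (g ⟨s, hs⟩) else 0
  have hx : ∀ p : Fin (2 ^ (6 - 1)), x (g.symm p).1 = v p := by
    intro p
    have : (g.symm p).1 ∈ S := (g.symm p).2
    simp only [x, this, dif_pos, Subtype.coe_eta]
    rw [Equiv.apply_symm_apply]
  have hxn : ∀ s, s ∉ S → x s = 0 := fun s hs => by simp [x, hs]
  have := h x hxn (by
    intro r hr
    rw [← taylor_mulVec]
    have e := congrFun hv0 (f ⟨r, hr⟩)
    simp only [Matrix.mulVec, dotProduct, Matrix.submatrix_apply, Pi.zero_apply] at e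
    rw [Equiv.symm_apply_apply] at e
    rw [← e]
    simp only [Matrix.mulVec, dotProduct]
    have e2 : ∑ c, taylorMatrixAt X a r c * x c = ∑ c : S, taylorMatrixAt X a r c * x c := by
      rw [Finset.sum_coe_sort S (fun c => taylorMatrixAt X a r c * x c)]
      symm
      exact Finset.sum_subset (Finset.subset_univ S) fun c _ hc => by simp [hxn c hc]
    rw [e2, ← Equiv.sum_comp g.symm]
    exact Finset.sum_congr rfl fun p _ => by rw [← hx])
  ext p
  rw [← hx]
  exact this _ (g.symm p).2

/-! ### Equivariance -/

def act (g : Equiv.Perm (Fin 6)) (X : Finset (Finset (Fin 6))) : Finset (Finset (Fin 6)) :=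
  X.image fun τ => τ.map g.toEmbedding

theorem mem_act {g : Equiv.Perm (Fin 6)} {X : Finset (Finset (Fin 6))} {τ : Finset (Fin 6)} :
    τ.map g.toEmbedding ∈ act g X ↔ τ ∈ X := by
  unfold act
  rw [Finset.mem_image]
  constructor
  · rintro ⟨σ, h, e⟩
    rwa [← Finset.map_injective _ e]
  · intro h; exact ⟨τ, h, rfl⟩

theorem act_mul (g h : Equiv.Perm (Fin 6)) (X : Finset (Finset (Fin 6))) :
    act g (act h X) = act (g * h) X := by
  unfold act
  rw [Finset.image_image]
  refine Finset.image_congr fun τ _ => ?_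
  simp only [Function.comp_apply, Finset.map_map]
  rfl

theorem act_one (X : Finset (Finset (Fin 6))) : act 1 X = X := by
  unfold act
  have : (fun τ : Finset (Fin 6) => τ.map (1 : Equiv.Perm (Fin 6)).toEmbedding) = id := by
    funext τ; ext; simp only [Finset.mem_map_equiv]; rfl
  rw [this, Finset.image_id]

theorem act_inv (g : Equiv.Perm (Fin 6)) (X : Finset (Finset (Fin 6))) :
    act g⁻¹ (act g X) = X := by rw [act_mul, inv_mul_cancel, act_one]

theorem gen_act (g : Equiv.Perm (Fin 6)) (X : Finset (Finset (Fin 6))) (hX : IsGenPattern 6 X) :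
    IsGenPattern 6 (act g X) := by
  constructor
  · intro σ hσ
    obtain ⟨τ, h, rfl⟩ := Finset.mem_image.1 hσ
    simpa using hX.1 τ h
  · intro i j hij
    obtain ⟨σ, h, h1, h2⟩ := hX.2 (g.symm i) (g.symm j) (by simpa using hij)
    refine ⟨σ.map g.toEmbedding, mem_act.2 h, ?_, ?_⟩
    · simpa [Finset.mem_map_equiv] using h1
    · simpa [Finset.mem_map_equiv] using h2

theorem map_flp (g : Equiv.Perm (Fin 6)) (r : Finset (Fin 6)) (i : Fin 6) :
    (flp r i).map g.toEmbedding = flp (r.map g.toEmbedding) (g i) := by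
  ext j
  simp only [Finset.mem_map_equiv, mem_flp, Equiv.symm_apply_apply, ne_eq, Equiv.symm_apply_eq]

theorem EE_act (g : Equiv.Perm (Fin 6)) (X : Finset (Finset (Fin 6))) (r : Finset (Fin 6))
    (i : Fin 6) : EE (act g X) (r.map g.toEmbedding) (g i) ↔ EE X r i := by
  unfold EE
  simp only [act, Finset.forall_mem_image]
  refine forall₂_congr fun τ hτ => ?_
  have e : (r.map g.toEmbedding).erase (g i) = (r.erase i).map g.toEmbedding := by
    rw [Finset.map_erase]; rfl
  rw [e, Finset.disjoint_map]
  simp only [Finset.mem_map_equiv, Equiv.symm_apply_apply]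

def eps (R : Type*) [CommRing R] (g : Equiv.Perm (Fin 6)) (r : Finset (Fin 6)) : R :=
  ∏ x ∈ r, ∏ y ∈ r, if x < y ∧ g y < g x then (-1 : R) else 1

theorem pm_sq {R ι : Type*} [CommRing R] (r : Finset ι) (p : ι → Prop) [DecidablePred p] :
    (∏ x ∈ r, if p x then (-1 : R) else 1) * (∏ x ∈ r, if p x then (-1 : R) else 1) = 1 := by
  rw [← Finset.prod_mul_distrib]
  refine Finset.prod_eq_one fun x _ => ?_
  split_ifs <;> ring

theorem eps_sq {R : Type*} [CommRing R] (g : Equiv.Perm (Fin 6)) (r : Finset (Fin 6)) :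
    eps R g r * eps R g r = 1 := by
  unfold eps
  rw [← Finset.prod_mul_distrib]
  exact Finset.prod_eq_one fun x _ => pm_sq _ _

theorem sgn_sq {R : Type*} [CommRing R] (r : Finset (Fin 6)) (i : Fin 6) :
    sgn R r i * sgn R r i = 1 := pm_sq _ _

theorem eps_insert {R : Type*} [CommRing R] (g : Equiv.Perm (Fin 6)) (r : Finset (Fin 6))
    (i : Fin 6) (h : i ∉ r) : eps R g (insert i r) =
      eps R g r * (sgn R (r.map g.toEmbedding) (g i) * sgn R r i) := by
  unfold eps sgn
  rw [Finset.prod_insert h, Finset.prod_insert h, Finset.prod_map]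
  simp only [Finset.prod_insert h, Finset.prod_mul_distrib]
  rw [if_neg (by simp), one_mul, ← mul_assoc, ← Finset.prod_mul_distrib,
    ← Finset.prod_mul_distrib, mul_comm, ← Finset.prod_mul_distrib, ← Finset.prod_mul_distrib]
  refine Finset.prod_congr rfl fun y hy => ?_
  congr 1
  have hyi : y ≠ i := fun e => h (e ▸ hy)
  have hg : g y ≠ g i := fun e => hyi (g.injective e)
  simp only [Equiv.coe_toEmbedding]
  rcases lt_or_gt_of_ne hyi with h1 | h1 <;> rcases lt_or_gt_of_ne hg with h2 | h2 <;>
    simp [h1, h2, h1.not_gt, h2.not_gt]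

theorem eps_flp {R : Type*} [CommRing R] (g : Equiv.Perm (Fin 6)) (r : Finset (Fin 6))
    (i : Fin 6) : sgn R (r.map g.toEmbedding) (g i) =
      eps R g r * eps R g (flp r i) * sgn R r i := by
  by_cases h : i ∈ r
  · have h2 : i ∉ r.erase i := by simp
    have e := eps_insert (R := R) g (r.erase i) i h2
    have e2 : (r.erase i).map g.toEmbedding = (r.map g.toEmbedding).erase (g i) := by
      rw [Finset.map_erase]; rfl
    rw [Finset.insert_erase h, sgn_erase, e2, sgn_erase] at e
    rw [flp, if_pos h, e]
    have h3 := eps_sq (R := R) g (r.erase i)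
    have h4 := sgn_sq (R := R) r i
    linear_combination (-sgn R (r.map g.toEmbedding) (g i)) * h4 -
      (sgn R (r.map g.toEmbedding) (g i)) * sgn R r i * sgn R r i * h3
  · have e := eps_insert (R := R) g r i h
    rw [flp, if_neg h, e]
    have h3 := eps_sq (R := R) g r
    have h4 := sgn_sq (R := R) r i
    linear_combination (-sgn R (r.map g.toEmbedding) (g i)) * h4 -
      (sgn R (r.map g.toEmbedding) (g i)) * sgn R r i * sgn R r i * h3

theorem taylor_act {k : Type*} [Field k] (g : Equiv.Perm (Fin 6)) (X : Finset (Finset (Fin 6)))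
    (a : Fin 6 → k) (r c : Finset (Fin 6)) :
    taylorMatrixAt X (fun i => a (g i)) r c = eps k g r * (eps k g c *
      taylorMatrixAt (act g X) a (r.map g.toEmbedding) (c.map g.toEmbedding)) := by
  rw [taylor_eq, taylor_eq, ← Equiv.sum_comp g (fun i => ite (_ = flp (r.map g.toEmbedding) i) _ _), Finset.mul_sum, Finset.mul_sum]
  refine Finset.sum_congr rfl fun i _ => ?_
  rw [← map_flp]
  by_cases hc : c = flp r i
  · rw [if_pos hc, if_pos (by rw [hc]), hc]
    unfold ent
    rw [EE_act, eps_flp]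
    split_ifs with h1 h2 h3 h3
    · have h3 := eps_sq (R := k) g r
      have h4 := eps_sq (R := k) g (flp r i)
      linear_combination (-sgn k r i * a (g i)) * h3 -
        sgn k r i * a (g i) * eps k g r * eps k g r * h4
    · simp at h3; exact absurd h2 h3
    · simp at h3; exact absurd h3 h2
    · have h3 := eps_sq (R := k) g r
      have h4 := eps_sq (R := k) g (flp r i)
      linear_combination (-sgn k r i) * h3 - sgn k r i * eps k g r * eps k g r * h4
    · simp
  · rw [if_neg hc, if_neg (fun e => hc (Finset.map_injective _ e))]
    simp

theorem mem_act_imp {k : Type*} [Field k] (g : Equiv.Perm (Fin 6)) (X : Finset (Finset (Fin 6)))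
    (a : Fin 6 → k) (h : a ∈ supportVariety k (act g X)) :
    (fun i => a (g i)) ∈ supportVariety k X := by
  intro f l hf hl
  have := h (fun p => (f p).map g.toEmbedding) (fun p => (l p).map g.toEmbedding)
    (fun p q e => hf (Finset.map_injective _ e)) (fun p q e => hl (Finset.map_injective _ e))
  have e : (taylorMatrixAt X (fun i => a (g i))).submatrix f l =
      Matrix.of fun p q => eps k g (f p) * (Matrix.of fun p q => eps k g (l q) *
        ((taylorMatrixAt (act g X) a).submatrix (fun p => (f p).map g.toEmbedding)
          (fun p => (l p).map g.toEmbedding)) p q) p q := by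
    ext p q
    simp only [Matrix.submatrix_apply, Matrix.of_apply]
    exact taylor_act g X a _ _
  rw [e, Matrix.det_mul_column, Matrix.det_mul_row, this, mul_zero, mul_zero]

theorem mem_act_iff {k : Type*} [Field k] (g : Equiv.Perm (Fin 6)) (X : Finset (Finset (Fin 6)))
    (a : Fin 6 → k) :
    a ∈ supportVariety k (act g X) ↔ (fun i => a (g i)) ∈ supportVariety k X := by
  refine ⟨mem_act_imp g X a, fun h => ?_⟩
  have := mem_act_imp g⁻¹ (act g X) (fun i => a (g i)) (by rwa [act_inv])
  simpa using this


/-! ### Bit masks -/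

/-- subset of `Fin 6` coded by a number -/
def dec (t : ℕ) : Finset (Fin 6) := Finset.univ.filter fun i : Fin 6 => t.testBit i.val = true

theorem mem_dec {t : ℕ} {i : Fin 6} : i ∈ dec t ↔ t.testBit i.val = true := by simp [dec]

def enc (s : Finset (Fin 6)) : ℕ := ∑ i ∈ s, 2 ^ i.val

theorem enc_lt : ∀ s : Finset (Fin 6), enc s < 64 := by decide +kernel

theorem dec_enc : ∀ s : Finset (Fin 6), dec (enc s) = s := by decide +kernel

theorem enc_dec : ∀ t < 64, enc (dec t) = t := by decide +kernel

theorem dec_inj {s t : ℕ} (hs : s < 64) (ht : t < 64) (h : dec s = dec t) : s = t := by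
  rw [← enc_dec s hs, ← enc_dec t ht, h]

theorem flp_dec (t : ℕ) (i : Fin 6) : flp (dec t) i = dec (t ^^^ 2 ^ i.val) := by
  ext j
  rw [mem_flp, mem_dec, mem_dec, mem_dec, Nat.testBit_xor, Nat.testBit_two_pow]
  by_cases h : j = i
  · subst h; simp
  · have h2 : i.val ≠ j.val := fun e => h (Fin.ext e.symm)
    simp [h, h2]

theorem xor_lt (t : ℕ) (ht : t < 64) (i : Fin 6) : t ^^^ 2 ^ i.val < 64 :=
  Nat.xor_lt_two_pow (n := 6) ht (Nat.pow_lt_pow_right (by norm_num) i.isLt)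

def Avoid (X : Finset (Finset (Fin 6))) (R : ℕ) : Prop :=
  ∀ t < 64, R.testBit t = true → dec t ∉ X

theorem Avoid.or {X : Finset (Finset (Fin 6))} {R m : ℕ} (h1 : Avoid X R) (h2 : Avoid X m) :
    Avoid X (Nat.lor R m) := by
  intro t ht h
  have h' : (R ||| m).testBit t = true := h
  rw [Nat.testBit_or, Bool.or_eq_true] at h'
  exact h'.elim (h1 t ht) (h2 t ht)

def sb (p q : ℕ) : Bool := Nat.beq (Nat.land p q) p

theorem Avoid.mono {X : Finset (Finset (Fin 6))} {p q : ℕ} (h : sb p q = true)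
    (h1 : Avoid X q) : Avoid X p := by
  have h' : p &&& q = p := Nat.eq_of_beq_eq_true h
  intro t ht hp
  apply h1 t ht
  rw [← h', Nat.testBit_and, Bool.and_eq_true] at hp
  exact hp.2

def tb (n i : ℕ) : Bool := Nat.beq (Nat.land (Nat.shiftRight n i) 1) 1

theorem tb_eq (n i : ℕ) : tb n i = n.testBit i := by
  unfold tb
  have : Nat.land (Nat.shiftRight n i) 1 = (n >>> i) % 2 := by
    show (n >>> i) &&& 1 = _
    rw [Nat.and_one_is_mod]
  rw [this, Nat.testBit_eq_decide_div_mod_eq, Nat.shiftRight_eq_div_pow]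
  rw [Bool.eq_iff_iff, decide_eq_true_iff]
  rw [Nat.beq_eq]

def IM (i : ℕ) : ℕ := match i with
  | 0 => 0xAAAAAAAAAAAAAAAA
  | 1 => 0xCCCCCCCCCCCCCCCC
  | 2 => 0xF0F0F0F0F0F0F0F0
  | 3 => 0xFF00FF00FF00FF00
  | 4 => 0xFFFF0000FFFF0000
  | 5 => 0xFFFFFFFF00000000
  | _ => 0

theorem IM_spec : ∀ i : Fin 6, ∀ t < 64, (IM i.val).testBit t = t.testBit i.val := by
  decide +kernel

def sel (l j : ℕ) : ℕ := match tb l j with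
  | true => IM j
  | false => 0

def meet (l : ℕ) : ℕ :=
  Nat.lor (sel l 0) (Nat.lor (sel l 1) (Nat.lor (sel l 2) (Nat.lor (sel l 3)
    (Nat.lor (sel l 4) (sel l 5)))))

def mA (l i : ℕ) : ℕ := Nat.land (IM i) (meet l)

def mB (l i : ℕ) : ℕ := Nat.xor (IM i) (mA l i)

theorem sel_spec (l : ℕ) (j : Fin 6) (t : ℕ) (ht : t < 64) :
    (sel l j.val).testBit t = true ↔ j ∈ dec l ∧ j ∈ dec t := by
  rw [mem_dec, mem_dec, sel, ← tb_eq l]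
  cases tb l j.val
  · simp
  · simp [IM_spec j t ht]

theorem meet_spec (l t : ℕ) (ht : t < 64) :
    (meet l).testBit t = true ↔ ¬ Disjoint (dec t) (dec l) := by
  have e : meet l = (sel l 0 ||| (sel l 1 ||| (sel l 2 ||| (sel l 3 ||| (sel l 4 ||| sel l 5))))) :=
    rfl
  have h0 := sel_spec l 0 t ht
  have h1 := sel_spec l 1 t ht
  have h2 := sel_spec l 2 t ht
  have h3 := sel_spec l 3 t ht
  have h4 := sel_spec l 4 t ht
  have h5 := sel_spec l 5 t ht
  rw [e]
  simp only [Nat.testBit_or, Bool.or_eq_true, Finset.not_disjoint_iff]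
  constructor
  · rintro (h | h | h | h | h | h)
    · exact ⟨0, (h0.1 h).2, (h0.1 h).1⟩
    · exact ⟨1, (h1.1 h).2, (h1.1 h).1⟩
    · exact ⟨2, (h2.1 h).2, (h2.1 h).1⟩
    · exact ⟨3, (h3.1 h).2, (h3.1 h).1⟩
    · exact ⟨4, (h4.1 h).2, (h4.1 h).1⟩
    · exact ⟨5, (h5.1 h).2, (h5.1 h).1⟩
  · rintro ⟨j, hj, hl⟩
    fin_cases j
    · exact Or.inl (h0.2 ⟨hl, hj⟩)
    · exact Or.inr (Or.inl (h1.2 ⟨hl, hj⟩))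
    · exact Or.inr (Or.inr (Or.inl (h2.2 ⟨hl, hj⟩)))
    · exact Or.inr (Or.inr (Or.inr (Or.inl (h3.2 ⟨hl, hj⟩))))
    · exact Or.inr (Or.inr (Or.inr (Or.inr (Or.inl (h4.2 ⟨hl, hj⟩)))))
    · exact Or.inr (Or.inr (Or.inr (Or.inr (Or.inr (h5.2 ⟨hl, hj⟩)))))

theorem mA_spec (l : ℕ) (i : Fin 6) (t : ℕ) (ht : t < 64) :
    (mA l i.val).testBit t = true ↔ i ∈ dec t ∧ ¬ Disjoint (dec t) (dec l) := by
  have e : mA l i.val = (IM i.val &&& meet l) := rfl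
  rw [e, Nat.testBit_and, Bool.and_eq_true, meet_spec l t ht, IM_spec i t ht, mem_dec]

theorem mB_spec (l : ℕ) (i : Fin 6) (t : ℕ) (ht : t < 64) :
    (mB l i.val).testBit t = true ↔ i ∈ dec t ∧ Disjoint (dec t) (dec l) := by
  have e : mB l i.val = (IM i.val ^^^ mA l i.val) := rfl
  have h := mA_spec l i t ht
  rw [e, Nat.testBit_xor, IM_spec i t ht]
  have h2 := @mem_dec t i
  cases h3 : (mA l i.val).testBit t <;> cases h4 : t.testBit i.val <;> simp_all

theorem avoid_iff (X : Finset (Finset (Fin 6))) (R : ℕ) (P : Finset (Fin 6) → Prop)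
    (h : ∀ t < 64, R.testBit t = true ↔ P (dec t)) : Avoid X R ↔ ∀ τ ∈ X, ¬ P τ := by
  constructor
  · intro hA τ hτ hP
    have h1 := enc_lt τ
    refine hA (enc τ) h1 ((h _ h1).2 ?_) ?_ <;> rwa [dec_enc]
  · intro hA t ht hR hX
    exact hA _ hX ((h t ht).1 hR)

theorem avoid_mA (X : Finset (Finset (Fin 6))) (l : ℕ) (i : Fin 6) :
    Avoid X (mA l i.val) ↔ ∀ τ ∈ X, i ∈ τ → Disjoint τ (dec l) := by
  rw [avoid_iff X _ (fun τ => i ∈ τ ∧ ¬ Disjoint τ (dec l)) (mA_spec l i)]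
  exact forall₂_congr fun τ _ => by tauto

theorem avoid_mB (X : Finset (Finset (Fin 6))) (l : ℕ) (i : Fin 6) :
    Avoid X (mB l i.val) ↔ ∀ τ ∈ X, i ∈ τ → ¬ Disjoint τ (dec l) := by
  rw [avoid_iff X _ (fun τ => i ∈ τ ∧ Disjoint τ (dec l)) (mB_spec l i)]
  exact forall₂_congr fun τ _ => by tauto

/-- the mask whose avoidance is equivalent to existence of the edge into `s` in direction `i` -/
def low (s i : ℕ) : ℕ := match tb s i with
  | true => Nat.xor s (Nat.pow 2 i)
  | false => s

theorem dec_low (s : ℕ) (i : Fin 6) : dec (low s i.val) = (dec s).erase i := by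
  unfold low
  rw [tb_eq]
  have h := @mem_dec s i
  cases hb : s.testBit i.val
  · rw [hb] at h
    rw [Finset.erase_eq_of_notMem (by simpa using h)]
  · rw [hb] at h
    have h1 : i ∈ dec s := by simpa using h
    have := flp_dec s i
    rw [flp, if_pos h1] at this
    exact this.symm

def eM (s i : ℕ) : ℕ := match tb s i with
  | true => mA (low s i) i
  | false => mB (low s i) i

theorem EE_iff (X : Finset (Finset (Fin 6))) (s : ℕ) (i : Fin 6) :
    EE X (dec s) i ↔ Avoid X (eM s i.val) := by
  unfold eM EE
  rw [tb_eq]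
  have h := @mem_dec s i
  cases hb : s.testBit i.val
  · rw [hb] at h
    simp only [h, avoid_mB, dec_low]
    simp
  · rw [hb] at h
    simp only [h, avoid_mA, dec_low]
    simp

/-! ### Masks for the generating condition -/

def genMasks : List ℕ := [2459565876494606882, 723401728380766730, 47851476196393130, 187647121205930, 2863311530, 4919131752989213764, 868082074056920076, 57421771435671756, 225176545447116, 3435973836, 5787213827046133840, 3472328296227680304, 67555025218437360, 264913582878960, 4042322160, 6124988953138320640, 3674993371882992384, 1080880403494997760, 280375465148160, 4278255360, 6148820867675914240, 3689292520605548544, 1085086035472220160, 71776119077928960, 4294901760, 6148914689804861440, 3689348813882916864, 1085102592318504960, 71777214277877760, 281470681743360]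

theorem genMasks_spec : ∀ p ∈ genMasks, ∃ i j : Fin 6, i ≠ j ∧
    ∀ t < 64, p.testBit t = true ↔ (i ∈ dec t ∧ j ∉ dec t) := by
  decide +kernel

theorem hit_gen (X : Finset (Finset (Fin 6))) (hX : IsGenPattern 6 X) (p : ℕ)
    (hp : p ∈ genMasks) : ¬ Avoid X p := by
  obtain ⟨i, j, hij, h⟩ := genMasks_spec p hp
  rw [avoid_iff X p (fun τ => i ∈ τ ∧ j ∉ τ) h]
  intro hh
  obtain ⟨σ, h1, h2, h3⟩ := hX.2 i j hij
  exact hh σ h1 ⟨h2, h3⟩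

def anyB (Q : ℕ) : List ℕ → Bool
  | [] => false
  | p :: l => match sb p Q with
    | true => true
    | false => anyB Q l

theorem anyB_spec (Q : ℕ) (l : List ℕ) (h : anyB Q l = true) : ∃ p ∈ l, sb p Q = true := by
  induction l with
  | nil => simp [anyB] at h
  | cons p l ih =>
    unfold anyB at h
    cases hp : sb p Q
    · rw [hp] at h
      obtain ⟨q, h1, h2⟩ := ih h
      exact ⟨q, by simp [h1], h2⟩
    · exact ⟨p, by simp, hp⟩

def dead' (G pos : List ℕ) (Q : ℕ) : Bool :=
  match anyB Q G with
  | true => true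
  | false => anyB Q pos

theorem dead'_spec (G pos : List ℕ) (Q : ℕ) (h : dead' G pos Q = true) :
    ∃ p, (p ∈ G ∨ p ∈ pos) ∧ sb p Q = true := by
  unfold dead' at h
  cases h1 : anyB Q G
  · rw [h1] at h
    obtain ⟨p, hp, hs⟩ := anyB_spec _ _ h
    exact ⟨p, Or.inr hp, hs⟩
  · obtain ⟨p, hp, hs⟩ := anyB_spec _ _ h1
    exact ⟨p, Or.inl hp, hs⟩

def dead (R : ℕ) (pos : List ℕ) (m : ℕ) : Bool := dead' genMasks pos (Nat.lor R m)

theorem dead_spec (X : Finset (Finset (Fin 6))) (hX : IsGenPattern 6 X) (R : ℕ) (pos : List ℕ)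
    (m : ℕ) (h : dead R pos m = true) (hR : Avoid X R) (hpos : ∀ p ∈ pos, ¬ Avoid X p) :
    ¬ Avoid X m := by
  intro hm
  have hor := hR.or hm
  unfold dead at h
  obtain ⟨p, hp | hp, hs⟩ := dead'_spec genMasks pos _ h
  · exact hit_gen X hX p hp (Avoid.mono hs hor)
  · exact hpos p hp (Avoid.mono hs hor)

/-! ### Permuting masks -/

/-- mask of `t` with bit `i` set and bit `j` unset -/
def dm (i j : ℕ) : ℕ := Nat.xor (IM i) (Nat.land (IM i) (IM j))

def sw (i j R : ℕ) : ℕ := match Nat.blt i j with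
  | false => R
  | true =>
    let d := 2 ^ j - 2 ^ i
    let x := Nat.land (Nat.xor (Nat.shiftRight R d) R) (dm i j)
    Nat.xor R (Nat.xor x (Nat.shiftLeft x d))

def swT (i j t : ℕ) : ℕ :=
  if t.testBit i && !t.testBit j then t + (2 ^ j - 2 ^ i)
  else if t.testBit j && !t.testBit i then t - (2 ^ j - 2 ^ i) else t

theorem dm_fact : ∀ i j : Fin 6, i < j → ∀ t < 64,
    (dm i.val j.val).testBit t = (t.testBit i.val && !t.testBit j.val) ∧
    (decide (2 ^ j.val - 2 ^ i.val ≤ t) && (dm i.val j.val).testBit (t - (2 ^ j.val - 2 ^ i.val))) =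
      (t.testBit j.val && !t.testBit i.val) := by
  decide +kernel

theorem swT_fact : ∀ i j : Fin 6, i < j → ∀ t < 64,
    swT i.val j.val t < 64 ∧
    dec (swT i.val j.val t) = (dec t).map (Equiv.swap i j).toEmbedding := by
  decide +kernel

theorem sw_spec (i j : Fin 6) (hij : i < j) (R t : ℕ) (ht : t < 64) :
    (sw i.val j.val R).testBit t = R.testBit (swT i.val j.val t) := by
  have hb : Nat.blt i.val j.val = true := by rw [Nat.blt_eq]; exact hij
  obtain ⟨h1, h2⟩ := dm_fact i j hij t ht
  unfold sw
  rw [hb]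
  generalize dm i.val j.val = m at *
  generalize hd : 2 ^ j.val - 2 ^ i.val = d at *
  show (R ^^^ ((((R >>> d) ^^^ R) &&& m) ^^^ ((((R >>> d) ^^^ R) &&& m) <<< d))).testBit t = _
  simp only [Nat.testBit_xor, Nat.testBit_shiftLeft, Nat.testBit_and, Nat.testBit_shiftRight]
  unfold swT
  rw [hd]
  by_cases hdt : d ≤ t
  · have e1 : d + (t - d) = t := by omega
    rw [e1, h1]
    simp only [hdt, decide_true, Bool.true_and] at h2 ⊢
    rw [h2, Nat.add_comm d t]
    cases t.testBit i.val <;> cases t.testBit j.val <;> cases h5 : R.testBit t <;>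
      cases h6 : R.testBit (t + d) <;> simp [h5, h6]
  · simp only [hdt, decide_false, Bool.false_and] at h2 ⊢
    rw [h1, Nat.add_comm d t]
    revert h2
    cases t.testBit i.val <;> cases t.testBit j.val <;> cases h5 : R.testBit t <;>
      cases h6 : R.testBit (t + d) <;> simp [h5, h6]

theorem avoid_sw (X : Finset (Finset (Fin 6))) (i j : Fin 6) (hij : i ≤ j) (R : ℕ) :
    Avoid X (sw i.val j.val R) ↔ Avoid (act (Equiv.swap i j) X) R := by
  rcases hij.lt_or_eq with h | h
  · have key : ∀ (Y : Finset (Finset (Fin 6))) (t : ℕ), t < 64 →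
        (dec (swT i.val j.val t) ∈ act (Equiv.swap i j) Y ↔ dec t ∈ Y) := by
      intro Y t ht
      rw [(swT_fact i j h t ht).2, mem_act]
    have inv : ∀ t < 64, swT i.val j.val (swT i.val j.val t) = t := by
      intro t ht
      have h1 := swT_fact i j h t ht
      have h2 := swT_fact i j h _ h1.1
      refine dec_inj h2.1 ht ?_
      rw [h2.2, h1.2, Finset.map_map]
      ext x
      simp only [Finset.mem_map, Function.Embedding.trans_apply, Equiv.coe_toEmbedding,
        Equiv.swap_apply_self]
      simp
    constructor
    · intro hA t ht hR hX
      have h1 := swT_fact i j h t ht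
      refine hA _ h1.1 ?_ ?_
      · rw [sw_spec i j h R _ h1.1, inv t ht, hR]
      · rwa [← key X _ h1.1, inv t ht]
    · intro hA t ht hR hX
      have h1 := swT_fact i j h t ht
      rw [sw_spec i j h R _ ht] at hR
      exact hA _ h1.1 hR ((key X t ht).2 hX)
  · subst h
    have : sw i.val i.val R = R := by
      unfold sw
      have : Nat.blt i.val i.val = false := by
        rw [Bool.eq_false_iff, ne_eq, Nat.blt_eq]; exact lt_irrefl _
      rw [this]
    rw [this, Equiv.swap_self, show Equiv.refl (Fin 6) = 1 from rfl, act_one]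

def dg (c j : ℕ) : ℕ := Nat.land (Nat.shiftRight c (3 * j)) 7

/-- the image of a mask under the permutation coded by `c` -/
def img (c R : ℕ) : ℕ :=
  sw 0 (dg c 0) (sw 1 (dg c 1) (sw 2 (dg c 2) (sw 3 (dg c 3) (sw 4 (dg c 4) R))))

/-- validity of a permutation code -/
def okc (c : ℕ) : Bool :=
  Nat.ble (dg c 0) 5 && Nat.ble (dg c 1) 5 && Nat.ble (dg c 2) 5 && Nat.ble (dg c 3) 5 &&
  Nat.ble (dg c 4) 5 && Nat.ble 1 (dg c 1) && Nat.ble 2 (dg c 2) && Nat.ble 3 (dg c 3) &&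
  Nat.ble 4 (dg c 4)

def swI (i j x : ℕ) : ℕ := match Nat.beq x i with
  | true => j
  | false => match Nat.beq x j with
    | true => i
    | false => x

/-- action on indices of the inverse of the permutation coded by `c` -/
def imgI (c x : ℕ) : ℕ :=
  swI 4 (dg c 4) (swI 3 (dg c 3) (swI 2 (dg c 2) (swI 1 (dg c 1) (swI 0 (dg c 0) x))))

theorem swI_spec : ∀ i j x : Fin 6, swI i.val j.val x.val = (Equiv.swap i j x).val := by
  decide +kernel

theorem img_spec (c : ℕ) (hc : okc c = true) : ∃ h : Equiv.Perm (Fin 6),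
    (∀ X R, Avoid X (img c R) ↔ Avoid (act h X) R) ∧ ∀ x : Fin 6, imgI c x.val = (h x).val := by
  unfold okc at hc
  simp only [Bool.and_eq_true, Nat.ble_eq] at hc
  obtain ⟨⟨⟨⟨⟨⟨⟨⟨h0, h1⟩, h2⟩, h3⟩, h4⟩, g1⟩, g2⟩, g3⟩, g4⟩ := hc
  unfold img imgI
  generalize dg c 0 = c0 at *
  generalize dg c 1 = c1 at *
  generalize dg c 2 = c2 at *
  generalize dg c 3 = c3 at *
  generalize dg c 4 = c4 at *
  refine ⟨Equiv.swap 4 ⟨c4, by omega⟩ * (Equiv.swap 3 ⟨c3, by omega⟩ *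
    (Equiv.swap 2 ⟨c2, by omega⟩ * (Equiv.swap 1 ⟨c1, by omega⟩ *
      Equiv.swap 0 ⟨c0, by omega⟩))), ?_, ?_⟩
  · intro X R
    rw [← act_mul, ← act_mul, ← act_mul, ← act_mul]
    have e0 := fun X R => avoid_sw X 0 ⟨c0, by omega⟩ (Fin.zero_le _) R
    have e1 := fun X R => avoid_sw X 1 ⟨c1, by omega⟩ g1 R
    have e2 := fun X R => avoid_sw X 2 ⟨c2, by omega⟩ g2 R
    have e3 := fun X R => avoid_sw X 3 ⟨c3, by omega⟩ g3 R
    have e4 := fun X R => avoid_sw X 4 ⟨c4, by omega⟩ g4 R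
    rw [← e4, ← e3, ← e2, ← e1, ← e0]
    rfl
  · intro x
    simp only [Equiv.Perm.mul_apply, ← swI_spec]
    rfl


/-! ### Certificates -/

inductive Cert : Type
  | L : ℕ → ℕ → Cert
  | D : List ℕ → Cert
  | K : ℕ → Cert → Cert → Cert
  | S : ℕ → Cert → List ℕ → Cert → Cert

def elemB (s : ℕ) : List ℕ → Bool
  | [] => false
  | p :: l => match Nat.beq s p with
    | true => true
    | false => elemB s l

theorem elemB_spec (s : ℕ) (l : List ℕ) : elemB s l = true ↔ s ∈ l := by
  induction l with
  | nil => simp [elemB]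
  | cons p l ih =>
    unfold elemB
    cases h : Nat.beq s p
    · have : s ≠ p := fun e => by rw [e] at h; simp at h
      simp [ih, this]
    · simp [Nat.eq_of_beq_eq_true h]

def allB (f : ℕ → Bool) : List ℕ → Bool
  | [] => true
  | p :: l => match f p with
    | true => allB f l
    | false => false

theorem allB_spec (f : ℕ → Bool) (l : List ℕ) : allB f l = true ↔ ∀ p ∈ l, f p = true := by
  induction l with
  | nil => simp [allB]
  | cons p l ih =>
    unfold allB
    cases h : f p
    · simp [h]
    · simp [h, ih]

def ndB : List ℕ → Bool
  | [] => true
  | p :: l => match elemB p l with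
    | true => false
    | false => ndB l

theorem ndB_spec (l : List ℕ) (h : ndB l = true) : l.Nodup := by
  induction l with
  | nil => simp
  | cons p l ih =>
    unfold ndB at h
    cases h1 : elemB p l
    · rw [h1] at h
      rw [List.nodup_cons, ← elemB_spec, h1]
      exact ⟨by simp, ih h⟩
    · rw [h1] at h; simp at h

def idx : List ℕ := [0, 1, 2, 3, 4, 5]

theorem allB_idx (f : ℕ → Bool) (h : allB f idx = true) (i : Fin 6) : f i.val = true := by
  rw [allB_spec] at h
  apply h
  have := i.isLt
  simp [idx]
  omega

/-- parity of the number of bits -/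
def parN (s : ℕ) : ℕ := Nat.land (Nat.add (Nat.add (Nat.add (Nat.land s 1)
  (Nat.land (Nat.shiftRight s 1) 1)) (Nat.add (Nat.land (Nat.shiftRight s 2) 1)
  (Nat.land (Nat.shiftRight s 3) 1))) (Nat.add (Nat.land (Nat.shiftRight s 4) 1)
  (Nat.land (Nat.shiftRight s 5) 1))) 1

theorem parN_spec : ∀ s < 64, parN s = (dec s).card % 2 := by decide +kernel

def sumB (f : ℕ → ℕ) : List ℕ → ℕ
  | [] => 0
  | p :: l => Nat.add (f p) (sumB f l)

def dirOK (Z R : ℕ) (pos l : List ℕ) (s i : ℕ) : Bool :=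
  match elemB (Nat.xor s (Nat.pow 2 i)) l with
  | true => true
  | false => match dead R pos (mB (low s i) i) with
    | false => false
    | true => match tb Z i with
      | true => true
      | false => dead R pos (mA (low s i) i)

def chkD (Z R : ℕ) (pos l : List ℕ) : Bool :=
  allB (fun s => Nat.blt s 64 && allB (fun i => dirOK Z R pos l s i) idx) l &&
  ndB l && !Nat.beq (Nat.mul 2 (sumB parN l)) l.length

def cm (m : ℕ) : ℕ := match Nat.div m 512 with
  | 0 => mA (Nat.land m 63) (Nat.land (Nat.shiftRight m 6) 7)
  | _ => mB (Nat.land m 63) (Nat.land (Nat.shiftRight m 6) 7)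

def symOK (Z R : ℕ) (pos : List ℕ) (c : ℕ) : Bool :=
  okc c && allB (fun i => !tb Z (imgI c i) || tb Z i) idx && sb (img c R) R &&
  allB (fun p => anyB (Nat.lor R (img c p)) pos) pos

def imgs (m : ℕ) (pos : List ℕ) : List ℕ → List ℕ
  | [] => pos
  | c :: gs => img c m :: imgs m pos gs

def frc {α : Type} (n : ℕ) (f : ℕ → α) : α := Nat.rec (f 0) (fun m _ => f (Nat.succ m)) n

theorem frc_eq {α : Type} (n : ℕ) (f : ℕ → α) : frc n f = f n := by cases n <;> rfl

def chk (Z : ℕ) (leaves : List ℕ) : Cert → ℕ → List ℕ → Bool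
  | Cert.L k c => fun R _ => okc c && Nat.blt k leaves.length && sb (img c (leaves.getD k 0)) R
  | Cert.D l => fun R pos => chkD Z R pos l
  | Cert.K m c1 c2 => fun R pos => frc (cm m) fun m' =>
      (frc (Nat.lor R m') fun R' => chk Z leaves c1 R' pos) && chk Z leaves c2 R (m' :: pos)
  | Cert.S m c1 gs c2 => fun R pos => frc (cm m) fun m' =>
      (frc (Nat.lor R m') fun R' => chk Z leaves c1 R' pos) && allB (symOK Z R pos) gs &&
        chk Z leaves c2 R (m' :: imgs m' pos gs)

def Good (k : Type*) [Field k] (Z : ℕ) (leaves : List ℕ) (X : Finset (Finset (Fin 6))) : Prop :=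
  (∀ a : Fin 6 → k, (∀ i : Fin 6, Z.testBit i.val = true → a i = 0) → a ∈ supportVariety k X) ∨
  ∃ g : Equiv.Perm (Fin 6), ∃ N ∈ leaves, Avoid (act g X) N

theorem good_act {k : Type*} [Field k] {Z : ℕ} {leaves : List ℕ} {X : Finset (Finset (Fin 6))}
    (h : Equiv.Perm (Fin 6))
    (hZ : ∀ i : Fin 6, Z.testBit (h i).val = true → Z.testBit i.val = true)
    (hg : Good k Z leaves (act h X)) : Good k Z leaves X := by
  rcases hg with hg | ⟨g, N, hN, hA⟩
  · left
    intro a ha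
    have := hg (fun i => a (h⁻¹ i)) (by
      intro i hi
      apply ha
      apply hZ
      simpa using hi)
    rw [mem_act_iff] at this
    simpa using this
  · right
    rw [act_mul] at hA
    exact ⟨_, N, hN, hA⟩

theorem sumB_spec (l : List ℕ) (hl : ∀ s ∈ l, s < 64) (hn : l.Nodup) :
    sumB parN l = (((l.map dec).toFinset).filter fun r => ¬ Even r.card).card := by
  induction l with
  | nil => simp [sumB]
  | cons p l ih =>
    have h1 : dec p ∉ (l.map dec).toFinset := by
      rw [List.mem_toFinset, List.mem_map]
      rintro ⟨q, hq, e⟩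
      have := dec_inj (hl q (by simp [hq])) (hl p (by simp)) e
      rw [List.nodup_cons] at hn
      exact hn.1 (this ▸ hq)
    have h2 := ih (fun s hs => hl s (by simp [hs])) (List.nodup_cons.1 hn).2
    have h3 := parN_spec p (hl p (by simp))
    rw [List.map_cons, List.toFinset_cons, Finset.filter_insert]
    show parN p + sumB parN l = _
    rw [h2, h3]
    split_ifs with h
    · rw [Nat.even_iff] at h
      omega
    · rw [Finset.card_insert_of_notMem (by simp only [Finset.mem_filter]; tauto)]
      rw [Nat.not_even_iff] at h
      omega

theorem ent_zero {k : Type*} [Field k] {X : Finset (Finset (Fin 6))} {a : Fin 6 → k} {s : ℕ}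
    {i : Fin 6} (h : ¬ Avoid X (eM s i.val) ∨ (i ∈ dec s ∧ a i = 0)) : ent X a (dec s) i = 0 := by
  unfold ent
  rcases h with h | h
  · rw [if_neg]; rwa [EE_iff]
  · rw [if_pos h.1, h.2]; simp

theorem dirOK_spec {k : Type*} [Field k] (Z R : ℕ) (pos l : List ℕ) (s : ℕ) (i : Fin 6)
    (h : dirOK Z R pos l s i.val = true) (X : Finset (Finset (Fin 6))) (hX : IsGenPattern 6 X)
    (hR : Avoid X R) (hpos : ∀ p ∈ pos, ¬ Avoid X p) (a : Fin 6 → k)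
    (ha : ∀ i : Fin 6, Z.testBit i.val = true → a i = 0)
    (hl : (s ^^^ 2 ^ i.val) ∉ l) :
    ent X a (dec s) i = 0 ∧ ent X a (flp (dec s) i) i = 0 := by
  unfold dirOK at h
  have h0 : elemB (Nat.xor s (Nat.pow 2 i.val)) l = false := by
    rw [Bool.eq_false_iff, ne_eq, elemB_spec]; exact hl
  rw [h0] at h
  have h1 : dead R pos (mB (low s i.val) i.val) = true := by
    cases h1 : dead R pos (mB (low s i.val) i.val)
    · rw [h1] at h; simp at h
    · rfl
  rw [h1] at h
  have hB := dead_spec X hX R pos _ h1 hR hpos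
  have hA : ¬ Avoid X (mA (low s i.val) i.val) ∨ a i = 0 := by
    cases h2 : tb Z i.val
    · rw [h2] at h
      exact Or.inl (dead_spec X hX R pos _ h hR hpos)
    · rw [tb_eq] at h2
      exact Or.inr (ha i h2)
  rw [avoid_mB, dec_low] at hB
  rw [avoid_mA, dec_low] at hA
  have e : (flp (dec s) i).erase i = (dec s).erase i := by
    ext l; simp only [Finset.mem_erase, mem_flp]; tauto
  have e2 : i ∈ flp (dec s) i ↔ i ∉ dec s := by simp [mem_flp]
  unfold ent EE
  rw [e]
  by_cases hi : i ∈ dec s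
  · simp only [e2, hi, true_iff, not_true_eq_false, false_iff, if_true]
    rw [if_neg hB]
    refine ⟨?_, rfl⟩
    rcases hA with hA | hA
    · rw [if_neg hA]
    · rw [hA]; simp
  · simp only [e2, hi, false_iff, not_false_eq_true, true_iff, if_true]
    rw [if_neg hB]
    refine ⟨rfl, ?_⟩
    rcases hA with hA | hA
    · rw [if_neg hA]
    · rw [hA]; simp

theorem chkD_spec {k : Type*} [Field k] (Z R : ℕ) (pos l : List ℕ)
    (h : chkD Z R pos l = true) (X : Finset (Finset (Fin 6))) (hX : IsGenPattern 6 X)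
    (hR : Avoid X R) (hpos : ∀ p ∈ pos, ¬ Avoid X p) (a : Fin 6 → k)
    (ha : ∀ i : Fin 6, Z.testBit i.val = true → a i = 0) : a ∈ supportVariety k X := by
  unfold chkD at h
  simp only [Bool.and_eq_true, allB_spec _ l] at h
  obtain ⟨⟨h1, h2⟩, h3⟩ := h
  have hn := ndB_spec l h2
  have hl : ∀ s ∈ l, s < 64 := fun s hs => by
    have := (h1 s hs).1
    rwa [Nat.blt_eq] at this
  refine memV_of_closed X hX a (l.map dec).toFinset ?_ ?_
  · intro r hr i hi
    rw [List.mem_toFinset, List.mem_map] at hr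
    obtain ⟨s, hs, rfl⟩ := hr
    refine dirOK_spec Z R pos l s i (allB_idx _ (h1 s hs).2 i) X hX hR hpos a ha ?_
    intro hh
    apply hi
    rw [List.mem_toFinset, List.mem_map]
    exact ⟨_, hh, (flp_dec s i).symm⟩
  · intro hh
    have e1 := sumB_spec l hl hn
    have e2 := Finset.card_filter_add_card_filter_not (s := (l.map dec).toFinset)
      (fun r => Even r.card)
    have e3 : (l.map dec).toFinset.card = l.length := by
      rw [List.toFinset_card_of_nodup, List.length_map]
      exact (List.nodup_map_iff_inj_on hn).2 fun x hx y hy e => dec_inj (hl x hx) (hl y hy) e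
    have e4 : Nat.beq (Nat.mul 2 (sumB parN l)) l.length = true := by
      rw [Nat.beq_eq, e1]
      show 2 * _ = _
      rw [← e3]
      omega
    rw [e4] at h3
    simp at h3

theorem chk_spec {k : Type*} [Field k] (Z : ℕ) (leaves : List ℕ) (c : Cert) :
    ∀ (R : ℕ) (pos : List ℕ), chk Z leaves c R pos = true →
    ∀ X : Finset (Finset (Fin 6)), IsGenPattern 6 X → Avoid X R → (∀ p ∈ pos, ¬ Avoid X p) →
      Good k Z leaves X := by
  induction c with
  | L j c =>
    intro R pos h X hX hR hpos
    unfold chk at h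
    simp only [Bool.and_eq_true] at h
    obtain ⟨⟨h1, h2⟩, h3⟩ := h
    obtain ⟨g, hg, -⟩ := img_spec c h1
    rw [Nat.blt_eq] at h2
    refine Or.inr ⟨g, leaves.getD j 0, ?_, ?_⟩
    · rw [List.getD_eq_getElem _ _ h2]; exact List.getElem_mem h2
    · rw [← hg]; exact Avoid.mono h3 hR
  | D l =>
    intro R pos h X hX hR hpos
    exact Or.inl fun a ha => chkD_spec Z R pos l h X hX hR hpos a ha
  | K m c1 c2 ih1 ih2 =>
    intro R pos h X hX hR hpos
    unfold chk at h
    simp only [frc_eq, Bool.and_eq_true] at h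
    by_cases hm : Avoid X (cm m)
    · exact ih1 _ _ h.1 X hX (hR.or hm) hpos
    · refine ih2 _ _ h.2 X hX hR ?_
      intro p hp
      rcases List.mem_cons.1 hp with rfl | hp
      · exact hm
      · exact hpos p hp
  | S m c1 gs c2 ih1 ih2 =>
    intro R pos h X hX hR hpos
    unfold chk at h
    simp only [frc_eq, Bool.and_eq_true] at h
    obtain ⟨⟨h1, h2⟩, h3⟩ := h
    by_cases hm : Avoid X (cm m)
    · exact ih1 _ _ h1 X hX (hR.or hm) hpos
    · by_contra hng
      apply hng
      refine ih2 _ _ h3 X hX hR ?_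
      intro p hp
      rcases List.mem_cons.1 hp with rfl | hp
      · exact hm
      · clear h3 ih2
        induction gs with
        | nil => exact hpos p hp
        | cons c gs ih =>
          rw [allB_spec] at h2
          rcases List.mem_cons.1 hp with rfl | hp
          · intro hA
            apply hng
            have hs := h2 c (by simp)
            unfold symOK at hs
            simp only [Bool.and_eq_true] at hs
            obtain ⟨⟨⟨s1, s2⟩, s3⟩, s4⟩ := hs
            obtain ⟨g, hg, hgi⟩ := img_spec c s1
            refine good_act g ?_ (ih1 _ _ h1 (act g X) (gen_act g X hX) ?_ ?_)
            · intro i hi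
              have := allB_idx _ s2 i
              simp only [hgi, tb_eq, hi] at this
              simpa using this
            · exact Avoid.or ((hg X R).1 (Avoid.mono s3 hR)) ((hg X _).1 hA)
            · intro p hp hpA
              rw [allB_spec] at s4
              obtain ⟨q, hq, hqs⟩ := anyB_spec _ _ (s4 p hp)
              exact hpos q hq (Avoid.mono hqs (hR.or ((hg X p).2 hpA)))
          · exact ih ((allB_spec _ _).2 fun q hq => h2 q (by simp [hq]))
              (List.mem_cons_of_mem _ hp) hp


/-! ### The certificates -/

def NM1 : ℕ := 18446744060808985104

def NM2 : ℕ := 18446744060725099088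

def NM3 : ℕ := 18445899639900925700

def NM1p : ℕ := 18446744060824320528

def NN5 : ℕ := 18446744052229205672

def NHEX : ℕ := 18446462590126124982

section

open Cert

def cert_main : Cert :=
  (S 574 (S 643 (S 649 (S 657 (K 673 (S 2 (S 709 (K 850 (K 838 (K 802 (D [5, 9, 12, 13]) (D [34]))
  (D [6])) (K 18 (K 838 (D [5, 9, 12, 13]) (D [6])) (D [18]))) [18568,23176] (D [5]))
  [18072,18592,23208] (D [0, 1, 2, 4, 8, 16, 32])) (K 321 (K 325 (S 322 (K 328 (K 48 (K 596 (D
  [18]) (K 724 (D [24]) (D [20]))) (D [48])) (K 808 (K 650 (K 524 (K 589 (D [9, 10, 11, 12, 13,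
  14, 15]) (D [9, 12, 13])) (D [12])) (D [10])) (K 40 (K 588 (D [10]) (K 780 (D [24]) (D [12])))
  (D [40])))) [18072,18592] (S 738 (K 518 (K 775 (K 752 (K 842 (K 616 (D [18]) (D [10, 34, 42]))
  (D [10])) (D [48])) (D [3, 6, 7])) (D [6])) [18568,18072,18584,18592,18080] (S 34 (K 40 (D [6])
  (D [40])) [18072,18592] (D [34])))) (S 581 (S 8 (K 778 (D [3, 5, 6, 7]) (D [10])) [18568] (D [0,
  1, 2, 4, 8, 16, 32, 33])) [18072,18592] (D [5]))) (S 97 (S 709 (K 338 (K 326 (K 328 (K 781 (D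
  [5, 9, 13, 17, 21, 25, 29]) (D [5, 9, 13])) (D [40])) (K 774 (D [20]) (D [6]))) (K 18 (K 852 (D
  [6]) (D [20])) (D [18]))) [18568] (D [5])) [18072,18592] (D [33])))) [22152] (S 849 (K 801 (K
  560 (S 113 (K 709 (K 524 (D [5, 9, 12, 13]) (D [5, 9, 13])) (D [5])) [18072] (D [17, 33, 48,
  49])) (S 113 (K 709 (K 524 (D [5, 9, 12, 13]) (D [5, 9, 13])) (D [5])) [18072] (D [17, 33,
  49]))) (S 97 (K 709 (K 524 (K 269 (K 262 (K 740 (K 680 (L 1 23381) (D [40])) (K 324 (D [6, 22,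
  38]) (D [36]))) (K 326 (D [10]) (D [6]))) (D [5, 9, 12, 13])) (K 269 (K 270 (K 740 (K 680 (L 1
  23381) (D [40])) (K 324 (D [6, 22, 38]) (D [36]))) (K 334 (K 596 (D [12, 28, 30, 37, 41, 44,
  45]) (D [22])) (D [14]))) (D [5, 9, 13]))) (K 261 (K 548 (K 112 (K 266 (K 680 (L 1 23381) (K 328
  (D [58]) (D [40]))) (K 10 (K 332 (K 724 (K 813 (D [5, 6, 10, 11, 12, 15, 21, 22, 24, 25, 29, 30,
  33, 35, 38, 39, 41, 42, 44, 45, 48, 50, 52, 53, 57, 58, 60, 61]) (D [6, 12, 22, 30, 33, 35, 38,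
  39, 41, 44, 45])) (D [28])) (D [12])) (K 330 (D [24]) (D [10])))) (K 176 (K 596 (K 328 (K 754 (D
  [0, 1, 2, 3, 4, 7, 8, 9, 13, 16, 17, 20, 22, 28, 30, 32, 34, 36, 37, 40, 49]) (K 802 (K 726 (D
  [0, 1, 2, 3, 4, 7, 8, 11, 15, 16, 17, 20, 22, 28, 30, 32, 34, 36, 37, 40, 49, 50]) (K 8 (K 241
  (D [5, 6, 10, 11, 12, 15, 18, 19, 21, 23, 28, 30, 33, 35, 38, 39, 41, 42, 44, 45, 48, 51, 52,
  53, 54, 55, 56, 58]) (D [0, 1, 2, 3, 4, 7, 8, 9, 13, 16, 17, 20, 22, 32, 34, 36, 37, 40, 49,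
  50])) (K 208 (D [0, 1, 2, 3, 4, 7, 8, 16, 17, 20, 22, 24, 26, 32, 34, 36, 37, 40, 49, 50]) (D
  [0, 1, 2, 3, 4, 7, 8, 16, 17, 20, 22, 32, 34, 36, 37, 40, 49, 50])))) (D [50]))) (D [40])) (K
  726 (K 332 (K 754 (K 813 (K 724 (D [0, 1, 2, 3, 4, 7, 8, 9, 13, 16, 17, 20, 28, 32, 34, 36, 37,
  40, 49, 56]) (D [28])) (D [6, 12, 33, 35, 38, 39, 41, 44, 45])) (K 802 (K 600 (K 268 (D [0, 1,
  2, 3, 4, 7, 8, 11, 15, 16, 17, 20, 24, 26, 32, 34, 36, 37, 40, 49, 50]) (D [22, 28, 30])) (D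
  [26])) (D [50]))) (D [12])) (D [22]))) (K 240 (K 710 (K 600 (K 680 (K 802 (D [0, 1, 2, 3, 4, 7,
  8, 11, 15, 16, 17, 20, 24, 26, 32, 34, 40, 41, 44, 45, 49, 50]) (D [0, 1, 2, 3, 4, 7, 8, 11, 15,
  16, 17, 20, 24, 26, 32, 34, 40, 41, 44, 45, 49])) (D [41, 44, 45])) (D [26])) (D [6])) (D
  [48])))) (K 741 (K 778 (K 326 (D [12]) (D [6])) (D [10])) (D [37]))) (D [5]))) [18072] (D
  [33]))) [22152] (S 257 (K 289 (S 258 (K 344 (K 650 (K 332 (L 1 23195) (K 524 (K 589 (D [9, 10,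
  11, 12, 13, 14, 15]) (D [9, 12, 13])) (K 588 (D [10, 12, 14]) (D [12])))) (K 330 (K 332 (L 0
  18584) (K 588 (L 1 23259) (K 524 (D [9, 12, 13]) (D [12])))) (K 10 (D [14]) (D [10])))) (K 24 (K
  588 (D [10]) (K 844 (K 680 (D [10]) (D [40])) (D [12]))) (D [24]))) [18072] (S 722 (K 518 (K 778
  (K 839 (K 600 (D [10, 18, 24, 26]) (D [10, 18, 26])) (D [3, 6, 7])) (K 330 (K 581 (D [3, 5, 6,
  7]) (D [3, 6, 7])) (D [10]))) (K 326 (K 261 (L 1 18568) (K 581 (D [3, 5, 7]) (D [5]))) (D [6])))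
  [18072] (S 338 (K 344 (K 261 (K 326 (L 1 18568) (K 518 (K 711 (K 524 (K 589 (D [3, 6, 7, 9, 11,
  12, 13, 14, 15]) (D [9, 12, 13])) (D [12])) (D [3, 6, 7])) (K 710 (K 588 (D [6, 12, 14]) (D
  [12])) (D [6])))) (K 581 (K 324 (K 711 (D [3, 5, 7, 9, 11, 13, 15]) (D [3, 5, 7])) (D [36])) (K
  709 (K 524 (D [5, 9, 12, 13]) (D [5, 9, 13])) (D [5])))) (K 24 (K 844 (K 581 (D [3, 5, 6, 7]) (D
  [3, 6, 7])) (K 588 (D [10]) (D [12]))) (D [24]))) [18072] (S 18 (K 24 (D [6]) (D [24])) [18072]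
  (D [18]))))) (K 321 (S 518 (K 524 (K 260 (K 324 (K 112 (K 754 (K 757 (K 266 (D [40]) (K 330 (D
  [24]) (D [10]))) (D [53])) (K 240 (D [0, 1, 2, 4, 8, 16, 17, 18, 20, 24, 32, 33, 34, 36, 40]) (D
  [48, 49, 50, 52]))) (K 240 (K 632 (K 629 (K 266 (D [34]) (K 330 (D [18]) (D [10]))) (D [53])) (D
  [48, 49, 52, 56])) (D [48, 49, 52]))) (D [36])) (K 852 (D [0, 1, 2, 4, 8, 16, 17, 32, 33]) (D
  [20]))) (S 268 (K 40 (K 263 (K 738 (K 740 (L 1 23245) (D [44])) (K 330 (D [10, 26, 42]) (D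
  [42]))) (K 327 (D [18]) (D [3, 6, 7]))) (K 328 (D [12, 28, 44]) (D [40]))) [22152] (D [12])))
  [18072] (S 262 (K 322 (D [6, 22, 38]) (D [34])) [22152,18072,22168] (D [6]))) (S 97 (K 113 (K
  548 (K 266 (K 680 (L 1 23381) (K 328 (D [58]) (D [40]))) (K 10 (K 332 (K 724 (D [5, 21, 24, 25,
  29]) (D [28])) (D [12])) (K 330 (D [24]) (D [10])))) (K 741 (K 324 (D [6, 22, 38]) (D [36])) (D
  [37]))) (K 241 (K 596 (D [5, 18, 19, 21, 23]) (D [22])) (D [49]))) [18072] (D [33])))) [22152]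
  (S 81 (K 97 (K 709 (K 524 (D [5, 9, 12, 13]) (D [5, 9, 13])) (D [5])) (K 225 (D [5]) (D [33])))
  [22152,18072,22168] (D [17]))))) [18568,23176] (S 777 (K 801 (S 721 (S 808 (K 773 (K 2 (K 838 (D
  [10]) (D [6])) (D [0, 1, 2, 4, 8, 16, 32])) (K 581 (K 518 (D [3, 5, 6, 7]) (D [3, 5, 7])) (D
  [5]))) [18568] (S 168 (K 581 (K 518 (K 327 (K 536 (D [10]) (D [9, 17, 25])) (D [3, 5, 6, 7])) (K
  327 (K 536 (D [9, 17, 24, 25]) (D [9, 17, 25])) (D [3, 5, 7]))) (K 325 (K 536 (K 89 (D [20]) (D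
  [9, 17, 24, 25])) (K 89 (K 260 (K 863 (D [13, 21, 24, 26, 28, 29, 58]) (D [9, 11, 15, 17, 19,
  23, 25, 27, 30, 31])) (D [20])) (D [9, 17, 25]))) (D [5]))) [18568] (S 104 (K 112 (K 581 (K 857
  (D [9, 17, 25, 33, 41, 49, 57]) (D [9, 17, 25])) (K 325 (K 89 (K 780 (K 724 (L 1 19098) (D
  [20])) (D [12])) (D [9, 17, 25])) (D [5]))) (D [48])) [18568] (D [40])))) [19080] (K 81 (S 197
  (K 532 (K 168 (K 176 (K 588 (K 858 (K 738 (K 855 (D [0, 1, 2, 3, 4, 7, 8, 9, 12, 14, 16, 18, 20,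
  21, 25, 26, 32, 36, 41, 50, 57, 58]) (K 326 (D [0, 1, 2, 3, 4, 7, 8, 9, 12, 14, 16, 18, 20, 21,
  25, 32, 34, 36, 41, 42, 57]) (D [6, 17, 19, 22, 23]))) (D [42])) (K 722 (K 96 (K 42 (D [5, 6,
  10, 11, 13, 15, 17, 19, 22, 23, 24, 27, 28, 29, 30, 31, 37, 38, 40, 41, 44, 46, 48, 50, 52, 53,
  57, 58]) (D [0, 1, 2, 3, 4, 7, 8, 9, 12, 14, 16, 18, 20, 21, 25, 26, 32, 34, 36, 42])) (K 32 (D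
  [0, 1, 2, 3, 4, 7, 8, 9, 12, 14, 16, 18, 20, 21, 25, 26, 32, 33, 36, 49]) (D [0, 1, 2, 3, 4, 7,
  8, 9, 12, 14, 16, 18, 20, 21, 25, 26, 32, 36]))) (D [26]))) (K 198 (K 620 (K 850 (K 325 (D [5,
  6, 13, 14, 17, 19, 22, 23, 24, 26, 28, 29, 34, 35, 37, 39, 40, 41, 44, 46, 48, 51, 52, 53, 54,
  55, 57, 58]) (D [5, 13, 24, 26, 28, 29, 58])) (D [50])) (K 846 (D [38]) (D [46]))) (K 846 (K 629
  (K 855 (D [0, 1, 2, 3, 4, 7, 8, 9, 12, 16, 18, 20, 21, 25, 32, 33, 36, 38, 49, 50]) (D [6, 17,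
  19, 22, 23])) (D [5, 13, 24, 28, 29, 37, 48, 52, 53])) (D [14])))) (K 112 (K 588 (K 856 (K 738
  (K 804 (D [0, 1, 2, 3, 4, 7, 8, 9, 12, 14, 16, 18, 25, 32, 34, 36, 37, 41, 42, 52, 53, 57]) (D
  [0, 1, 2, 3, 4, 7, 8, 9, 12, 14, 16, 18, 25, 32, 34, 36, 41, 42, 57])) (D [42])) (D [24])) (K
  198 (K 806 (L 1 22178) (D [6, 14, 38])) (D [14]))) (D [48]))) (K 40 (D [48]) (K 104 (K 804 (L 1
  22178) (D [36])) (D [40])))) (K 853 (D [40]) (D [21]))) [19080] (D [5])) (D [17]))) (K 321 (K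
  337 (K 536 (K 345 (K 650 (K 658 (K 324 (K 34 (D [6]) (K 290 (D [6]) (K 226 (D [6]) (D [34]))))
  (K 612 (D [6]) (D [36]))) (K 258 (K 262 (K 325 (L 1 18569) (K 581 (D [3, 5, 7]) (D [5]))) (D
  [6])) (D [18]))) (K 194 (K 198 (K 325 (L 1 18057) (K 581 (D [3, 5, 7]) (D [5]))) (K 518 (D [18])
  (D [6]))) (D [10]))) (K 89 (K 325 (K 780 (K 326 (L 0 19098) (K 198 (K 863 (K 612 (D [0, 1, 2, 3,
  4, 7, 8, 10, 12, 13, 16, 18, 22, 28, 29, 32, 33, 36, 38, 42, 48]) (D [0, 1, 2, 3, 4, 7, 8, 10,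
  12, 13, 16, 18, 22, 28, 29, 32, 33, 36, 42, 48])) (D [6, 9, 11, 14, 15, 24, 25, 26, 27, 30,
  31])) (D [6]))) (D [13, 28, 29])) (D [5])) (D [9, 24, 25]))) (K 344 (K 290 (K 650 (K 262 (K 325
  (L 1 18569) (K 581 (D [3, 5, 7]) (D [5]))) (D [6])) (K 194 (K 698 (K 690 (K 198 (K 340 (L 1
  18057) (K 532 (K 197 (L 1 19212) (D [5])) (D [20]))) (K 518 (K 581 (D [3, 5, 6, 7]) (D [3, 6,
  7])) (D [6]))) (D [34, 42, 50])) (D [58])) (K 10 (K 588 (K 197 (K 262 (D [36, 44, 46, 52, 53])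
  (D [6])) (D [5])) (D [14])) (D [10])))) (K 34 (K 10 (D [6]) (D [10])) (K 226 (K 658 (K 198 (K
  340 (L 1 18057) (K 532 (K 197 (L 1 19212) (K 581 (D [3, 5, 7]) (D [5]))) (K 596 (D [3, 5, 7]) (D
  [20])))) (K 518 (K 581 (D [3, 5, 6, 7]) (D [3, 6, 7])) (D [6]))) (D [18])) (D [34])))) (K 152 (K
  168 (K 338 (K 778 (L 1 18715) (K 88 (D [46]) (D [26]))) (K 258 (K 842 (L 2 23184) (K 42 (K 620
  (K 753 (K 588 (K 722 (D [5, 6, 10, 11, 13, 15, 17, 19, 22, 23, 24, 27, 28, 29, 30, 31, 34, 35,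
  37, 39, 40, 41, 44, 46, 49, 50, 57, 58]) (D [26])) (K 198 (L 2 22290) (D [14]))) (D [40, 41, 44,
  46, 57])) (D [46])) (D [42]))) (K 722 (K 34 (D [6]) (D [34])) (D [18])))) (K 40 (K 613 (K 290 (K
  34 (K 754 (K 605 (K 727 (D [0, 1, 2, 3, 4, 7, 8, 9, 12, 14, 16, 18, 20, 21, 25, 26, 32, 33, 48,
  56]) (D [6, 17, 19, 22, 23, 40, 41, 49, 57])) (K 88 (L 2 22290) (D [5, 13, 24, 28, 29]))) (D
  [34, 35, 37, 39, 50])) (D [35, 37, 39])) (D [34])) (D [37])) (D [40]))) (K 88 (K 120 (K 780 (L 1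
  18203) (K 196 (D [6, 14, 38]) (D [12]))) (K 752 (K 612 (K 198 (K 842 (K 197 (K 658 (K 325 (D [5,
  13, 28, 29, 35, 37, 39]) (D [35, 37, 39])) (K 81 (L 2 22290) (D [19, 22, 23]))) (K 325 (K 780 (K
  658 (D [6, 11, 14, 15, 20, 21, 24, 26, 27, 30, 31, 34, 40, 43, 44, 45, 46, 47, 50, 51, 52, 53,
  54, 55, 58, 59, 60, 61, 62, 63]) (K 81 (D [0, 1, 2, 3, 4, 7, 8, 10, 12, 13, 16, 18, 28, 29, 32,
  33, 36, 38, 42, 48, 56]) (D [19, 22, 23]))) (D [13, 28, 29])) (D [5]))) (K 42 (L 2 22290) (D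
  [42]))) (D [6])) (K 550 (K 340 (K 199 (D [17, 20, 40, 41, 44, 49, 52, 57, 60]) (D [3, 6, 7])) (D
  [20])) (D [38]))) (D [56]))) (D [24]))))) (K 721 (K 536 (K 89 (K 121 (K 780 (K 724 (L 1 19098)
  (D [20])) (K 196 (D [20]) (D [12]))) (D [41, 49, 56, 57])) (D [9, 17, 24, 25])) (K 89 (K 121 (K
  814 (K 724 (L 1 19098) (D [20])) (D [46])) (D [41, 49, 57])) (D [9, 17, 25]))) (K 81 (K 325 (K
  532 (K 113 (K 104 (K 780 (L 1 19098) (K 196 (D [46]) (D [12]))) (K 168 (K 722 (K 10 (K 588 (D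
  [40, 41, 44, 46, 57]) (D [14])) (D [10])) (D [26])) (K 40 (D [24]) (D [40])))) (K 753 (K 168 (K
  612 (K 197 (K 262 (K 727 (K 605 (D [0, 1, 2, 3, 4, 7, 8, 9, 12, 14, 16, 18, 20, 21, 25, 26, 32,
  33, 36, 38]) (D [5, 13, 24, 28, 29, 34, 35, 37, 39])) (K 198 (L 2 22290) (D [6, 17, 19, 22,
  23]))) (K 198 (L 2 22290) (D [6]))) (D [5, 34, 35, 37, 39])) (D [38])) (D [40])) (D [49]))) (K
  725 (D [40]) (D [21]))) (K 197 (K 612 (K 752 (K 262 (K 727 (K 605 (K 858 (D [0, 1, 2, 3, 4, 7,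
  8, 9, 12, 14, 16, 18, 20, 21, 25, 26, 32, 33, 44, 46, 50, 58]) (D [0, 1, 2, 3, 4, 7, 8, 9, 12,
  14, 16, 18, 20, 21, 25, 26, 32, 33])) (D [5, 13, 24, 28, 29])) (K 198 (L 2 22290) (D [6, 17, 19,
  22, 23]))) (K 198 (L 2 22290) (D [6]))) (D [48])) (D [36])) (D [5]))) (D [17])))) (K 97 (K 773
  (K 721 (K 326 (K 536 (D [9, 17, 24, 25]) (D [9, 17, 25])) (D [6])) (D [17])) (K 197 (K 81 (K 532
  (K 548 (K 588 (K 262 (K 858 (D [0, 1, 2, 3, 4, 7, 8, 9, 12, 14, 16, 18, 20, 21, 25, 32, 34, 36,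
  37, 41, 57]) (K 722 (K 857 (D [5, 6, 10, 11, 13, 15, 17, 19, 22, 23, 24, 27, 28, 29, 30, 31, 43,
  44, 45, 46, 47, 49, 51, 54, 55, 59, 60, 61, 62, 63]) (K 160 (K 229 (D [5, 6, 10, 11, 13, 15, 17,
  19, 22, 23, 24, 27, 28, 29, 30, 31, 33, 35, 38, 39, 41, 42, 48, 50, 52, 53, 57, 58]) (D [0, 1,
  2, 3, 4, 7, 8, 9, 12, 14, 16, 18, 20, 21, 25, 26, 32, 34, 36, 37])) (K 224 (D [0, 1, 2, 3, 4, 7,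
  8, 9, 12, 14, 16, 18, 20, 21, 25, 26, 32, 34, 40, 56]) (D [0, 1, 2, 3, 4, 7, 8, 9, 12, 14, 16,
  18, 20, 21, 25, 26, 32, 34])))) (D [26]))) (K 326 (K 225 (D [24]) (D [6, 33, 35, 38, 39])) (D
  [6]))) (K 198 (L 1 22178) (K 334 (K 152 (D [5, 13, 24, 28, 29]) (D [24])) (D [14])))) (K 229 (K
  568 (K 198 (L 0 22178) (K 262 (K 588 (K 727 (K 294 (D [5, 6, 10, 11, 13, 15, 17, 19, 22, 23, 24,
  27, 28, 29, 30, 31, 33, 35, 36, 39, 41, 42, 44, 46, 52, 53, 56, 57]) (D [0, 1, 2, 3, 4, 7, 8, 9,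
  12, 14, 16, 18, 20, 21, 25, 26, 32, 34, 38, 40])) (D [6, 17, 19, 22, 23])) (D [14])) (D [6])))
  (K 121 (L 0 22178) (D [33, 35, 39, 41, 57]))) (D [37]))) (K 853 (K 176 (K 548 (K 754 (D [21, 42,
  48, 50, 52, 53, 58]) (D [21, 48, 50, 52, 53])) (D [37])) (D [21, 52, 53])) (D [21]))) (K 849 (K
  326 (K 152 (K 588 (K 722 (K 548 (K 802 (D [0, 1, 2, 3, 4, 7, 8, 9, 12, 14, 16, 20, 25, 32, 34,
  36, 37, 41, 42, 50, 57, 58]) (D [0, 1, 2, 3, 4, 7, 8, 9, 12, 14, 16, 20, 25, 32, 34, 36, 37, 41,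
  57])) (D [37])) (D [18])) (D [14])) (D [24])) (D [6])) (D [17]))) (D [5]))) (K 225 (K 81 (K 560
  (K 197 (K 532 (K 722 (K 682 (K 152 (K 588 (K 853 (D [0, 1, 2, 3, 4, 7, 8, 9, 12, 14, 16, 18, 20,
  21, 25, 26, 32, 35, 39, 40, 52, 53]) (K 288 (D [0, 1, 2, 3, 4, 7, 8, 9, 12, 14, 16, 18, 20, 21,
  25, 26, 32, 40, 48, 49]) (D [0, 1, 2, 3, 4, 7, 8, 9, 12, 14, 16, 18, 20, 21, 25, 26, 32, 40])))
  (K 846 (D [0, 1, 2, 3, 4, 7, 8, 9, 12, 16, 18, 20, 21, 25, 26, 32, 35, 39, 40, 48, 49]) (D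
  [14]))) (D [24])) (D [42])) (K 88 (L 1 22804) (D [26]))) (K 853 (K 292 (K 620 (D [21, 36, 42,
  44, 46, 52, 53]) (D [21, 36, 44, 52, 53])) (D [21, 52, 53])) (D [21]))) (K 837 (K 262 (K 588 (K
  344 (K 722 (K 680 (D [0, 1, 2, 3, 4, 7, 8, 9, 16, 18, 20, 25, 26, 32, 35, 39, 40, 42, 44, 46,
  48, 49]) (D [42, 44, 46])) (D [26])) (D [24])) (D [12])) (D [6])) (D [5]))) (D [49])) (D [17]))
  (D [33]))))) [22152,18568,22664,23176,19080] (S 193 (S 209 (K 225 (K 10 (S 774 (K 658 (K 322 (K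
  197 (K 342 (L 0 18056) (D [6, 18, 22])) (D [5])) (D [34])) (K 338 (K 197 (L 1 19209) (D [5])) (D
  [18]))) [22152] (S 262 (K 197 (K 698 (L 1 22665) (K 298 (L 0 22152) (K 858 (D [6, 17, 19, 22,
  23, 25, 51, 54, 55]) (D [58])))) (K 261 (K 322 (D [49, 51, 54, 55, 57]) (D [34])) (K 837 (K 674
  (K 292 (L 1 22344) (D [36])) (K 290 (L 1 22344) (D [34]))) (K 325 (K 858 (D [10, 11, 15, 26,
  58]) (K 298 (L 0 23176) (D [58]))) (D [5]))))) [22152] (D [6]))) (S 266 (K 674 (K 262 (K 197 (L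
  1 22665) (K 261 (K 548 (L 1 22349) (D [36])) (K 581 (K 839 (K 612 (K 550 (D [3, 5, 7, 34, 35,
  36, 37, 38, 39]) (K 294 (L 1 22344) (D [34, 36, 38]))) (K 292 (L 1 22344) (D [36]))) (D [3, 5,
  7])) (K 837 (K 292 (L 1 22344) (K 548 (D [5, 36, 37]) (D [36]))) (D [5]))))) (K 518 (K 196 (K
  839 (D [3, 6, 7, 34, 35, 38, 39]) (D [3, 6, 7])) (D [12])) (K 838 (K 612 (D [12]) (D [6, 34,
  38])) (D [6])))) (K 290 (K 197 (K 262 (L 0 22152) (K 518 (K 839 (L 1 22857) (D [3, 6, 7])) (K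
  838 (L 1 22857) (K 326 (L 0 18056) (D [6]))))) (K 837 (K 260 (L 1 22344) (D [20])) (K 581 (K 518
  (D [3, 5, 6, 7]) (D [3, 5, 7])) (K 325 (K 518 (D [3, 6, 7]) (K 262 (L 0 23176) (D [6]))) (D
  [5]))))) (K 322 (K 666 (K 326 (K 212 (L 1 19081) (K 532 (K 325 (L 1 18188) (D [5])) (D [20])))
  (K 518 (K 581 (D [3, 5, 6, 7]) (D [3, 6, 7])) (D [6]))) (D [10, 26, 42])) (D [34])))) [22152] (D
  [10]))) (K 321 (K 697 (K 689 (K 804 (K 196 (K 194 (K 802 (K 48 (L 1 19213) (D [48])) (D [34]))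
  (K 842 (D [0, 1, 2, 4, 8, 9, 12, 16, 24, 32, 33]) (D [10]))) (D [12])) (K 612 (K 198 (K 34 (L 1
  19093) (D [34])) (D [6])) (D [36]))) (K 337 (K 665 (K 588 (K 326 (K 10 (L 1 18067) (D [10])) (D
  [6])) (D [12])) (K 289 (D [18]) (K 81 (D [5]) (D [17, 25, 49])))) (K 48 (K 842 (D [18]) (K 266
  (K 740 (L 1 23245) (D [36])) (D [10]))) (D [49])))) (K 857 (K 48 (K 842 (K 210 (D [34]) (D
  [18])) (K 194 (K 802 (K 813 (L 1 19213) (D [45])) (K 112 (D [40, 41, 42, 44]) (D [50]))) (K 266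
  (K 738 (K 757 (L 1 23245) (D [53])) (D [42])) (D [10])))) (K 113 (K 621 (L 2 23314) (K 741 (D
  [13]) (D [45]))) (D [49]))) (K 56 (K 842 (K 210 (D [34]) (D [18])) (K 194 (K 802 (K 813 (L 1
  19213) (D [45])) (K 322 (K 621 (D [43, 45, 46, 47]) (D [43, 46, 47])) (D [34]))) (K 266 (K 738
  (K 757 (L 1 23245) (D [53])) (D [42])) (D [10])))) (K 121 (D [5, 13, 37]) (D [57]))))) (K 289 (K
  18 (K 198 (K 322 (D [41, 43, 46, 47, 57]) (D [34])) (K 326 (K 588 (K 197 (D [5, 10, 11, 13, 15])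
  (D [5])) (D [14])) (D [6]))) (K 210 (K 674 (K 548 (L 1 22861) (K 292 (L 0 22377) (D [36]))) (K
  322 (D [18, 26, 50]) (D [34]))) (K 338 (D [10]) (D [18])))) (K 97 (K 105 (K 548 (K 560 (L 1
  19285) (K 113 (L 0 18090) (D [49]))) (K 805 (K 340 (D [6, 14, 38]) (D [37, 52, 53])) (D [37])))
  (D [41])) (D [33]))))) [22152] (S 257 (K 321 (S 778 (K 802 (K 722 (K 858 (D [10, 18, 26, 34, 42,
  50, 58]) (D [10, 18, 26])) (K 850 (D [18, 34, 50]) (D [18]))) (K 322 (K 813 (K 340 (L 1 18187)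
  (K 724 (D [10, 18, 26]) (D [20]))) (D [45])) (D [34]))) [22152] (K 194 (S 858 (K 861 (K 850 (K
  804 (D [18, 34, 50]) (D [36])) (K 258 (K 160 (D [0, 1, 2, 4, 8, 9, 10, 12, 16, 17, 18, 20, 32,
  33, 34, 36]) (D [0, 1, 2, 4, 8, 9, 10, 12, 16, 17, 18, 20, 32, 33])) (D [18]))) (D [29]))
  [22152] (S 88 (D [24, 25, 26, 28]) [22152] (D [26]))) (D [10]))) (K 289 (K 681 (K 844 (K 680 (K
  740 (D [10]) (D [12, 40, 44])) (D [40])) (K 588 (K 262 (K 10 (L 1 22163) (D [10])) (D [6])) (D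
  [12]))) (K 105 (K 605 (K 753 (L 2 18258) (D [57])) (K 781 (D [21]) (D [29]))) (D [41]))) (K 97
  (S 809 (K 261 (K 588 (K 113 (L 2 18770) (K 753 (D [5, 10, 11, 13, 15, 18, 19, 21, 23]) (D
  [49]))) (K 198 (D [5, 13, 21]) (D [14]))) (D [5])) [18568] (S 105 (K 113 (D [5, 13, 21]) (D
  [49])) [18568] (D [41]))) (D [33])))) [22152] (S 81 (K 97 (K 197 (S 532 (K 548 (K 588 (D [5, 10,
  11, 13, 15]) (K 198 (L 1 22178) (D [14]))) (D [37])) [22152] (D [21])) (D [5])) (D [33]))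
  [22152] (D [17])))) [18568,23176] (S 73 (S 81 (K 837 (D [33]) (D [5])) [22152] (D [17]))
  [18568,23176] (D [9])))))
  [18120,18696,23368,18064,18128,18704,23376,18136,18072,18200,22360,18720,18592,18656,22880,23400,23208,23272,19240]
  (S 65 (S 129 (S 193 (S 81 (K 97 (S 84 (K 664 (K 680 (L 1 22179) (K 332 (D [43]) (D [44]))) (K
  264 (K 859 (K 168 (D [10, 11, 14, 15, 26]) (D [40])) (K 155 (K 225 (D [33, 35, 41]) (D [41])) (D
  [27]))) (K 152 (K 328 (D [10, 11, 14, 15, 42]) (D [40])) (K 344 (D [25]) (D [24]))))) [18120] (S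
  724 (K 664 (K 348 (D [6, 7, 38]) (D [20, 24, 28])) (K 344 (D [25]) (D [24])))
  [22152,18120,22216] (S 260 (K 161 (K 727 (K 743 (K 264 (D [17, 19, 21, 25]) (K 152 (L 1 22753)
  (D [24]))) (D [39])) (D [23])) (K 229 (K 726 (K 675 (L 2 19281) (D [39])) (D [6, 7, 22])) (D
  [37]))) [22152,18120,22216] (D [20])))) (S 161 (K 163 (K 616 (K 665 (L 2 18251) (K 209 (K 859 (K
  213 (D [30]) (D [29])) (D [27])) (D [25]))) (K 170 (K 726 (K 344 (D [25]) (D [24])) (K 92 (L 0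
  23340) (D [30]))) (K 226 (K 302 (D [33, 37, 41]) (D [46])) (K 298 (K 225 (D [33, 37, 41]) (D
  [41])) (D [42]))))) (K 739 (K 169 (K 260 (K 726 (L 1 22753) (D [6, 7, 22])) (K 212 (K 658 (L 2
  22801) (D [22])) (D [20]))) (K 617 (K 298 (K 145 (D [6, 7, 22]) (D [21])) (D [34, 40, 42])) (D
  [41]))) (K 227 (K 725 (K 613 (L 2 19274) (D [39])) (K 145 (K 199 (D [6, 7, 14, 15, 22]) (D [6,
  7, 22])) (D [21]))) (D [35])))) [18120] (D [33]))) [22152,18064,22160,18136,22232] (D [17]))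
  [18568,23176] (S 73 (S 81 (K 97 (S 781 (K 805 (K 724 (K 780 (D [12, 20, 28]) (D [12])) (K 852 (K
  804 (D [20, 36, 52]) (D [36])) (D [20]))) (K 161 (D [33, 35, 37]) (D [37])))
  [22152,18568,22664,23176,19080] (S 137 (D [9, 11, 13]) [18568,23176] (D [13]))) (K 161 (K 163 (K
  552 (K 560 (L 1 19293) (K 753 (K 336 (D [34, 38, 50]) (D [48])) (K 177 (L 0 19179) (D [49]))))
  (K 809 (K 328 (D [34, 38, 42]) (D [40])) (K 169 (K 753 (K 758 (L 0 23340) (D [54])) (K 560 (L 0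
  23340) (D [49]))) (D [41])))) (D [35])) (D [33]))) [22152] (S 145 (K 161 (K 147 (K 536 (K 552 (L
  1 22755) (K 809 (K 328 (D [0, 1, 2, 3, 4, 5, 6, 7, 8, 10, 16, 20, 32, 36, 40]) (D [40])) (D
  [41]))) (K 857 (K 264 (D [18, 22, 26]) (D [24])) (D [25]))) (S 851 (K 803 (K 137 (K 843 (K 850
  (D [19, 35, 51]) (D [18])) (D [9, 11, 13])) (D [13])) (D [35])) [22152] (D [19]))) (D [33]))
  [22152] (D [17]))) [18568,23176,18064,18576,23184] (D [9]))) [18120,18696,23368] (S 69 (S 73 (S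
  81 (D [33]) [22152] (D [17])) [18568,23176] (D [9])) [18120,18696,23368] (D [5])))
  [18064,18136,18720,23400] (D [3]))) [18057,18066,18139,18724,23405] (D [63]))

theorem chk_main : chk 0 [NM1, NM2, NM3] cert_main 0
    [12297829382473034408, 14757395258967641288, 17361641481138401504, 18374966859414961664, 18446462603027677184, 18446744065119617024] = true := by decide +kernel

def cert_i1 : Cert :=
  (S 636 (S 710 (S 722 (K 738 (S 68 (K 600 (K 844 (D [36]) (D [12])) (D [24])) [18184,22344] (D
  [0, 2, 4, 8, 16, 32])) (K 322 (S 588 (K 804 (K 852 (D [6, 12, 14]) (D [20])) (K 324 (K 112 (D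
  [20]) (D [48])) (D [36]))) [18184] (S 332 (D [24]) [18184] (D [12]))) (S 162 (K 778 (K 332 (K
  340 (D [10, 18, 26]) (D [20])) (D [12])) (D [10])) [18184] (D [34])))) [22152] (S 850 (K 802 (K
  624 (K 178 (D [10]) (D [18, 34, 48, 50])) (K 178 (D [10]) (D [18, 34, 50]))) (K 162 (K 266 (K
  268 (L 0 18776) (K 332 (K 664 (K 804 (D [0, 2, 4, 6, 8, 14, 16, 18, 24, 28, 32, 36, 40, 42, 50,
  52]) (D [0, 2, 4, 6, 8, 14, 16, 18, 24, 28, 32, 36, 40, 42, 50])) (D [28])) (D [12]))) (D [10]))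
  (D [34]))) [22152] (S 258 (K 290 (K 84 (K 332 (K 266 (L 0 18568) (D [10])) (D [12])) (K 340 (K
  266 (K 588 (D [6, 12, 14]) (K 332 (L 0 18568) (D [12]))) (K 650 (K 588 (D [6, 10, 12, 14]) (D
  [6, 10, 14])) (D [10]))) (D [20]))) (K 322 (S 852 (K 804 (D [20, 36, 52]) (D [36])) [22152] (S
  260 (K 324 (D [0, 2, 4, 8, 16, 18, 20, 24, 32, 34, 36, 40]) (D [36])) [22152] (D [20]))) (K 162
  (K 178 (L 0 18776) (D [50])) (D [34])))) [22152] (S 146 (K 842 (D [34]) (D [10])) [22152] (D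
  [18]))))) [18568,23176,18120,18632,23240,18696,18184,19208,23368,22344,22856] (S 130 (S 194 (S
  146 (K 162 (K 264 (K 858 (D [12, 14, 28]) (D [18, 22, 26])) (K 344 (D [26]) (D [24]))) (K 226 (K
  230 (L 0 19296) (D [38])) (D [34]))) [22152,18120,22216] (D [18])) [18568,23176] (S 138 (S 146
  (D [34]) [22152] (D [18])) [18568,23176] (D [10]))) [18120,18696,23368] (D [6])))
  [18064,18136,18720,23400] (D [62]))

theorem chk_i1 : chk 1 [NN5] cert_i1 12297829382473034408
    [14757395258967641288, 17361641481138401504, 18374966859414961664, 18446462603027677184, 18446744065119617024] = true := by decide +kernel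

def cert_i2 : Cert :=
  (S 696 (S 664 (K 680 (K 208 (K 844 (D [20]) (D [12])) (K 224 (D [48]) (D [0, 4, 8, 16, 32]))) (K
  328 (K 240 (D [20]) (D [48])) (K 296 (D [12]) (D [40])))) [22152,22664] (S 264 (K 844 (D [20])
  (D [12])) [22152,22664] (D [24]))) [18120,18696,23368] (D [60]))

theorem chk_i2 : chk 3 [] cert_i2 17216961135462248168
    [17361641481138401504, 18374966859414961664, 18446462603027677184, 18446744065119617024] = true := by decide +kernel

def cert_i3 : Cert :=
  (S 856 (K 208 (D [40]) (D [0, 8, 16, 32])) [22152,22664] (S 264 (D [0, 8, 16, 24, 32])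
  [22152,22664] (D [24])))

theorem chk_i3 : chk 7 [] cert_i3 18374403900871474920
    [18374966859414961664, 18446462603027677184, 18446744065119617024] = true := by decide +kernel

def cert_i4 : Cert :=
  (D [0, 16, 32])

theorem chk_i4 : chk 15 [] cert_i4 18446462594437807848
    [18446462603027677184, 18446744065119617024] = true := by decide +kernel

def cert_i6 : Cert :=
  (D [0])

theorem chk_i6 : chk 63 [] cert_i6 18446744069414518504
    [] = true := by decide +kernel

def cert_m1a : Cert :=
  (K 297 (K 261 (L 0 18056) (D [5])) (D [41]))

theorem chk_m1a : chk 8 [NM1p] cert_m1a NM1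
    [12297829382473034408, 14757395258967641288, 17361641481138401504, 18374966859414961664, 18446462603027677184, 18446744065119617024] = true := by decide +kernel

def cert_m1b : Cert :=
  (K 298 (K 262 (L 0 22665) (D [6])) (D [42]))

theorem chk_m1b : chk 32 [NM1p] cert_m1b NM1
    [12297829382473034408, 14757395258967641288, 17361641481138401504, 18374966859414961664, 18446462603027677184, 18446744065119617024] = true := by decide +kernel

def cert_m2a : Cert :=
  (K 105 (D [5]) (K 297 (D [5]) (D [41])))

theorem chk_m2a : chk 8 [] cert_m2a NM2
    [12297829382473034408, 14757395258967641288, 17361641481138401504, 18374966859414961664, 18446462603027677184, 18446744065119617024] = true := by decide +kernel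

def cert_m2b : Cert :=
  (K 198 (D [56]) (K 774 (D [42]) (D [6])))

theorem chk_m2b : chk 32 [] cert_m2b NM2
    [12297829382473034408, 14757395258967641288, 17361641481138401504, 18374966859414961664, 18446462603027677184, 18446744065119617024] = true := by decide +kernel

def cert_m1pa : Cert :=
  (D [6])

theorem chk_m1pa : chk 32 [] cert_m1pa NM1p
    [12297829382473034408, 14757395258967641288, 17361641481138401504, 18374966859414961664, 18446462603027677184, 18446744065119617024] = true := by decide +kernel

def cert_m1pb : Cert :=
  (D [5])

theorem chk_m1pb : chk 24 [] cert_m1pb NM1p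
    [12297829382473034408, 14757395258967641288, 17361641481138401504, 18374966859414961664, 18446462603027677184, 18446744065119617024] = true := by decide +kernel

def cert_m3a : Cert :=
  (K 808 (K 666 (K 24 (K 262 (K 550 (K 161 (L 0 18056) (D [6, 22, 26, 30, 37, 38, 39])) (D [6, 22,
  26, 30, 38])) (D [22, 26, 30])) (D [24])) (D [26])) (D [56]))

theorem chk_m3a : chk 2 [NHEX] cert_m3a NM3
    [] = true := by decide +kernel

def cert_m3b : Cert :=
  (K 546 (K 651 (K 259 (K 12 (K 812 (K 262 (L 0 18056) (D [22, 24, 25, 26, 30, 41, 57])) (D [11,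
  12, 13, 15, 44])) (D [11, 13, 15])) (D [3])) (D [11])) (D [35]))

theorem chk_m3b : chk 8 [NHEX] cert_m3b NM3
    [] = true := by decide +kernel

def cert_m3c : Cert :=
  (K 650 (K 550 (K 262 (K 12 (K 259 (K 809 (L 0 18056) (D [6, 22, 24, 25, 26, 30, 57])) (D [3, 11,
  12, 13, 15])) (D [12])) (D [6])) (D [38])) (D [14]))

theorem chk_m3c : chk 32 [NHEX] cert_m3c NM3
    [] = true := by decide +kernel

def cert_n5a : Cert :=
  (D [18])

theorem chk_n5a : chk 9 [] cert_n5a NN5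
    [14757395258967641288, 17361641481138401504, 18374966859414961664, 18446462603027677184, 18446744065119617024] = true := by decide +kernel

def cert_n5b : Cert :=
  (D [20])

theorem chk_n5b : chk 33 [] cert_n5b NN5
    [14757395258967641288, 17361641481138401504, 18374966859414961664, 18446462603027677184, 18446744065119617024] = true := by decide +kernel

end


/-! ### Triangular minors -/

/-- source of a matching code -/
def src (e : ℕ) : ℕ := Nat.shiftRight e 3

/-- direction of a matching code -/
def dir (e : ℕ) : ℕ := Nat.land e 7

/-- target of a matching code -/
def tgt (e : ℕ) : ℕ := Nat.xor (src e) (Nat.pow 2 (dir e))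

def rowOK (R : ℕ) (pos : List ℕ) (rest : List ℕ) (t i : ℕ) (j : ℕ) : Bool :=
  Nat.beq j i || !elemB (Nat.xor t (Nat.pow 2 j)) rest || dead R pos (eM t j)

def triOK (NZ R : ℕ) (pos : List ℕ) : List ℕ → Bool
  | [] => true
  | e :: es => Nat.blt (src e) 64 && Nat.blt (dir e) 6 && sb (eM (tgt e) (dir e)) R &&
      (!tb (tgt e) (dir e) || tb NZ (dir e)) &&
      allB (rowOK R pos (es.map src) (tgt e) (dir e)) idx && triOK NZ R pos es

theorem sgn_ne {k : Type*} [Field k] (r : Finset (Fin 6)) (i : Fin 6) : sgn k r i ≠ 0 := by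
  intro h
  have := sgn_sq (R := k) r i
  rw [h] at this
  simp at this

theorem ent_val {k : Type*} [Field k] (X : Finset (Finset (Fin 6))) (R : ℕ) (hR : Avoid X R)
    (a : Fin 6 → k) (t : ℕ) (i : Fin 6) (h : sb (eM t i.val) R = true) :
    ent X a (dec t) i = sgn k (dec t) i * (if t.testBit i.val = true then a i else 1) := by
  unfold ent
  rw [if_pos ((EE_iff X t i).2 (Avoid.mono h hR))]
  simp only [mem_dec]

theorem triOK_spec {k : Type*} [Field k] (X : Finset (Finset (Fin 6))) (hX : IsGenPattern 6 X)
    (NZ R : ℕ) (pos : List ℕ) (hR : Avoid X R) (hpos : ∀ p ∈ pos, ¬ Avoid X p) (a : Fin 6 → k)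
    (ha : ∀ i : Fin 6, NZ.testBit i.val = true → a i ≠ 0) (x : Finset (Fin 6) → k) (es : List ℕ) :
    triOK NZ R pos es = true → (∀ s < 64, s ∉ es.map src → x (dec s) = 0) →
    (∀ e ∈ es, ∑ j, ent X a (dec (tgt e)) j * x (flp (dec (tgt e)) j) = 0) →
    ∀ s < 64, x (dec s) = 0 := by
  induction es with
  | nil => intro _ h _ s hs; exact h s hs (by simp)
  | cons e es ih =>
    intro hok h0 heq
    unfold triOK at hok
    simp only [Bool.and_eq_true] at hok
    obtain ⟨⟨⟨⟨⟨k1, k2⟩, k3⟩, k4⟩, k5⟩, k6⟩ := hok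
    rw [Nat.blt_eq] at k1 k2
    generalize hi : (⟨dir e, k2⟩ : Fin 6) = i at *
    have hdi : dir e = i.val := by rw [← hi]
    have ht : tgt e = src e ^^^ 2 ^ i.val := by rw [← hdi]; rfl
    have htl : tgt e < 64 := by rw [ht]; exact xor_lt _ k1 i
    rw [hdi] at k3 k4 k5
    have hs0 : x (dec (src e)) = 0 := by
      have hE := heq e (by simp)
      rw [Finset.sum_eq_single i] at hE
      · have hne : ent X a (dec (tgt e)) i ≠ 0 := by
          rw [ent_val X R hR a _ i k3]
          refine mul_ne_zero (sgn_ne _ _) ?_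
          split_ifs with hb
          · rw [tb_eq, hb, tb_eq] at k4
            exact ha i (by simpa using k4)
          · exact one_ne_zero
        have := (mul_eq_zero.1 hE).resolve_left hne
        rwa [ht, ← flp_dec, flp_flp] at this
      · intro j _ hji
        have := allB_idx _ k5 j
        unfold rowOK at this
        simp only [Bool.or_eq_true, Nat.beq_eq] at this
        rcases this with (h1 | h1) | h1
        · exact absurd (Fin.ext h1) hji
        · rw [flp_dec]
          have h2 : (tgt e ^^^ 2 ^ j.val) ∉ es.map src := by
            rw [← elemB_spec]
            intro hh
            have hh' : elemB (Nat.xor (tgt e) (Nat.pow 2 j.val)) (es.map src) = true := hh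
            rw [hh'] at h1
            simp at h1
          rw [h0 _ (xor_lt _ htl j) ?_, mul_zero]
          rw [List.map_cons, List.mem_cons]
          rintro (hh | hh)
          · apply hji
            have : flp (flp (dec (src e)) i) j = dec (src e) := by
              rw [flp_dec, flp_dec, ← ht, hh]
            have h3 : flp (flp (dec (src e)) i) j = flp (flp (dec (src e)) i) i := by
              rw [this, flp_flp]
            exact flp_inj h3
          · exact h2 hh
        · rw [ent_zero (Or.inl (dead_spec X hX R pos _ h1 hR hpos)), zero_mul]
      · simp
    refine ih k6 ?_ fun e' he' => heq e' (by simp [he'])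
    intro s hs hns
    by_cases hse : s = src e
    · rw [hse]; exact hs0
    · exact h0 s hs (by rw [List.map_cons, List.mem_cons]; tauto)

theorem card_dec (l : List ℕ) (h : allB (fun s => Nat.blt s 64) l = true) (hn : ndB l = true) :
    ((l.map dec).toFinset).card = l.length := by
  rw [allB_spec] at h
  rw [List.toFinset_card_of_nodup, List.length_map]
  refine (List.nodup_map_iff_inj_on (ndB_spec l hn)).2 fun x hx y hy e => dec_inj ?_ ?_ e
  · have := h x hx; rwa [Nat.blt_eq] at this
  · have := h y hy; rwa [Nat.blt_eq] at this

def minorOK (es : List ℕ) : Bool :=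
  Nat.beq es.length 32 && allB (fun s => Nat.blt s 64) (es.map src) && ndB (es.map src) &&
    allB (fun s => Nat.blt s 64) (es.map tgt) && ndB (es.map tgt)

theorem notMem_of_codes {k : Type*} [Field k] (X : Finset (Finset (Fin 6))) (a : Fin 6 → k)
    (es : List ℕ) (hes : minorOK es = true)
    (h : ∀ x : Finset (Fin 6) → k, (∀ s < 64, s ∉ es.map src → x (dec s) = 0) →
      (∀ e ∈ es, ∑ j, ent X a (dec (tgt e)) j * x (flp (dec (tgt e)) j) = 0) →
      ∀ s < 64, x (dec s) = 0) :
    a ∉ supportVariety k X := by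
  unfold minorOK at hes
  simp only [Bool.and_eq_true, Nat.beq_eq] at hes
  obtain ⟨⟨⟨⟨h1, h2⟩, h3⟩, h4⟩, h5⟩ := hes
  refine notMem_of_null X a ((es.map src).map dec).toFinset ((es.map tgt).map dec).toFinset ?_ ?_ ?_
  · rw [card_dec _ h2 h3, List.length_map, h1]
  · rw [card_dec _ h4 h5, List.length_map, h1]
  · intro x hx hr s _
    rw [← dec_enc s]
    refine h x ?_ ?_ _ (enc_lt s)
    · intro s hs hns
      apply hx
      rw [List.mem_toFinset]
      intro hh
      obtain ⟨q, hq, e⟩ := List.mem_map.1 hh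
      rw [allB_spec] at h2
      have := h2 q hq
      rw [Nat.blt_eq] at this
      exact hns (dec_inj this hs e ▸ hq)
    · intro e he
      apply hr
      rw [List.mem_toFinset]
      exact List.mem_map_of_mem (List.mem_map_of_mem he)

theorem notMem_tri {k : Type*} [Field k] (X : Finset (Finset (Fin 6))) (hX : IsGenPattern 6 X)
    (NZ R : ℕ) (pos : List ℕ) (es : List ℕ)
    (h : (minorOK es && triOK NZ R pos es) = true)
    (hR : Avoid X R) (hpos : ∀ p ∈ pos, ¬ Avoid X p) (a : Fin 6 → k)
    (ha : ∀ i : Fin 6, NZ.testBit i.val = true → a i ≠ 0) : a ∉ supportVariety k X := by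
  rw [Bool.and_eq_true] at h
  exact notMem_of_codes X a es h.1 fun x => triOK_spec X hX NZ R pos hR hpos a ha x es h.2


def tri_m1 : List ℕ :=
  [5, 21, 69, 85, 101, 149, 197, 213, 229, 267, 378, 395, 506, 11, 117, 122, 133, 139, 245,
  250, 299, 314, 427, 442, 37, 43, 53, 58, 165, 171, 181, 186]

theorem tok_m1 : (minorOK tri_m1 && triOK 40 NM1
    [12297829382473034408, 14757395258967641288, 17361641481138401504, 18374966859414961664, 18446462603027677184, 18446744065119617024] tri_m1) = true := by decide +kernel

def tri_m2 : List ℕ :=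
  [5, 21, 69, 85, 101, 133, 149, 197, 213, 267, 378, 442, 490, 506, 11, 117, 122, 181, 186,
  229, 234, 245, 250, 299, 314, 426, 37, 43, 53, 58, 165, 170]

theorem tok_m2 : (minorOK tri_m2 && triOK 40 NM2
    [12297829382473034408, 14757395258967641288, 17361641481138401504, 18374966859414961664, 18446462603027677184, 18446744065119617024] tri_m2) = true := by decide +kernel

def tri_m1p : List ℕ :=
  [5, 21, 44, 69, 85, 133, 149, 165, 197, 213, 229, 268, 300, 332, 378, 442, 506, 12, 37, 76,
  117, 122, 181, 186, 245, 250, 314, 364, 53, 58, 101, 108]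

theorem tok_m1p : (minorOK tri_m1p && triOK 48 NM1p
    [12297829382473034408, 14757395258967641288, 17361641481138401504, 18374966859414961664, 18446462603027677184, 18446744065119617024] tri_m1p) = true := by decide +kernel

def tri_n5 : List ℕ :=
  [5, 13, 37, 45, 69, 77, 101, 109, 197, 205, 275, 283, 500, 508, 19, 27, 229, 237, 244, 252,
  403, 411, 436, 444, 133, 141, 147, 155, 165, 173, 180, 188]

theorem tok_n5 : (minorOK tri_n5 && triOK 40 NN5
    [14757395258967641288, 17361641481138401504, 18374966859414961664, 18446462603027677184, 18446744065119617024] tri_n5) = true := by decide +kernel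

def tri_m3_1 : List ℕ :=
  [1, 53, 129, 185, 257, 321, 377, 385, 499, 505, 37, 117, 243, 449, 483, 65, 101, 193, 227,
  11, 121, 249, 461, 27, 57, 267, 397, 477, 283, 313, 413, 441]

theorem tok_m3_1 : (minorOK tri_m3_1 && triOK 42 NM3
    [2 ^ 1] tri_m3_1) = true := by decide +kernel

def tri_m3_4 : List ℕ :=
  [1, 27, 65, 129, 185, 193, 321, 377, 477, 505, 11, 283, 413, 449, 461, 257, 267, 385, 397,
  37, 313, 441, 483, 53, 57, 101, 227, 499, 117, 121, 243, 249]

theorem tok_m3_4 : (minorOK tri_m3_4 && triOK 42 NM3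
    [2 ^ 4] tri_m3_4) = true := by decide +kernel

def tri_m3_16 : List ℕ :=
  [1, 101, 129, 185, 267, 321, 377, 505, 117, 121, 283, 313, 27, 53, 65, 257, 11, 37, 243, 413,
  57, 193, 227, 385, 397, 249, 441, 461, 483, 477, 499, 449]

theorem tok_m3_16 : (minorOK tri_m3_16 && triOK 42 NM3
    [2 ^ 16] tri_m3_16) = true := by decide +kernel

def tri_m3_5 : List ℕ :=
  [1, 57, 65, 121, 129, 185, 193, 249, 257, 313, 321, 377, 385, 441, 449, 505, 11, 27, 37, 53,
  461, 477, 483, 499, 101, 117, 227, 243, 267, 283, 397, 413]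

theorem tok_m3_5 : (minorOK tri_m3_5 && triOK 42 NM3
    [2 ^ 5] tri_m3_5) = true := by decide +kernel

def tri_m3_17 : List ℕ :=
  [1, 53, 101, 117, 129, 185, 249, 257, 321, 377, 397, 413, 461, 505, 37, 65, 121, 243, 267,
  385, 441, 477, 11, 27, 193, 227, 283, 313, 483, 499, 57, 449]

theorem tok_m3_17 : (minorOK tri_m3_17 && triOK 42 NM3
    [2 ^ 17] tri_m3_17) = true := by decide +kernel

def tri_m3_20 : List ℕ :=
  [1, 27, 65, 129, 185, 227, 243, 267, 283, 321, 377, 441, 483, 505, 11, 101, 193, 249, 257,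
  313, 413, 499, 37, 53, 117, 121, 385, 397, 461, 477, 57, 449]

theorem tok_m3_20 : (minorOK tri_m3_20 && triOK 42 NM3
    [2 ^ 20] tri_m3_20) = true := by decide +kernel

def tri_m3_21 : List ℕ :=
  [1, 57, 65, 121, 129, 185, 227, 243, 249, 257, 313, 321, 377, 397, 413, 441, 461, 483, 505,
  11, 27, 37, 53, 101, 193, 267, 385, 477, 499, 117, 283, 449]

theorem tok_m3_21 : (minorOK tri_m3_21 && triOK 42 NM3
    [2 ^ 21] tri_m3_21) = true := by decide +kernel

def tri_m3_7 : List ℕ :=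
  [1, 57, 121, 129, 185, 249, 313, 321, 377, 441, 505, 27, 53, 477, 499, 117, 243, 283, 413,
  449, 65, 193, 257, 385, 11, 37, 461, 483, 101, 227, 267, 397]

theorem tok_m3_7 : (minorOK tri_m3_7 && triOK 42 NM3
    [2 ^ 7] tri_m3_7) = true := by decide +kernel

def tri_m3_28 : List ℕ :=
  [1, 129, 185, 227, 243, 321, 377, 441, 483, 505, 101, 193, 249, 499, 117, 121, 461, 477, 27,
  65, 267, 283, 449, 11, 257, 313, 413, 37, 53, 385, 397, 57]

theorem tok_m3_28 : (minorOK tri_m3_28 && triOK 42 NM3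
    [2 ^ 28] tri_m3_28) = true := by decide +kernel

def tri_m3_49 : List ℕ :=
  [1, 129, 185, 249, 321, 377, 397, 413, 461, 505, 267, 385, 441, 477, 283, 313, 483, 499, 53,
  101, 117, 257, 449, 37, 65, 121, 243, 11, 27, 193, 227, 57]

theorem tok_m3_49 : (minorOK tri_m3_49 && triOK 42 NM3
    [2 ^ 49] tri_m3_49) = true := by decide +kernel

def tri_iso0 : List ℕ :=
  [0, 16, 32, 48, 64, 80, 96, 112, 128, 144, 160, 176, 192, 208, 224, 240, 256, 272, 288, 304,
  320, 336, 352, 368, 384, 400, 416, 432, 448, 464, 480, 496]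

theorem tok_iso0 : (minorOK tri_iso0 && triOK 1 12297829382473034408
    [] tri_iso0) = true := by decide +kernel

def tri_iso1 : List ℕ :=
  [1, 9, 33, 41, 65, 73, 97, 105, 129, 137, 161, 169, 193, 201, 225, 233, 257, 265, 289, 297,
  321, 329, 353, 361, 385, 393, 417, 425, 449, 457, 481, 489]

theorem tok_iso1 : (minorOK tri_iso1 && triOK 2 14757395258967641288
    [] tri_iso1) = true := by decide +kernel

def tri_iso2 : List ℕ :=
  [2, 10, 18, 26, 66, 74, 82, 90, 130, 138, 146, 154, 194, 202, 210, 218, 258, 266, 274, 282,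
  322, 330, 338, 346, 386, 394, 402, 410, 450, 458, 466, 474]

theorem tok_iso2 : (minorOK tri_iso2 && triOK 4 17361641481138401504
    [] tri_iso2) = true := by decide +kernel

def tri_iso3 : List ℕ :=
  [3, 11, 19, 27, 35, 43, 51, 59, 131, 139, 147, 155, 163, 171, 179, 187, 259, 267, 275, 283,
  291, 299, 307, 315, 387, 395, 403, 411, 419, 427, 435, 443]

theorem tok_iso3 : (minorOK tri_iso3 && triOK 8 18374966859414961664
    [] tri_iso3) = true := by decide +kernel

def tri_iso4 : List ℕ :=
  [4, 12, 20, 28, 36, 44, 52, 60, 68, 76, 84, 92, 100, 108, 116, 124, 260, 268, 276, 284, 292,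
  300, 308, 316, 324, 332, 340, 348, 356, 364, 372, 380]

theorem tok_iso4 : (minorOK tri_iso4 && triOK 16 18446462603027677184
    [] tri_iso4) = true := by decide +kernel

def tri_iso5 : List ℕ :=
  [5, 13, 21, 29, 37, 45, 53, 61, 69, 77, 85, 93, 101, 109, 117, 125, 133, 141, 149, 157, 165,
  173, 181, 189, 197, 205, 213, 221, 229, 237, 245, 253]

theorem tok_iso5 : (minorOK tri_iso5 && triOK 32 18446744065119617024
    [] tri_iso5) = true := by decide +kernel


/-! ### The hexagon -/

def row2OK (R : ℕ) (L : List ℕ) (t i i' : ℕ) : Bool :=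
  !Nat.beq i i' && Nat.blt t 64 && sb (eM t i) R && sb (eM t i') R &&
    allB (fun j => Nat.beq j i || Nat.beq j i' || !elemB (Nat.xor t (Nat.pow 2 j)) L ||
      dead R [] (eM t j)) idx

def vl {k : Type*} [Field k] (a : Fin 6 → k) (t : ℕ) (i : Fin 6) : k :=
  if t.testBit i.val = true then a i else 1

theorem row2 {k : Type*} [Field k] (X : Finset (Finset (Fin 6))) (hX : IsGenPattern 6 X)
    (R : ℕ) (hR : Avoid X R) (a : Fin 6 → k) (x : Finset (Fin 6) → k) (L : List ℕ)
    (h0 : ∀ s < 64, s ∉ L → x (dec s) = 0) (t : ℕ) (i i' : Fin 6)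
    (h : row2OK R L t i.val i'.val = true) :
    ∑ j, ent X a (dec t) j * x (flp (dec t) j) =
      sgn k (dec t) i * vl a t i * x (dec (t ^^^ 2 ^ i.val)) +
      sgn k (dec t) i' * vl a t i' * x (dec (t ^^^ 2 ^ i'.val)) := by
  unfold row2OK at h
  simp only [Bool.and_eq_true] at h
  obtain ⟨⟨⟨⟨h1, h2⟩, h3⟩, h4⟩, h5⟩ := h
  have hii : i ≠ i' := by
    rintro rfl
    simp at h1
  rw [Nat.blt_eq] at h2
  have := Finset.sum_subset (Finset.subset_univ ({i, i'} : Finset (Fin 6)))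
    (f := fun j => ent X a (dec t) j * x (flp (dec t) j)) ?_
  · rw [← this, Finset.sum_pair hii, ent_val X R hR a t i h3, ent_val X R hR a t i' h4,
      flp_dec, flp_dec]
    rfl
  · intro j _ hj
    simp only [Finset.mem_insert, Finset.mem_singleton, not_or] at hj
    have := allB_idx _ h5 j
    simp only [Bool.or_eq_true, Nat.beq_eq] at this
    rcases this with ((q | q) | q) | q
    · exact absurd (Fin.ext q) hj.1
    · exact absurd (Fin.ext q) hj.2
    · rw [flp_dec, h0 _ (xor_lt _ h2 j) ?_, mul_zero]
      rw [← elemB_spec]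
      intro hh
      have hh' : elemB (Nat.xor t (Nat.pow 2 j.val)) L = true := hh
      rw [hh'] at q
      simp at q
    · rw [ent_zero (Or.inl (dead_spec X hX R [] _ q hR (by simp))), zero_mul]

theorem peel {k : Type*} [Field k] (X : Finset (Finset (Fin 6))) (hX : IsGenPattern 6 X)
    (R : ℕ) (hR : Avoid X R) (a : Fin 6 → k) (x : Finset (Fin 6) → k) (L : List ℕ)
    (h0 : ∀ s < 64, s ∉ L → x (dec s) = 0) (t : ℕ) (ht : t < 64) (i : Fin 6)
    (hE : ∑ j, ent X a (dec t) j * x (flp (dec t) j) = 0)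
    (h3 : sb (eM t i.val) R = true) (hv : vl a t i ≠ 0)
    (h : allB (rowOK R [] L t i.val) idx = true) : x (dec (t ^^^ 2 ^ i.val)) = 0 := by
  rw [Finset.sum_eq_single i] at hE
  · rw [ent_val X R hR a t i h3, flp_dec] at hE
    exact (mul_eq_zero.1 hE).resolve_left (mul_ne_zero (sgn_ne _ _) hv)
  · intro j _ hj
    have := allB_idx _ h j
    unfold rowOK at this
    simp only [Bool.or_eq_true, Nat.beq_eq] at this
    rcases this with (q | q) | q
    · exact absurd (Fin.ext q) hj
    · rw [flp_dec, h0 _ (xor_lt _ ht j) ?_, mul_zero]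
      rw [← elemB_spec]
      intro hh
      have hh' : elemB (Nat.xor t (Nat.pow 2 j.val)) L = true := hh
      rw [hh'] at q
      simp at q
    · rw [ent_zero (Or.inl (dead_spec X hX R [] _ q hR (by simp))), zero_mul]
  · simp

theorem cyc6 {k : Type*} [Field k] {d0 d1 d2 d3 d4 d5 e0 e1 e2 e3 e4 e5 x0 x1 x2 x3 x4 x5 : k}
    (h0 : d0 * x0 + e0 * x5 = 0) (h1 : d1 * x1 + e1 * x0 = 0) (h2 : d2 * x2 + e2 * x1 = 0)
    (h3 : d3 * x3 + e3 * x2 = 0) (h4 : d4 * x4 + e4 * x3 = 0) (h5 : d5 * x5 + e5 * x4 = 0)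
    (hp : d0 * d1 * d2 * d3 * d4 * d5 - e0 * e1 * e2 * e3 * e4 * e5 ≠ 0) : x0 = 0 := by
  refine (mul_eq_zero.1 ?_).resolve_left hp
  linear_combination (d1 * d2 * d3 * d4 * d5) * h0 - e0 * (d1 * d2 * d3 * d4) * h5 +
    e0 * e5 * (d1 * d2 * d3) * h4 - e0 * e5 * e4 * (d1 * d2) * h3 +
    e0 * e5 * e4 * e3 * d1 * h2 - e0 * e5 * e4 * e3 * e2 * h1

theorem sgn_cast {k : Type*} [Field k] (r : Finset (Fin 6)) (i : Fin 6) (z : ℤ)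
    (h : sgn ℤ r i = z) : sgn k r i = (z : k) := by
  rw [← h]
  unfold sgn
  rw [Int.cast_prod]
  refine Finset.prod_congr rfl fun j _ => ?_
  split_ifs <;> simp

def hexL : List ℕ := [1, 129, 185, 321, 377, 505, 53, 243, 193, 461, 267, 313, 27, 413, 385, 483, 101, 121, 65, 11, 397, 441, 499, 117, 37, 227, 249, 477, 283, 257, 57, 449]

def hexL1 : List ℕ := [6, 30, 24, 57, 33, 39, 3, 51, 48, 60, 12, 15, 8, 1, 49, 55, 62, 14, 4, 28, 31, 59, 35, 32, 7, 56]

theorem hexL_ok : minorOK hexL = true := by decide +kernel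

theorem hex_notMem1 {k : Type*} [Field k] (X : Finset (Finset (Fin 6))) (hX : IsGenPattern 6 X)
    (hR : Avoid X NHEX) (a : Fin 6 → k) (ha1 : a 1 ≠ 0)
    (hp : a 0 * a 2 * a 4 + a 1 * a 3 * a 5 ≠ 0) : a ∉ supportVariety k X := by
  refine notMem_of_codes X a hexL hexL_ok ?_
  intro x h0 hE
  have z0 : x (dec 0) = 0 :=
    peel X hX NHEX hR a x _ h0 2 (by norm_num) 1 (hE 1 (by decide))
      (by decide +kernel) (by simp [vl, Nat.testBit, ha1]) (by decide +kernel)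
  have z16 : x (dec 16) = 0 :=
    peel X hX NHEX hR a x _ h0 18 (by norm_num) 1 (hE 129 (by decide))
      (by decide +kernel) (by simp [vl, Nat.testBit, ha1]) (by decide +kernel)
  have z23 : x (dec 23) = 0 :=
    peel X hX NHEX hR a x _ h0 21 (by norm_num) 1 (hE 185 (by decide))
      (by decide +kernel) (by simp [vl, Nat.testBit, ha1]) (by decide +kernel)
  have z40 : x (dec 40) = 0 :=
    peel X hX NHEX hR a x _ h0 42 (by norm_num) 1 (hE 321 (by decide))
      (by decide +kernel) (by simp [vl, Nat.testBit, ha1]) (by decide +kernel)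
  have z47 : x (dec 47) = 0 :=
    peel X hX NHEX hR a x _ h0 45 (by norm_num) 1 (hE 377 (by decide))
      (by decide +kernel) (by simp [vl, Nat.testBit, ha1]) (by decide +kernel)
  have z63 : x (dec 63) = 0 :=
    peel X hX NHEX hR a x _ h0 61 (by norm_num) 1 (hE 505 (by decide))
      (by decide +kernel) (by simp [vl, Nat.testBit, ha1]) (by decide +kernel)
  have h1 : ∀ s < 64, s ∉ hexL1 → x (dec s) = 0 := by
    intro s hs hns
    by_cases hh : s ∈ hexL.map src
    · have hk : ∀ s ∈ hexL.map src, s ∉ hexL1 → s = 0 ∨ s = 16 ∨ s = 23 ∨ s = 40 ∨ s = 47 ∨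
          s = 63 := by decide +kernel
      rcases hk s hh hns with rfl | rfl | rfl | rfl | rfl | rfl <;> assumption
    · exact h0 s hs hh
  have c6 : (a 5) * x (dec 6) + (1) * x (dec 39) = 0 := by
    have := row2 X hX NHEX hR a x hexL1 h1 38 5 0 (by decide +kernel)
    rw [show (∑ j, ent X a (dec 38) j * x (flp (dec 38) j)) = 0 from hE 53 (by decide), sgn_cast (dec 38) 5 (1) (by decide +kernel),
      sgn_cast (dec 38) 0 (1) (by decide +kernel)] at this
    simpa [vl, Nat.testBit] using this.symm
  have c30 : (1) * x (dec 30) + (a 4) * x (dec 6) = 0 := by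
    have := row2 X hX NHEX hR a x hexL1 h1 22 3 4 (by decide +kernel)
    rw [show (∑ j, ent X a (dec 22) j * x (flp (dec 22) j)) = 0 from hE 243 (by decide), sgn_cast (dec 22) 3 (1) (by decide +kernel),
      sgn_cast (dec 22) 4 (1) (by decide +kernel)] at this
    simpa [vl, Nat.testBit] using this.symm
  have c24 : (a 1) * x (dec 24) + (-1) * x (dec 30) = 0 := by
    have := row2 X hX NHEX hR a x hexL1 h1 26 1 2 (by decide +kernel)
    rw [show (∑ j, ent X a (dec 26) j * x (flp (dec 26) j)) = 0 from hE 193 (by decide), sgn_cast (dec 26) 1 (1) (by decide +kernel),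
      sgn_cast (dec 26) 2 (-1) (by decide +kernel)] at this
    simpa [vl, Nat.testBit] using this.symm
  have c57 : (-1) * x (dec 57) + (a 0) * x (dec 24) = 0 := by
    have := row2 X hX NHEX hR a x hexL1 h1 25 5 0 (by decide +kernel)
    rw [show (∑ j, ent X a (dec 25) j * x (flp (dec 25) j)) = 0 from hE 461 (by decide), sgn_cast (dec 25) 5 (-1) (by decide +kernel),
      sgn_cast (dec 25) 0 (1) (by decide +kernel)] at this
    simpa [vl, Nat.testBit] using this.symm
  have c33 : (-a 3) * x (dec 33) + (1) * x (dec 57) = 0 := by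
    have := row2 X hX NHEX hR a x hexL1 h1 41 3 4 (by decide +kernel)
    rw [show (∑ j, ent X a (dec 41) j * x (flp (dec 41) j)) = 0 from hE 267 (by decide), sgn_cast (dec 41) 3 (-1) (by decide +kernel),
      sgn_cast (dec 41) 4 (1) (by decide +kernel)] at this
    simpa [vl, Nat.testBit] using this.symm
  have c39 : (-1) * x (dec 39) + (-a 2) * x (dec 33) = 0 := by
    have := row2 X hX NHEX hR a x hexL1 h1 37 1 2 (by decide +kernel)
    rw [show (∑ j, ent X a (dec 37) j * x (flp (dec 37) j)) = 0 from hE 313 (by decide), sgn_cast (dec 37) 1 (-1) (by decide +kernel),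
      sgn_cast (dec 37) 2 (-1) (by decide +kernel)] at this
    simpa [vl, Nat.testBit] using this.symm
  have z6 : x (dec 6) = 0 := by
    refine cyc6 c6 c30 c24 c57 c33 c39 ?_
    intro hh
    apply hp
    linear_combination -hh
  have z30 : x (dec 30) = 0 := by
    refine cyc6 c30 c24 c57 c33 c39 c6 ?_
    intro hh
    apply hp
    linear_combination -hh
  have z24 : x (dec 24) = 0 := by
    refine cyc6 c24 c57 c33 c39 c6 c30 ?_
    intro hh
    apply hp
    linear_combination -hh
  have z57 : x (dec 57) = 0 := by
    refine cyc6 c57 c33 c39 c6 c30 c24 ?_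
    intro hh
    apply hp
    linear_combination -hh
  have z33 : x (dec 33) = 0 := by
    refine cyc6 c33 c39 c6 c30 c24 c57 ?_
    intro hh
    apply hp
    linear_combination -hh
  have z39 : x (dec 39) = 0 := by
    refine cyc6 c39 c6 c30 c24 c57 c33 ?_
    intro hh
    apply hp
    linear_combination -hh
  have c3 : (a 3) * x (dec 3) + (1) * x (dec 15) = 0 := by
    have := row2 X hX NHEX hR a x hexL1 h1 11 3 2 (by decide +kernel)
    rw [show (∑ j, ent X a (dec 11) j * x (flp (dec 11) j)) = 0 from hE 27 (by decide), sgn_cast (dec 11) 3 (1) (by decide +kernel),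
      sgn_cast (dec 11) 2 (1) (by decide +kernel)] at this
    simpa [vl, Nat.testBit] using this.symm
  have c51 : (-1) * x (dec 51) + (a 4) * x (dec 3) = 0 := by
    have := row2 X hX NHEX hR a x hexL1 h1 19 5 4 (by decide +kernel)
    rw [show (∑ j, ent X a (dec 19) j * x (flp (dec 19) j)) = 0 from hE 413 (by decide), sgn_cast (dec 19) 5 (-1) (by decide +kernel),
      sgn_cast (dec 19) 4 (1) (by decide +kernel)] at this
    simpa [vl, Nat.testBit] using this.symm
  have c48 : (a 1) * x (dec 48) + (1) * x (dec 51) = 0 := by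
    have := row2 X hX NHEX hR a x hexL1 h1 50 1 0 (by decide +kernel)
    rw [show (∑ j, ent X a (dec 50) j * x (flp (dec 50) j)) = 0 from hE 385 (by decide), sgn_cast (dec 50) 1 (1) (by decide +kernel),
      sgn_cast (dec 50) 0 (1) (by decide +kernel)] at this
    simpa [vl, Nat.testBit] using this.symm
  have c60 : (-1) * x (dec 60) + (a 2) * x (dec 48) = 0 := by
    have := row2 X hX NHEX hR a x hexL1 h1 52 3 2 (by decide +kernel)
    rw [show (∑ j, ent X a (dec 52) j * x (flp (dec 52) j)) = 0 from hE 483 (by decide), sgn_cast (dec 52) 3 (-1) (by decide +kernel),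
      sgn_cast (dec 52) 2 (1) (by decide +kernel)] at this
    simpa [vl, Nat.testBit] using this.symm
  have c12 : (a 5) * x (dec 12) + (1) * x (dec 60) = 0 := by
    have := row2 X hX NHEX hR a x hexL1 h1 44 5 4 (by decide +kernel)
    rw [show (∑ j, ent X a (dec 44) j * x (flp (dec 44) j)) = 0 from hE 101 (by decide), sgn_cast (dec 44) 5 (1) (by decide +kernel),
      sgn_cast (dec 44) 4 (1) (by decide +kernel)] at this
    simpa [vl, Nat.testBit] using this.symm
  have c15 : (-1) * x (dec 15) + (a 0) * x (dec 12) = 0 := by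
    have := row2 X hX NHEX hR a x hexL1 h1 13 1 0 (by decide +kernel)
    rw [show (∑ j, ent X a (dec 13) j * x (flp (dec 13) j)) = 0 from hE 121 (by decide), sgn_cast (dec 13) 1 (-1) (by decide +kernel),
      sgn_cast (dec 13) 0 (1) (by decide +kernel)] at this
    simpa [vl, Nat.testBit] using this.symm
  have z3 : x (dec 3) = 0 := by
    refine cyc6 c3 c51 c48 c60 c12 c15 ?_
    intro hh
    apply hp
    linear_combination -hh
  have z51 : x (dec 51) = 0 := by
    refine cyc6 c51 c48 c60 c12 c15 c3 ?_
    intro hh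
    apply hp
    linear_combination -hh
  have z48 : x (dec 48) = 0 := by
    refine cyc6 c48 c60 c12 c15 c3 c51 ?_
    intro hh
    apply hp
    linear_combination -hh
  have z60 : x (dec 60) = 0 := by
    refine cyc6 c60 c12 c15 c3 c51 c48 ?_
    intro hh
    apply hp
    linear_combination -hh
  have z12 : x (dec 12) = 0 := by
    refine cyc6 c12 c15 c3 c51 c48 c60 ?_
    intro hh
    apply hp
    linear_combination -hh
  have z15 : x (dec 15) = 0 := by
    refine cyc6 c15 c3 c51 c48 c60 c12 ?_
    intro hh
    apply hp
    linear_combination -hh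
  have c8 : (a 1) * x (dec 8) + (-1) * x (dec 14) = 0 := by
    have := row2 X hX NHEX hR a x hexL1 h1 10 1 2 (by decide +kernel)
    rw [show (∑ j, ent X a (dec 10) j * x (flp (dec 10) j)) = 0 from hE 65 (by decide), sgn_cast (dec 10) 1 (1) (by decide +kernel),
      sgn_cast (dec 10) 2 (-1) (by decide +kernel)] at this
    simpa [vl, Nat.testBit] using this.symm
  have c1 : (-a 3) * x (dec 1) + (a 0) * x (dec 8) = 0 := by
    have := row2 X hX NHEX hR a x hexL1 h1 9 3 0 (by decide +kernel)
    rw [show (∑ j, ent X a (dec 9) j * x (flp (dec 9) j)) = 0 from hE 11 (by decide), sgn_cast (dec 9) 3 (-1) (by decide +kernel),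
      sgn_cast (dec 9) 0 (1) (by decide +kernel)] at this
    simpa [vl, Nat.testBit] using this.symm
  have c49 : (1) * x (dec 49) + (-a 4) * x (dec 1) = 0 := by
    have := row2 X hX NHEX hR a x hexL1 h1 17 5 4 (by decide +kernel)
    rw [show (∑ j, ent X a (dec 17) j * x (flp (dec 17) j)) = 0 from hE 397 (by decide), sgn_cast (dec 17) 5 (1) (by decide +kernel),
      sgn_cast (dec 17) 4 (-1) (by decide +kernel)] at this
    simpa [vl, Nat.testBit] using this.symm
  have c55 : (-1) * x (dec 55) + (-a 2) * x (dec 49) = 0 := by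
    have := row2 X hX NHEX hR a x hexL1 h1 53 1 2 (by decide +kernel)
    rw [show (∑ j, ent X a (dec 53) j * x (flp (dec 53) j)) = 0 from hE 441 (by decide), sgn_cast (dec 53) 1 (-1) (by decide +kernel),
      sgn_cast (dec 53) 2 (-1) (by decide +kernel)] at this
    simpa [vl, Nat.testBit] using this.symm
  have c62 : (1) * x (dec 62) + (1) * x (dec 55) = 0 := by
    have := row2 X hX NHEX hR a x hexL1 h1 54 3 0 (by decide +kernel)
    rw [show (∑ j, ent X a (dec 54) j * x (flp (dec 54) j)) = 0 from hE 499 (by decide), sgn_cast (dec 54) 3 (1) (by decide +kernel),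
      sgn_cast (dec 54) 0 (1) (by decide +kernel)] at this
    simpa [vl, Nat.testBit] using this.symm
  have c14 : (-a 5) * x (dec 14) + (-1) * x (dec 62) = 0 := by
    have := row2 X hX NHEX hR a x hexL1 h1 46 5 4 (by decide +kernel)
    rw [show (∑ j, ent X a (dec 46) j * x (flp (dec 46) j)) = 0 from hE 117 (by decide), sgn_cast (dec 46) 5 (-1) (by decide +kernel),
      sgn_cast (dec 46) 4 (-1) (by decide +kernel)] at this
    simpa [vl, Nat.testBit] using this.symm
  have z8 : x (dec 8) = 0 := by
    refine cyc6 c8 c1 c49 c55 c62 c14 ?_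
    intro hh
    apply hp
    linear_combination -hh
  have z1 : x (dec 1) = 0 := by
    refine cyc6 c1 c49 c55 c62 c14 c8 ?_
    intro hh
    apply hp
    linear_combination -hh
  have z49 : x (dec 49) = 0 := by
    refine cyc6 c49 c55 c62 c14 c8 c1 ?_
    intro hh
    apply hp
    linear_combination -hh
  have z55 : x (dec 55) = 0 := by
    refine cyc6 c55 c62 c14 c8 c1 c49 ?_
    intro hh
    apply hp
    linear_combination -hh
  have z62 : x (dec 62) = 0 := by
    refine cyc6 c62 c14 c8 c1 c49 c55 ?_
    intro hh
    apply hp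
    linear_combination -hh
  have z14 : x (dec 14) = 0 := by
    refine cyc6 c14 c8 c1 c49 c55 c62 ?_
    intro hh
    apply hp
    linear_combination -hh
  have c4 : (-a 5) * x (dec 4) + (a 2) * x (dec 32) = 0 := by
    have := row2 X hX NHEX hR a x hexL1 h1 36 5 2 (by decide +kernel)
    rw [show (∑ j, ent X a (dec 36) j * x (flp (dec 36) j)) = 0 from hE 37 (by decide), sgn_cast (dec 36) 5 (-1) (by decide +kernel),
      sgn_cast (dec 36) 2 (1) (by decide +kernel)] at this
    simpa [vl, Nat.testBit] using this.symm
  have c28 : (-1) * x (dec 28) + (-a 4) * x (dec 4) = 0 := by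
    have := row2 X hX NHEX hR a x hexL1 h1 20 3 4 (by decide +kernel)
    rw [show (∑ j, ent X a (dec 20) j * x (flp (dec 20) j)) = 0 from hE 227 (by decide), sgn_cast (dec 20) 3 (-1) (by decide +kernel),
      sgn_cast (dec 20) 4 (-1) (by decide +kernel)] at this
    simpa [vl, Nat.testBit] using this.symm
  have c31 : (-1) * x (dec 31) + (a 0) * x (dec 28) = 0 := by
    have := row2 X hX NHEX hR a x hexL1 h1 29 1 0 (by decide +kernel)
    rw [show (∑ j, ent X a (dec 29) j * x (flp (dec 29) j)) = 0 from hE 249 (by decide), sgn_cast (dec 29) 1 (-1) (by decide +kernel),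
      sgn_cast (dec 29) 0 (1) (by decide +kernel)] at this
    simpa [vl, Nat.testBit] using this.symm
  have c59 : (1) * x (dec 59) + (1) * x (dec 31) = 0 := by
    have := row2 X hX NHEX hR a x hexL1 h1 27 5 2 (by decide +kernel)
    rw [show (∑ j, ent X a (dec 27) j * x (flp (dec 27) j)) = 0 from hE 477 (by decide), sgn_cast (dec 27) 5 (1) (by decide +kernel),
      sgn_cast (dec 27) 2 (1) (by decide +kernel)] at this
    simpa [vl, Nat.testBit] using this.symm
  have c35 : (a 3) * x (dec 35) + (-1) * x (dec 59) = 0 := by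
    have := row2 X hX NHEX hR a x hexL1 h1 43 3 4 (by decide +kernel)
    rw [show (∑ j, ent X a (dec 43) j * x (flp (dec 43) j)) = 0 from hE 283 (by decide), sgn_cast (dec 43) 3 (1) (by decide +kernel),
      sgn_cast (dec 43) 4 (-1) (by decide +kernel)] at this
    simpa [vl, Nat.testBit] using this.symm
  have c32 : (a 1) * x (dec 32) + (1) * x (dec 35) = 0 := by
    have := row2 X hX NHEX hR a x hexL1 h1 34 1 0 (by decide +kernel)
    rw [show (∑ j, ent X a (dec 34) j * x (flp (dec 34) j)) = 0 from hE 257 (by decide), sgn_cast (dec 34) 1 (1) (by decide +kernel),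
      sgn_cast (dec 34) 0 (1) (by decide +kernel)] at this
    simpa [vl, Nat.testBit] using this.symm
  have z4 : x (dec 4) = 0 := by
    refine cyc6 c4 c28 c31 c59 c35 c32 ?_
    intro hh
    apply hp
    linear_combination -hh
  have z28 : x (dec 28) = 0 := by
    refine cyc6 c28 c31 c59 c35 c32 c4 ?_
    intro hh
    apply hp
    linear_combination -hh
  have z31 : x (dec 31) = 0 := by
    refine cyc6 c31 c59 c35 c32 c4 c28 ?_
    intro hh
    apply hp
    linear_combination -hh
  have z59 : x (dec 59) = 0 := by
    refine cyc6 c59 c35 c32 c4 c28 c31 ?_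
    intro hh
    apply hp
    linear_combination -hh
  have z35 : x (dec 35) = 0 := by
    refine cyc6 c35 c32 c4 c28 c31 c59 ?_
    intro hh
    apply hp
    linear_combination -hh
  have z32 : x (dec 32) = 0 := by
    refine cyc6 c32 c4 c28 c31 c59 c35 ?_
    intro hh
    apply hp
    linear_combination -hh
  have h2 : ∀ s < 64, s ∉ [7, 56] → x (dec s) = 0 := by
    intro s hs hns
    by_cases hh : s ∈ hexL1
    · simp only [hexL1, List.mem_cons, List.not_mem_nil, or_false] at hh
      simp only [List.mem_cons, List.not_mem_nil, or_false, not_or] at hns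
      rcases hh with rfl | rfl | rfl | rfl | rfl | rfl | rfl | rfl | rfl | rfl | rfl | rfl | rfl | rfl | rfl | rfl | rfl | rfl | rfl | rfl | rfl | rfl | rfl | rfl | hh | hh
      all_goals first | assumption | exact absurd hh hns.1 | exact absurd hh hns.2
    · exact h1 s hs hh
  have z7 : x (dec 7) = 0 :=
    peel X hX NHEX hR a x _ h2 5 (by norm_num) 1 (hE 57 (by decide))
      (by decide +kernel) (by simp [vl, Nat.testBit, ha1]) (by decide +kernel)
  have z56 : x (dec 56) = 0 :=
    peel X hX NHEX hR a x _ h2 58 (by norm_num) 1 (hE 449 (by decide))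
      (by decide +kernel) (by simp [vl, Nat.testBit, ha1]) (by decide +kernel)
  intro s hs
  by_cases hh : s ∈ [7, 56]
  · simp only [List.mem_cons, List.not_mem_nil, or_false] at hh
    rcases hh with rfl | rfl <;> assumption
  · exact h2 s hs hh

theorem hex_col {k : Type*} [Field k] (X : Finset (Finset (Fin 6))) (hX : IsGenPattern 6 X)
    (hR : Avoid X NHEX) (a : Fin 6 → k) (ha : a ∉ supportVariety k X) (t : ℕ)
    (ht : allB (fun j => dead NHEX [] (eM (Nat.xor t (Nat.pow 2 j)) j)) idx = true) :
    ∃ y : Finset (Fin 6) → k, ∀ r, ∑ j, ent X a r j * y (flp r j) = if r = dec t then 1 else 0 := by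
  obtain ⟨y, hy⟩ := exact_of_notMem X hX a ha (fun r => if r = dec t then 1 else 0) (by
    funext r
    rw [taylor_mulVec]
    refine Finset.sum_eq_zero fun i _ => ?_
    show ent X a r i * (if flp r i = dec t then 1 else 0) = 0
    split_ifs with hr
    · have h1 : r = dec (t ^^^ 2 ^ i.val) := by rw [← flp_dec, ← hr, flp_flp]
      have : dead NHEX [] (eM (t ^^^ 2 ^ i.val) i.val) = true := allB_idx _ ht i
      rw [h1, ent_zero (Or.inl (dead_spec X hX NHEX [] _ this hR (by simp))), zero_mul]
    · rw [mul_zero])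
  refine ⟨y, fun r => ?_⟩
  rw [← taylor_mulVec, hy]

theorem hex_sys {k : Type*} [Field k] (X : Finset (Finset (Fin 6))) (hX : IsGenPattern 6 X)
    (hR : Avoid X NHEX) (a : Fin 6 → k) (ha : a ∉ supportVariety k X) (t : ℕ)
    (ht : allB (fun j => dead NHEX [] (eM (Nat.xor t (Nat.pow 2 j)) j)) idx = true) (ht' : t < 64) :
    ∃ u v w : k, a 5 * u - a 2 * w = (if 38 = t then 1 else 0) + (if 37 = t then 1 else 0) ∧
      a 4 * u + a 1 * v = (if 22 = t then 1 else 0) + (if 26 = t then 1 else 0) ∧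
      a 0 * v - a 3 * w = (if 25 = t then 1 else 0) + (if 41 = t then 1 else 0) := by
  obtain ⟨y, hy⟩ := hex_col X hX hR a ha t ht
  have hy' : ∀ s < 64, ∑ j, ent X a (dec s) j * y (flp (dec s) j) = if s = t then 1 else 0 := by
    intro s hs
    rw [hy]
    exact if_congr ⟨dec_inj hs ht', fun h => by rw [h]⟩ rfl rfl
  have h1 : ∀ s < 64, s ∉ List.range 64 → y (dec s) = 0 :=
    fun s hs h => absurd (List.mem_range.2 hs) h
  have c6 : (a 5) * y (dec 6) + (1) * y (dec 39) = if 38 = t then 1 else 0 := by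
    have := row2 X hX NHEX hR a y (List.range 64) h1 38 5 0 (by decide +kernel)
    rw [hy' 38 (by norm_num), sgn_cast (dec 38) 5 (1) (by decide +kernel),
      sgn_cast (dec 38) 0 (1) (by decide +kernel)] at this
    rw [this]
    simp [vl, Nat.testBit]
  have c30 : (1) * y (dec 30) + (a 4) * y (dec 6) = if 22 = t then 1 else 0 := by
    have := row2 X hX NHEX hR a y (List.range 64) h1 22 3 4 (by decide +kernel)
    rw [hy' 22 (by norm_num), sgn_cast (dec 22) 3 (1) (by decide +kernel),
      sgn_cast (dec 22) 4 (1) (by decide +kernel)] at this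
    rw [this]
    simp [vl, Nat.testBit]
  have c24 : (a 1) * y (dec 24) + (-1) * y (dec 30) = if 26 = t then 1 else 0 := by
    have := row2 X hX NHEX hR a y (List.range 64) h1 26 1 2 (by decide +kernel)
    rw [hy' 26 (by norm_num), sgn_cast (dec 26) 1 (1) (by decide +kernel),
      sgn_cast (dec 26) 2 (-1) (by decide +kernel)] at this
    rw [this]
    simp [vl, Nat.testBit]
  have c57 : (-1) * y (dec 57) + (a 0) * y (dec 24) = if 25 = t then 1 else 0 := by
    have := row2 X hX NHEX hR a y (List.range 64) h1 25 5 0 (by decide +kernel)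
    rw [hy' 25 (by norm_num), sgn_cast (dec 25) 5 (-1) (by decide +kernel),
      sgn_cast (dec 25) 0 (1) (by decide +kernel)] at this
    rw [this]
    simp [vl, Nat.testBit]
  have c33 : (-a 3) * y (dec 33) + (1) * y (dec 57) = if 41 = t then 1 else 0 := by
    have := row2 X hX NHEX hR a y (List.range 64) h1 41 3 4 (by decide +kernel)
    rw [hy' 41 (by norm_num), sgn_cast (dec 41) 3 (-1) (by decide +kernel),
      sgn_cast (dec 41) 4 (1) (by decide +kernel)] at this
    rw [this]
    simp [vl, Nat.testBit]
  have c39 : (-1) * y (dec 39) + (-a 2) * y (dec 33) = if 37 = t then 1 else 0 := by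
    have := row2 X hX NHEX hR a y (List.range 64) h1 37 1 2 (by decide +kernel)
    rw [hy' 37 (by norm_num), sgn_cast (dec 37) 1 (-1) (by decide +kernel),
      sgn_cast (dec 37) 2 (-1) (by decide +kernel)] at this
    rw [this]
    simp [vl, Nat.testBit]
  refine ⟨y (dec 6), y (dec 24), y (dec 33), ?_, ?_, ?_⟩
  · rw [← c6, ← c39]; ring
  · rw [← c30, ← c24]; ring
  · rw [← c57, ← c33]; ring

theorem hex_mem {k : Type*} [Field k] (X : Finset (Finset (Fin 6))) (hX : IsGenPattern 6 X)
    (hR : Avoid X NHEX) (a : Fin 6 → k) (hp : a 0 * a 2 * a 4 + a 1 * a 3 * a 5 = 0) :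
    a ∈ supportVariety k X := by
  by_contra ha
  obtain ⟨u1, v1, w1, p1, q1, r1⟩ := hex_sys X hX hR a ha 38 (by decide +kernel) (by norm_num)
  obtain ⟨u2, v2, w2, p2, q2, r2⟩ := hex_sys X hX hR a ha 22 (by decide +kernel) (by norm_num)
  obtain ⟨u3, v3, w3, p3, q3, r3⟩ := hex_sys X hX hR a ha 25 (by decide +kernel) (by norm_num)
  norm_num at p1 q1 r1 p2 q2 r2 p3 q3 r3
  have hM : (!![a 5, 0, -a 2; a 4, a 1, 0; 0, a 0, -a 3] : Matrix (Fin 3) (Fin 3) k) *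
      !![u1, u2, u3; v1, v2, v3; w1, w2, w3] = 1 := by
    ext i j
    fin_cases i <;> fin_cases j <;> simp [Matrix.mul_apply, Fin.sum_univ_three] <;>
      first
      | linear_combination p1 | linear_combination p2 | linear_combination p3
      | linear_combination q1 | linear_combination q2 | linear_combination q3
      | linear_combination r1 | linear_combination r2 | linear_combination r3
  have hd := congrArg Matrix.det hM
  rw [Matrix.det_mul, Matrix.det_one, Matrix.det_fin_three] at hd
  have h0 : a 5 * a 1 * -a 3 - a 5 * 0 * a 0 - 0 * a 4 * -a 3 + 0 * 0 * 0 + -a 2 * a 4 * a 0 -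
      -a 2 * a 1 * 0 = 0 := by linear_combination -hp
  have h1 : (0 : k) = 1 := by
    rw [← hd]
    simp
    left
    linear_combination -hp
  exact zero_ne_one h1


theorem hex_notMem {k : Type*} [Field k] (X : Finset (Finset (Fin 6))) (hX : IsGenPattern 6 X)
    (hR : Avoid X NHEX) (a : Fin 6 → k) (hp : a 0 * a 2 * a 4 + a 1 * a 3 * a 5 ≠ 0) :
    a ∉ supportVariety k X := by
  by_cases h1 : a 1 = 0
  · have h0 : a 0 ≠ 0 := by
      intro h0
      apply hp
      rw [h0, h1]; ring
    obtain ⟨h, hA, hi⟩ := img_spec 23405 (by decide +kernel)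
    have hh : ∀ i : Fin 6, h i + 5 = i := by
      intro i
      have e : ∀ i : Fin 6, imgI 23405 i.val = (i + 1).val := by decide +kernel
      have : h i = i + 1 := Fin.ext ((hi i).symm.trans (e i))
      rw [this, add_assoc]
      exact add_zero i
    have hR' : Avoid (act h X) NHEX := (hA X NHEX).1 (Avoid.mono (by decide +kernel) hR)
    have := hex_notMem1 (act h X) (gen_act h X hX) hR' (fun y => a (y + 5))
      (by
        show a (1 + 5) ≠ 0
        rwa [show (1 + 5 : Fin 6) = 0 by decide])
      (by
        show a (0 + 5) * a (2 + 5) * a (4 + 5) + a (1 + 5) * a (3 + 5) * a (5 + 5) ≠ 0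
        rw [show (0 + 5 : Fin 6) = 5 by decide, show (1 + 5 : Fin 6) = 0 by decide,
          show (2 + 5 : Fin 6) = 1 by decide, show (3 + 5 : Fin 6) = 2 by decide,
          show (4 + 5 : Fin 6) = 3 by decide, show (5 + 5 : Fin 6) = 4 by decide]
        intro e
        apply hp
        linear_combination e)
    rw [mem_act_iff] at this
    simpa only [hh] using this
  · exact hex_notMem1 X hX hR a h1 hp

theorem hex_V {k : Type*} [Field k] (X : Finset (Finset (Fin 6))) (hX : IsGenPattern 6 X)
    (hR : Avoid X NHEX) :
    supportVariety k X = {a | a 0 * a 2 * a 4 + a 1 * a 3 * a 5 = 0} := by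
  ext a
  refine ⟨fun ha => ?_, fun ha => hex_mem X hX hR a ha⟩
  by_contra hp
  exact hex_notMem X hX hR a hp ha

/-! ### Isolated vertices -/

def Iso (X : Finset (Finset (Fin 6))) (i : Fin 6) : Prop := ∀ τ ∈ X, i ∈ τ → τ = {i}

def NI : List ℕ := [12297829382473034408, 14757395258967641288, 17361641481138401504,
  18374966859414961664, 18446462603027677184, 18446744065119617024]

theorem NI_eq : ∀ i : Fin 6, NI.getD i.val 0 = mA (63 - 2 ^ i.val) i.val := by decide +kernel

theorem avoid_NI (X : Finset (Finset (Fin 6))) (i : Fin 6) :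
    Avoid X (NI.getD i.val 0) ↔ Iso X i := by
  rw [NI_eq, avoid_mA]
  have key : ∀ i : Fin 6, ∀ τ : Finset (Fin 6), i ∈ τ →
      (Disjoint τ (dec (63 - 2 ^ i.val)) ↔ τ = {i}) := by
    have h1 : ∀ i j : Fin 6, j ∈ dec (63 - 2 ^ i.val) ↔ j ≠ i := by
      simp only [mem_dec]; decide +kernel
    intro i τ hi
    rw [Finset.disjoint_left]
    constructor
    · intro h
      ext j
      rw [Finset.mem_singleton]
      constructor
      · intro hj
        by_contra hne
        exact h hj ((h1 i j).2 hne)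
      · rintro rfl; exact hi
    · rintro rfl j hj
      rw [h1]
      simpa using hj
  exact forall₃_congr fun τ _ hi => key i τ hi

theorem iso_act (g : Equiv.Perm (Fin 6)) (X : Finset (Finset (Fin 6))) (i : Fin 6) :
    Iso (act g X) (g i) ↔ Iso X i := by
  have hmem : ∀ τ : Finset (Fin 6), g i ∈ τ.map g.toEmbedding ↔ i ∈ τ := by
    intro τ; simp
  have hsing : ∀ τ : Finset (Fin 6), τ.map g.toEmbedding = {g i} ↔ τ = {i} := by
    intro τ
    rw [show ({g i} : Finset (Fin 6)) = ({i} : Finset (Fin 6)).map g.toEmbedding by simp]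
    exact (Finset.map_injective _).eq_iff
  constructor
  · intro h τ hτ hi
    exact (hsing τ).1 (h _ (mem_act.2 hτ) ((hmem τ).2 hi))
  · intro h τ' hτ' hi
    obtain ⟨τ, hτ, rfl⟩ := Finset.mem_image.1 hτ'
    exact (hsing τ).2 (h τ hτ ((hmem τ).1 hi))

theorem iso_act' (g : Equiv.Perm (Fin 6)) (X : Finset (Finset (Fin 6))) (i : Fin 6) :
    Iso (act g X) i ↔ Iso X (g⁻¹ i) := by
  rw [← iso_act g X]
  simp

theorem iso_zero {k : Type*} [Field k] (X : Finset (Finset (Fin 6))) (hX : IsGenPattern 6 X)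
    (i : Fin 6) (h : Iso X i) (a : Fin 6 → k) (ha : a ∈ supportVariety k X) : a i = 0 := by
  by_contra hne
  have h' := (avoid_NI X i).2 h
  have hz : ∀ j : Fin 6, (2 ^ i.val).testBit j.val = true → a j ≠ 0 := by
    intro j hj
    rw [Nat.testBit_two_pow, decide_eq_true_eq] at hj
    rw [← Fin.ext hj]; exact hne
  revert ha
  fin_cases i
  · exact notMem_tri X hX 1 _ [] _ tok_iso0 h' (by simp) a hz
  · exact notMem_tri X hX 2 _ [] _ tok_iso1 h' (by simp) a hz
  · exact notMem_tri X hX 4 _ [] _ tok_iso2 h' (by simp) a hz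
  · exact notMem_tri X hX 8 _ [] _ tok_iso3 h' (by simp) a hz
  · exact notMem_tri X hX 16 _ [] _ tok_iso4 h' (by simp) a hz
  · exact notMem_tri X hX 32 _ [] _ tok_iso5 h' (by simp) a hz

/-- the condition that exactly the vertices `< q` are isolated -/
def IsoSeg (X : Finset (Finset (Fin 6))) (q : ℕ) : Prop := ∀ i : Fin 6, Iso X i ↔ i.val < q

theorem IsoSeg.pos {X : Finset (Finset (Fin 6))} {q : ℕ} (h : IsoSeg X q) :
    ∀ p ∈ NI.drop q, ¬ Avoid X p := by
  intro p hp hA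
  obtain ⟨n, hn, rfl⟩ := List.mem_iff_getElem.1 hp
  have hl : NI.length = 6 := rfl
  rw [List.length_drop, hl] at hn
  have hn6 : q + n < 6 := by omega
  have h2 := avoid_NI X ⟨q + n, hn6⟩
  rw [List.getD_eq_getElem _ _ (by rw [hl]; exact hn6)] at h2
  rw [List.getElem_drop] at hA
  have := (h ⟨q + n, hn6⟩).1 (h2.1 hA)
  simp at this

theorem IsoSeg.av {X : Finset (Finset (Fin 6))} {q : ℕ} (h : IsoSeg X q) (i : Fin 6)
    (hi : i.val < q) : Avoid X (NI.getD i.val 0) := (avoid_NI X i).2 ((h i).2 hi)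

/-! ### The classification up to permutation -/

def VL (k : Type*) [Field k] (X : Finset (Finset (Fin 6))) : Prop :=
  ∃ g : Equiv.Perm (Fin 6), VarietyListSix k (supportVariety k (act g X))

theorem VL_act {k : Type*} [Field k] {X : Finset (Finset (Fin 6))} (g : Equiv.Perm (Fin 6))
    (h : VL k (act g X)) : VL k X := by
  obtain ⟨g', h⟩ := h
  rw [act_mul] at h
  exact ⟨_, h⟩

theorem VL_of {k : Type*} [Field k] {X : Finset (Finset (Fin 6))}
    (h : VarietyListSix k (supportVariety k X)) : VL k X := ⟨1, by rwa [act_one]⟩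

theorem VL_image {k : Type*} [Field k] {X : Finset (Finset (Fin 6))} (h : VL k X) :
    ∃ π : Equiv.Perm (Fin 6),
        VarietyListSix k ((fun a => fun i => a (π i)) '' supportVariety k X) := by
  obtain ⟨g, h⟩ := h
  refine ⟨g⁻¹, ?_⟩
  convert h using 1
  ext b
  rw [mem_act_iff]
  constructor
  · rintro ⟨a, ha, rfl⟩
    simpa using ha
  · intro hb
    exact ⟨_, hb, by simp⟩

theorem isoSeg_leaf {X : Finset (Finset (Fin 6))} (g : Equiv.Perm (Fin 6)) (h : IsoSeg X 0) :
    IsoSeg (act g X) 0 := by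
  intro i
  rw [iso_act', h]
  simp

theorem V_M1p {k : Type*} [Field k] {X : Finset (Finset (Fin 6))} (hX : IsGenPattern 6 X)
    (hI : IsoSeg X 0) (hR : Avoid X NM1p) :
    supportVariety k X = {a | a 3 * a 5 = 0 ∧ a 4 * a 5 = 0} := by
  ext a
  constructor
  · intro ha
    constructor
    · by_contra hne
      refine notMem_tri X hX 40 NM1 NI _ tok_m1 (Avoid.mono (by decide +kernel) hR) hI.pos a ?_ ha
      obtain ⟨h3, h5⟩ := mul_ne_zero_iff.1 hne
      intro i; fin_cases i <;> simp [Nat.testBit, h3, h5]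
    · by_contra hne
      refine notMem_tri X hX 48 NM1p NI _ tok_m1p hR hI.pos a ?_ ha
      obtain ⟨h3, h5⟩ := mul_ne_zero_iff.1 hne
      intro i; fin_cases i <;> simp [Nat.testBit, h3, h5]
  · rintro ⟨h1, h2⟩
    by_cases h5 : a 5 = 0
    · rcases chk_spec (k := k) 32 [] _ NM1p NI chk_m1pa X hX hR hI.pos with h | ⟨_, _, hN, _⟩
      · apply h
        intro i; fin_cases i <;> simp [Nat.testBit, h5]
      · simp at hN
    · have h3 := (mul_eq_zero.1 h1).resolve_right h5
      have h4 := (mul_eq_zero.1 h2).resolve_right h5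
      rcases chk_spec (k := k) 24 [] _ NM1p NI chk_m1pb X hX hR hI.pos with h | ⟨_, _, hN, _⟩
      · apply h
        intro i; fin_cases i <;> simp [Nat.testBit, h3, h4]
      · simp at hN

theorem VL_M1p {k : Type*} [Field k] {X : Finset (Finset (Fin 6))} (hX : IsGenPattern 6 X)
    (hI : IsoSeg X 0) (hR : Avoid X NM1p) : VL k X :=
  VL_of (Or.inr (Or.inr (Or.inr (Or.inl (V_M1p hX hI hR)))))

theorem VL_M1 {k : Type*} [Field k] {X : Finset (Finset (Fin 6))} (hX : IsGenPattern 6 X)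
    (hI : IsoSeg X 0) (hR : Avoid X NM1) : VL k X := by
  rcases chk_spec (k := k) 8 [NM1p] _ NM1 NI chk_m1a X hX hR hI.pos with ha | ⟨g, N, hN, hA⟩
  swap
  · rw [List.mem_singleton] at hN
    subst hN
    exact VL_act g (VL_M1p (gen_act g X hX) (isoSeg_leaf g hI) hA)
  rcases chk_spec (k := k) 32 [NM1p] _ NM1 NI chk_m1b X hX hR hI.pos with hb | ⟨g, N, hN, hA⟩
  swap
  · rw [List.mem_singleton] at hN
    subst hN
    exact VL_act g (VL_M1p (gen_act g X hX) (isoSeg_leaf g hI) hA)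
  refine VL_of (Or.inr (Or.inr (Or.inl ?_)))
  ext a
  constructor
  · intro ham
    by_contra hne
    refine notMem_tri X hX 40 NM1 NI _ tok_m1 hR hI.pos a ?_ ham
    obtain ⟨h3, h5⟩ := mul_ne_zero_iff.1 hne
    intro i; fin_cases i <;> simp [Nat.testBit, h3, h5]
  · intro h
    rcases mul_eq_zero.1 h with h | h
    · apply ha
      intro i; fin_cases i <;> simp [Nat.testBit, h]
    · apply hb
      intro i; fin_cases i <;> simp [Nat.testBit, h]

theorem V_M2 {k : Type*} [Field k] {X : Finset (Finset (Fin 6))} (hX : IsGenPattern 6 X)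
    (hI : IsoSeg X 0) (hR : Avoid X NM2) : supportVariety k X = {a | a 3 * a 5 = 0} := by
  rcases chk_spec (k := k) 8 [] _ NM2 NI chk_m2a X hX hR hI.pos with ha | ⟨g, N, hN, hA⟩
  swap
  · simp at hN
  rcases chk_spec (k := k) 32 [] _ NM2 NI chk_m2b X hX hR hI.pos with hb | ⟨g, N, hN, hA⟩
  swap
  · simp at hN
  ext a
  constructor
  · intro ham
    by_contra hne
    refine notMem_tri X hX 40 NM2 NI _ tok_m2 hR hI.pos a ?_ ham
    obtain ⟨h3, h5⟩ := mul_ne_zero_iff.1 hne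
    intro i; fin_cases i <;> simp [Nat.testBit, h3, h5]
  · intro h
    rcases mul_eq_zero.1 h with h | h
    · apply ha
      intro i; fin_cases i <;> simp [Nat.testBit, h]
    · apply hb
      intro i; fin_cases i <;> simp [Nat.testBit, h]

theorem m3_mem {k : Type*} [Field k] {X : Finset (Finset (Fin 6))} (hX : IsGenPattern 6 X)
    (hR : Avoid X NM3) : (∀ a : Fin 6 → k, a 1 * a 3 * a 5 = 0 → a ∈ supportVariety k X) ∨
      ∃ g, Avoid (act g X) NHEX := by
  rcases chk_spec (k := k) 2 [NHEX] _ NM3 [] chk_m3a X hX hR (by simp) with ha | ⟨g, N, hN, hA⟩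
  swap
  · rw [List.mem_singleton] at hN
    exact Or.inr ⟨g, hN ▸ hA⟩
  rcases chk_spec (k := k) 8 [NHEX] _ NM3 [] chk_m3b X hX hR (by simp) with hb | ⟨g, N, hN, hA⟩
  swap
  · rw [List.mem_singleton] at hN
    exact Or.inr ⟨g, hN ▸ hA⟩
  rcases chk_spec (k := k) 32 [NHEX] _ NM3 [] chk_m3c X hX hR (by simp) with hc | ⟨g, N, hN, hA⟩
  swap
  · rw [List.mem_singleton] at hN
    exact Or.inr ⟨g, hN ▸ hA⟩
  left
  intro a h
  rcases mul_eq_zero.1 h with h | h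
  · rcases mul_eq_zero.1 h with h | h
    · apply ha
      intro i; fin_cases i <;> simp [Nat.testBit, h]
    · apply hb
      intro i; fin_cases i <;> simp [Nat.testBit, h]
  · apply hc
    intro i; fin_cases i <;> simp [Nat.testBit, h]

theorem m3_zero {k : Type*} [Field k] {X : Finset (Finset (Fin 6))} (hX : IsGenPattern 6 X)
    (hR : Avoid X NM3) (hH : ¬ Avoid X NHEX) (a : Fin 6 → k) (ha : a ∈ supportVariety k X) :
    a 1 * a 3 * a 5 = 0 := by
  by_contra hne
  have hz : ∀ i : Fin 6, (42 : ℕ).testBit i.val = true → a i ≠ 0 := by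
    obtain ⟨h13, h5⟩ := mul_ne_zero_iff.1 hne
    obtain ⟨h1, h3⟩ := mul_ne_zero_iff.1 h13
    intro i; fin_cases i <;> simp [Nat.testBit, h1, h3, h5]
  have hp : ∀ e L, (minorOK L && triOK 42 NM3 [2 ^ e] L) = true → Avoid X (2 ^ e) := by
    intro e L hL
    by_contra hA
    exact notMem_tri X hX 42 NM3 [2 ^ e] L hL hR (by simpa using hA) a hz ha
  have k1 := hp 1 _ tok_m3_1
  have k2 := hp 4 _ tok_m3_4
  have k3 := hp 16 _ tok_m3_16
  have k4 := hp 5 _ tok_m3_5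
  have k5 := hp 17 _ tok_m3_17
  have k6 := hp 20 _ tok_m3_20
  have k7 := hp 21 _ tok_m3_21
  have k8 := hp 7 _ tok_m3_7
  have k9 := hp 28 _ tok_m3_28
  have k10 := hp 49 _ tok_m3_49
  exact hH (Avoid.mono (by decide +kernel)
    ((((((((((hR.or k1).or k2).or k3).or k4).or k5).or k6).or k7).or k8).or k9).or k10))

theorem VL_hex {k : Type*} [Field k] {X : Finset (Finset (Fin 6))} (hX : IsGenPattern 6 X)
    (hR : Avoid X NHEX) : VL k X :=
  VL_of (Or.inr (Or.inr (Or.inr (Or.inr (Or.inr (hex_V X hX hR))))))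

theorem VL_M3 {k : Type*} [Field k] {X : Finset (Finset (Fin 6))} (hX : IsGenPattern 6 X)
    (hR : Avoid X NM3) : VL k X := by
  by_cases hH : Avoid X NHEX
  · exact VL_hex hX hH
  rcases m3_mem (k := k) hX hR with h | ⟨g, hA⟩
  · refine VL_of (Or.inr (Or.inr (Or.inr (Or.inr (Or.inl ?_)))))
    ext a
    exact ⟨m3_zero hX hR hH a, h a⟩
  · exact VL_act g (VL_hex (gen_act g X hX) hA)

theorem VL_seg {k : Type*} [Field k] {X : Finset (Finset (Fin 6))} (hX : IsGenPattern 6 X) (q : ℕ)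
    (hq : (Finset.univ.filter fun i : Fin 6 => i.val < q).card ≠ 5)
    (hI : IsoSeg X q) (h : ∀ a : Fin 6 → k, (∀ i : Fin 6, i.val < q → a i = 0) →
      a ∈ supportVariety k X) : VL k X := by
  refine VL_of (Or.inl ⟨Finset.univ.filter fun i : Fin 6 => i.val < q, hq, ?_⟩)
  ext a
  constructor
  · intro ha i hi
    rw [Finset.mem_filter] at hi
    exact iso_zero X hX i ((hI i).2 hi.2) a ha
  · intro ha
    exact h a fun i hi => ha i (by simpa using hi)

theorem VL_0 {k : Type*} [Field k] {X : Finset (Finset (Fin 6))} (hX : IsGenPattern 6 X)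
    (hI : IsoSeg X 0) : VL k X := by
  rcases chk_spec (k := k) 0 [NM1, NM2, NM3] _ 0 NI chk_main X hX (by intro t _ h; simp at h)
    hI.pos with h | ⟨g, N, hN, hA⟩
  · exact VL_seg hX 0 (by decide) hI fun a _ => h a (by simp)
  · refine VL_act g ?_
    have hX' := gen_act g X hX
    have hI' := isoSeg_leaf g hI
    simp only [List.mem_cons, List.not_mem_nil, or_false] at hN
    rcases hN with rfl | rfl | rfl
    · exact VL_M1 hX' hI' hA
    · exact VL_of (Or.inr (Or.inr (Or.inl (V_M2 hX' hI' hA))))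
    · exact VL_M3 hX' hA

theorem V_N5 {k : Type*} [Field k] {X : Finset (Finset (Fin 6))} (hX : IsGenPattern 6 X)
    (hI : IsoSeg X 1) (hR : Avoid X NN5) :
    supportVariety k X = {a | a 0 = 0 ∧ a 3 * a 5 = 0} := by
  ext a
  constructor
  · intro ha
    refine ⟨iso_zero X hX 0 ((hI 0).2 (by norm_num)) a ha, ?_⟩
    by_contra hne
    refine notMem_tri X hX 40 NN5 (NI.drop 1) _ tok_n5 hR hI.pos a ?_ ha
    obtain ⟨h3, h5⟩ := mul_ne_zero_iff.1 hne
    intro i; fin_cases i <;> simp [Nat.testBit, h3, h5]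
  · rintro ⟨h0, h⟩
    rcases mul_eq_zero.1 h with h | h
    · rcases chk_spec (k := k) 9 [] _ NN5 (NI.drop 1) chk_n5a X hX hR hI.pos with
        hh | ⟨_, _, hN, _⟩
      · apply hh
        intro i; fin_cases i <;> simp [Nat.testBit, h, h0]
      · simp at hN
    · rcases chk_spec (k := k) 33 [] _ NN5 (NI.drop 1) chk_n5b X hX hR hI.pos with
        hh | ⟨_, _, hN, _⟩
      · apply hh
        intro i; fin_cases i <;> simp [Nat.testBit, h, h0]
      · simp at hN

theorem VL_1 {k : Type*} [Field k] {X : Finset (Finset (Fin 6))} (hX : IsGenPattern 6 X)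
    (hI : IsoSeg X 1) : VL k X := by
  have h0 := hI.av 0 (by norm_num)
  rcases chk_spec (k := k) 1 [NN5] _ _ (NI.drop 1) chk_i1 X hX h0 hI.pos with h | ⟨g, N, hN, hA⟩
  · refine VL_seg hX 1 (by decide) hI fun a ha => h a ?_
    intro i; fin_cases i <;> simp [Nat.testBit, ha]
  · rw [List.mem_singleton] at hN
    subst hN
    refine VL_act g (VL_of (Or.inr (Or.inl (V_N5 (gen_act g X hX) ?_ hA))))
    have hg0 : Iso (act g X) 0 := (avoid_NI _ 0).1 (Avoid.mono (by decide +kernel) hA)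
    rw [iso_act', hI] at hg0
    have hg0' : g⁻¹ 0 = 0 := Fin.ext (by simpa using hg0)
    intro i
    rw [iso_act', hI, Nat.lt_one_iff, Nat.lt_one_iff]
    constructor
    · intro h
      have : g⁻¹ i = g⁻¹ 0 := by rw [hg0']; exact Fin.ext h
      rw [g⁻¹.injective this]
      rfl
    · intro h
      have : i = 0 := Fin.ext h
      rw [this, hg0']
      rfl

theorem VL_2 {k : Type*} [Field k] {X : Finset (Finset (Fin 6))} (hX : IsGenPattern 6 X)
    (hI : IsoSeg X 2) : VL k X := by
  have h0 := (hI.av 0 (by norm_num)).or (hI.av 1 (by norm_num))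
  rcases chk_spec (k := k) 3 [] _ _ (NI.drop 2) chk_i2 X hX (Avoid.mono (by decide +kernel) h0)
    hI.pos with h | ⟨g, N, hN, hA⟩
  · refine VL_seg hX 2 (by decide) hI fun a ha => h a ?_
    intro i; fin_cases i <;> simp [Nat.testBit, ha]
  · simp at hN

theorem VL_3 {k : Type*} [Field k] {X : Finset (Finset (Fin 6))} (hX : IsGenPattern 6 X)
    (hI : IsoSeg X 3) : VL k X := by
  have h0 := ((hI.av 0 (by norm_num)).or (hI.av 1 (by norm_num))).or (hI.av 2 (by norm_num))
  rcases chk_spec (k := k) 7 [] _ _ (NI.drop 3) chk_i3 X hX (Avoid.mono (by decide +kernel) h0)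
    hI.pos with h | ⟨g, N, hN, hA⟩
  · refine VL_seg hX 3 (by decide) hI fun a ha => h a ?_
    intro i; fin_cases i <;> simp [Nat.testBit, ha]
  · simp at hN

theorem VL_4 {k : Type*} [Field k] {X : Finset (Finset (Fin 6))} (hX : IsGenPattern 6 X)
    (hI : IsoSeg X 4) : VL k X := by
  have h0 := (((hI.av 0 (by norm_num)).or (hI.av 1 (by norm_num))).or (hI.av 2 (by norm_num))).or
    (hI.av 3 (by norm_num))
  rcases chk_spec (k := k) 15 [] _ _ (NI.drop 4) chk_i4 X hX (Avoid.mono (by decide +kernel) h0)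
    hI.pos with h | ⟨g, N, hN, hA⟩
  · refine VL_seg hX 4 (by decide) hI fun a ha => h a ?_
    intro i; fin_cases i <;> simp [Nat.testBit, ha]
  · simp at hN

theorem VL_6 {k : Type*} [Field k] {X : Finset (Finset (Fin 6))} (hX : IsGenPattern 6 X)
    (hI : IsoSeg X 6) : VL k X := by
  have h0 := (((((hI.av 0 (by norm_num)).or (hI.av 1 (by norm_num))).or
    (hI.av 2 (by norm_num))).or (hI.av 3 (by norm_num))).or (hI.av 4 (by norm_num))).or
    (hI.av 5 (by norm_num))
  rcases chk_spec (k := k) 63 [] _ _ (NI.drop 6) chk_i6 X hX (Avoid.mono (by decide +kernel) h0)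
    hI.pos with h | ⟨g, N, hN, hA⟩
  · refine VL_seg hX 6 (by decide) hI fun a ha => h a ?_
    intro i; fin_cases i <;> simp [ha]
  · simp at hN

theorem not_seg5 {X : Finset (Finset (Fin 6))} (hI : IsoSeg X 5) : False := by
  have h5 : Iso X 5 := by
    intro τ hτ h
    ext j
    rw [Finset.mem_singleton]
    constructor
    · intro hj
      by_contra hne
      have hj5 : j.val < 5 := by
        have := j.isLt
        have h2 : j.val ≠ 5 := fun e => hne (Fin.ext e)
        omega
      have := (hI j).2 hj5 τ hτ hj
      rw [this, Finset.mem_singleton] at h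
      exact hne h.symm
    · rintro rfl; exact h
  have := (hI 5).1 h5
  simp at this

theorem VL_all {k : Type*} [Field k] {X : Finset (Finset (Fin 6))} (hX : IsGenPattern 6 X) :
    VL k X := by
  set I := Finset.univ.filter fun i => Iso X i with hIdef
  set J := Finset.univ.filter fun i : Fin 6 => i.val < I.card with hJdef
  have hle : I.card ≤ 6 := by
    have := Finset.card_le_univ I
    simpa using this
  have hc : I.card = J.card := by
    have : ∀ q ≤ 6, q = (Finset.univ.filter fun i : Fin 6 => i.val < q).card := by decide
    exact this _ hle
  obtain ⟨g, hg⟩ := Equiv.Perm.exists_map_finset_eq I J hc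
  refine VL_act g ?_
  have hX' := gen_act g X hX
  have hI : IsoSeg (act g X) I.card := by
    intro i
    rw [iso_act']
    have h1 : Iso X (g⁻¹ i) ↔ g⁻¹ i ∈ I := by simp [hIdef]
    have h2 : i.val < I.card ↔ i ∈ J := by simp [hJdef]
    rw [h1, h2, ← hg, Finset.mem_map_equiv]
    rfl
  generalize I.card = q at hI hle
  interval_cases q
  · exact VL_0 hX' hI
  · exact VL_1 hX' hI
  · exact VL_2 hX' hI
  · exact VL_3 hX' hI
  · exact VL_4 hX' hI
  · exact (not_seg5 hI).elim
  · exact VL_6 hX' hI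


/-! ### Realization -/

def pat (N : ℕ) : Finset (Finset (Fin 6)) :=
  Finset.univ.filter fun τ => enc τ ≠ 0 ∧ N.testBit (enc τ) = false

theorem pat_avoid (N : ℕ) : Avoid (pat N) N := by
  intro t ht h hm
  unfold pat at hm
  rw [Finset.mem_filter, enc_dec t ht] at hm
  rw [h] at hm
  simp at hm

theorem gen_M1p : IsGenPattern 6 (pat NM1p) := by
  unfold IsGenPattern; decide +kernel
theorem gen_M2 : IsGenPattern 6 (pat NM2) := by
  unfold IsGenPattern; decide +kernel
theorem gen_M3 : IsGenPattern 6 (pat NM3) := by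
  unfold IsGenPattern; decide +kernel
theorem gen_N5 : IsGenPattern 6 (pat NN5) := by
  unfold IsGenPattern; decide +kernel
theorem gen_HEX : IsGenPattern 6 (pat NHEX) := by
  unfold IsGenPattern; decide +kernel
theorem seg_M1p : IsoSeg (pat NM1p) 0 := by
  unfold IsoSeg Iso; decide +kernel
theorem seg_M2 : IsoSeg (pat NM2) 0 := by
  unfold IsoSeg Iso; decide +kernel
theorem seg_N5 : IsoSeg (pat NN5) 1 := by
  unfold IsoSeg Iso; decide +kernel

theorem M3_not_hex (g : Equiv.Perm (Fin 6)) : ¬ Avoid (act g (pat NM3)) NHEX := by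
  intro h
  have h1 : ({0} : Finset (Fin 6)) ∈ pat NM3 := by decide +kernel
  have h2 := mem_act (g := g).2 h1
  rw [Finset.map_singleton] at h2
  have h3 : ∀ i : Fin 6, NHEX.testBit (enc {i}) = true := by decide +kernel
  have := h (enc {g 0}) (enc_lt _) (h3 _)
  rw [dec_enc] at this
  exact this h2

theorem V_M3 {k : Type*} [Field k] :
    supportVariety k (pat NM3) = {a | a 1 * a 3 * a 5 = 0} := by
  ext a
  have h1 : ¬ Avoid (pat NM3) NHEX := by
    have := M3_not_hex 1
    rwa [act_one] at this
  rcases m3_mem (k := k) gen_M3 (pat_avoid _) with h | ⟨g, hA⟩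
  · exact ⟨m3_zero gen_M3 (pat_avoid _) h1 a, h a⟩
  · exact (M3_not_hex g hA).elim

def patS (S : Finset (Fin 6)) : Finset (Finset (Fin 6)) :=
  Finset.univ.filter fun τ => τ.Nonempty ∧ ((∃ i, τ = {i}) ∨ τ = Sᶜ)

theorem patS_sing (S : Finset (Fin 6)) (i : Fin 6) : {i} ∈ patS S := by
  simp [patS]

theorem gen_patS (S : Finset (Fin 6)) : IsGenPattern 6 (patS S) := by
  constructor
  · intro σ hσ
    exact (Finset.mem_filter.1 hσ).2.1
  · intro i j hij
    exact ⟨{i}, patS_sing S i, by simp, by simpa using hij.symm⟩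

theorem iso_patS (S : Finset (Fin 6)) (i : Fin 6) (hi : i ∈ S) : Iso (patS S) i := by
  intro τ hτ h
  rcases (Finset.mem_filter.1 hτ).2.2 with ⟨j, rfl⟩ | rfl
  · rw [Finset.mem_singleton] at h
    rw [h]
  · simp [hi] at h

theorem V_patS {k : Type*} [Field k] (S : Finset (Fin 6)) (hS : S.card ≠ 5) :
    supportVariety k (patS S) = {a | ∀ i ∈ S, a i = 0} := by
  ext a
  refine ⟨fun ha i hi => iso_zero _ (gen_patS S) i (iso_patS S i hi) a ha, fun ha => ?_⟩
  refine memV_of_closed _ (gen_patS S) a {Sᶜ} ?_ ?_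
  · intro r hr i _
    rw [Finset.mem_singleton] at hr
    have hE : ∀ r : Finset (Fin 6), i ∉ r → ent (patS S) a r i = 0 := by
      intro r hi
      unfold ent
      rw [if_neg]
      intro h
      have := (h {i} (patS_sing S i) (by simp)).2 (by simp)
      exact hi this
    by_cases hi : i ∈ S
    · refine ⟨hE r (by simp [hr, hi]), ?_⟩
      unfold ent
      rw [ha i hi, if_pos (mem_flp.2 (by simp [hr, hi])), mul_zero, ite_self]
    · have hir : i ∈ r := by simp [hr, hi]
      refine ⟨?_, hE _ (by simp [mem_flp, hir])⟩
      unfold ent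
      rw [if_neg]
      intro h
      have hmem : r ∈ patS S := by
        rw [patS, Finset.mem_filter]
        exact ⟨Finset.mem_univ _, ⟨i, hir⟩, Or.inr hr⟩
      have hd := (h r hmem hir).1 hir
      have hem : r.erase i = ∅ := by
        have := hd (Finset.erase_subset i r) le_rfl
        exact Finset.subset_empty.1 this
      apply hS
      have h1 := Finset.card_erase_of_mem hir
      have h2 := Finset.card_compl S
      rw [hem, Finset.card_empty] at h1
      rw [← hr] at h2
      have h3 : 0 < r.card := Finset.card_pos.2 ⟨i, hir⟩
      simp only [Fintype.card_fin] at h2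
      omega
  · by_cases h : Even (Sᶜ).card
    · rw [Finset.filter_singleton, Finset.filter_singleton, if_pos h, if_neg (not_not.2 h)]
      simp
    · rw [Finset.filter_singleton, Finset.filter_singleton, if_neg h, if_pos h]
      simp

theorem six_generated_classification (k : Type*) [Field k] [IsAlgClosed k] :
    (∀ X : Finset (Finset (Fin 6)), IsGenPattern 6 X →
      ∃ π : Equiv.Perm (Fin 6),
        VarietyListSix k ((fun a => fun i => a (π i)) '' supportVariety k X)) ∧
    (∀ V : Set (Fin 6 → k), VarietyListSix k V →
      ∃ X : Finset (Finset (Fin 6)), IsGenPattern 6 X ∧ supportVariety k X = V) := by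
  refine ⟨fun X hX => VL_image (VL_all hX), ?_⟩
  rintro V (⟨S, hS, rfl⟩ | rfl | rfl | rfl | rfl | rfl)
  · exact ⟨_, gen_patS S, V_patS S hS⟩
  · exact ⟨_, gen_N5, V_N5 gen_N5 seg_N5 (pat_avoid _)⟩
  · exact ⟨_, gen_M2, V_M2 gen_M2 seg_M2 (pat_avoid _)⟩
  · exact ⟨_, gen_M1p, V_M1p gen_M1p seg_M1p (pat_avoid _)⟩
  · exact ⟨_, gen_M3, V_M3⟩
  · exact ⟨_, gen_HEX, hex_V _ gen_HEX (pat_avoid _)⟩
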